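/- Let d ≥ 2 and set C_d = 2(3e^{1/4} − 2)²(5 + 4/(d−1))². Define the weight w₂(z,t) = (1+|z|²+t²)^{−1/2}. Then for every σ ∈ ℂ with Im σ ≠ 0 and every f ∈ 𝒮(ℝ^{2d+1}), ∫ w₂(z,t)² |f(z,t)|² dz dt ≤ C_d² ∫ w₂(z,t)^{−2} |Δ_H f(z,t) + σ f(z,t)|² dz dt. This is the uniform resolvent estimate ‖w₂ (L−σ)^{−1} w₂‖ ≤ C_d, L = −Δ_H, in a priori form on Schwartz functions. -/

import Mathlib

noncomputable section

open MeasureTheory ENNReal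

/-- The Heisenberg group ℍ^d modeled on ℝ^d × ℝ^d × ℝ. -/
abbrev Hd (d : ℕ) : Type := EuclideanSpace ℝ (Fin d) × EuclideanSpace ℝ (Fin d) × ℝ

/-- The left-invariant vector field `X_j = ∂_{x_j} + 2 y_j ∂_t`. -/
def Xop (d : ℕ) (j : Fin d) (f : Hd d → ℂ) (p : Hd d) : ℂ :=
  fderiv ℝ f p (EuclideanSpace.single j 1, 0, 2 * p.2.1 j)

/-- The left-invariant vector field `Y_j = ∂_{y_j} - 2 x_j ∂_t`. -/
def Yop (d : ℕ) (j : Fin d) (f : Hd d → ℂ) (p : Hd d) : ℂ :=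
  fderiv ℝ f p (0, EuclideanSpace.single j 1, -(2 * p.1 j))

/-- The vertical derivative `T = ∂_t`. -/
def Tder (d : ℕ) (f : Hd d → ℂ) (p : Hd d) : ℂ :=
  fderiv ℝ f p (0, 0, 1)

/-- The rotation operator `N = Σ_j (y_j ∂_{x_j} - x_j ∂_{y_j})`. -/
def Nop (d : ℕ) (f : Hd d → ℂ) (p : Hd d) : ℂ :=
  fderiv ℝ f p (p.2.1, -p.1, 0)

/-- The sublaplacian `Δ_H = Σ_j (X_j² + Y_j²)`. -/
def subLap (d : ℕ) (f : Hd d → ℂ) (p : Hd d) : ℂ :=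
  ∑ j : Fin d, (Xop d j (Xop d j f) p + Yop d j (Yop d j f) p)

/-- Squared length of the horizontal gradient: `|∇_H f|² = Σ_j (|X_j f|² + |Y_j f|²)`. -/
def gradHsq (d : ℕ) (f : Hd d → ℂ) (p : Hd d) : ℝ :=
  ∑ j : Fin d, (‖Xop d j f p‖ ^ 2 + ‖Yop d j f p‖ ^ 2)

/-- `|z|² = |x|² + |y|²`. -/
def zsq (d : ℕ) (p : Hd d) : ℝ := ‖p.1‖ ^ 2 + ‖p.2.1‖ ^ 2

/-- `|z|`. -/
def zn (d : ℕ) (p : Hd d) : ℝ := Real.sqrt (zsq d p)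

/-- The weight `w₁(z,t) = |z| (1+|z|²)^{-1/2} (1 + (|z|⁴+t²)^{1/2})⁻¹`. -/
def w1 (d : ℕ) (p : Hd d) : ℝ :=
  zn d p / Real.sqrt (1 + zn d p ^ 2) / (1 + Real.sqrt (zn d p ^ 4 + p.2.2 ^ 2))

/-- The weight `w₂(z,t) = (1+|z|²+t²)^{-1/2}`. -/
def w2 (d : ℕ) (p : Hd d) : ℝ :=
  (Real.sqrt (1 + zsq d p + p.2.2 ^ 2))⁻¹

/-- The weight `w₄(z,t) = |z| (|z|⁴+t²)^{-1/2}`. -/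
def w4 (d : ℕ) (p : Hd d) : ℝ :=
  zn d p / Real.sqrt (zn d p ^ 4 + p.2.2 ^ 2)

set_option linter.unusedSectionVars false

namespace Heis
open SchwartzMap
open scoped LineDeriv ContDiff FourierTransform

variable {E : Type} [NormedAddCommGroup E] [NormedSpace ℝ E]
variable {F : Type} [NormedAddCommGroup F] [NormedSpace ℝ F] [NormedSpace ℂ F]
  [IsScalarTower ℝ ℂ F]

/-- The character `e^{-2πi tλ}`. -/
def phase (t l : ℝ) : ℂ := Complex.exp (((-(2 * Real.pi * (t * l)) : ℝ) : ℂ) * Complex.I)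

lemma norm_phase (t l : ℝ) : ‖phase t l‖ = 1 := Complex.norm_exp_ofReal_mul_I _

lemma continuous_phase (l : ℝ) : Continuous fun t => phase t l := by
  unfold phase; fun_prop

/-- The partial Fourier transform in the last variable. -/
def partialFourierFun (h : E × ℝ → F) (p : E × ℝ) : F := ∫ t : ℝ, phase t p.2 • h (p.1, t)

/-- Every Schwartz function is dominated by an integrable function of the last variable. -/
lemma exists_bound_slice {G : Type*} [NormedAddCommGroup G] [NormedSpace ℝ G]
    (h : 𝓢(E × ℝ, G)) (k : ℕ) :
    ∃ C : ℝ, 0 < C ∧ ∀ (z : E) (t : ℝ), ‖z‖ ^ k * ‖h (z, t)‖ ≤ C * (1 + t ^ 2)⁻¹ := by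
  obtain ⟨C₁, hC₁, h₁⟩ := h.decay k 0
  obtain ⟨C₂, hC₂, h₂⟩ := h.decay (k + 2) 0
  refine ⟨C₁ + C₂, by positivity, fun z t => ?_⟩
  have a₁ := h₁ (z, t)
  have a₂ := h₂ (z, t)
  simp only [norm_iteratedFDeriv_zero] at a₁ a₂
  have hz : ‖z‖ ≤ ‖(z, t)‖ := norm_fst_le (z, t)
  have ht : ‖t‖ ≤ ‖(z, t)‖ := norm_snd_le (z, t)
  rw [← div_eq_mul_inv, le_div_iff₀ (by positivity)]
  have e1 : ‖z‖ ^ k * ‖h (z, t)‖ ≤ C₁ := le_trans (by gcongr) a₁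
  have e2 : ‖z‖ ^ k * ‖t‖ ^ 2 * ‖h (z, t)‖ ≤ C₂ := by
    refine le_trans ?_ a₂
    rw [pow_add]; gcongr
  rw [Real.norm_eq_abs, sq_abs] at e2
  nlinarith

lemma integrable_slice {G : Type*} [NormedAddCommGroup G] [NormedSpace ℝ G]
    (h : 𝓢(E × ℝ, G)) (z : E) : Integrable fun t => h (z, t) := by
  obtain ⟨C, hC, hb⟩ := exists_bound_slice h 0
  refine (integrable_inv_one_add_sq.const_mul C).mono' ?_ (.of_forall fun t => ?_)
  · exact (h.continuous.comp (by fun_prop)).aestronglyMeasurable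
  · simpa using hb z t

lemma integrable_phase_slice (h : 𝓢(E × ℝ, F)) (p : E × ℝ) :
    Integrable fun t => phase t p.2 • h (p.1, t) := by
  refine (integrable_slice h p.1).norm.mono' ?_ (.of_forall fun t => ?_)
  · exact ((continuous_phase _).smul (h.continuous.comp (by fun_prop))).aestronglyMeasurable
  · rw [norm_smul, norm_phase, one_mul]

variable (E F) in
/-- Restriction of a linear map on `E × ℝ` to `E`, extended by zero. -/
def horizL : (E × ℝ →L[ℝ] F) →L[ℝ] (E × ℝ →L[ℝ] F) :=
  (ContinuousLinearMap.compL ℝ (E × ℝ) (E × ℝ) F).flip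
    ((ContinuousLinearMap.inl ℝ E ℝ).comp (ContinuousLinearMap.fst ℝ E ℝ))

variable (E F) in
/-- `v ↦ v ⊗ dλ`. -/
def vertL : F →L[ℝ] (E × ℝ →L[ℝ] F) :=
  ContinuousLinearMap.smulRightL ℝ (E × ℝ) F (ContinuousLinearMap.snd ℝ E ℝ)

lemma hasTemperateGrowth_clm {D G : Type*} [NormedAddCommGroup D] [NormedSpace ℝ D]
    [NormedAddCommGroup G] [NormedSpace ℝ G] (L : D →L[ℝ] G) :
    Function.HasTemperateGrowth (fun x => L x) := by fun_prop

/-- Multiplication by a complex linear form `2πi ℓ`. -/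
def mulForm {D : Type*} [NormedAddCommGroup D] [NormedSpace ℝ D] (c : ℂ) (l : D →L[ℝ] ℝ)
    (h : 𝓢(D, F)) : 𝓢(D, F) := smulLeftCLM F (fun x => c * (l x : ℂ)) h

@[simp] lemma mulForm_apply {D : Type*} [NormedAddCommGroup D] [NormedSpace ℝ D] (c : ℂ)
    (l : D →L[ℝ] ℝ) (h : 𝓢(D, F)) (x : D) : mulForm c l h x = (c * (l x : ℂ)) • h x := by
  rw [mulForm, smulLeftCLM_apply_apply (by fun_prop)]

variable (E) in
/-- The coordinate `t`. -/
abbrev tForm : E × ℝ →L[ℝ] ℝ := ContinuousLinearMap.snd ℝ E ℝ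

/-- The Schwartz function whose partial Fourier transform is the derivative of that of `h`. -/
def partialFourierDeriv (h : 𝓢(E × ℝ, F)) : 𝓢(E × ℝ, E × ℝ →L[ℝ] F) :=
  postcompCLM (𝕜 := ℝ) (horizL E F) (fderivCLM ℝ (E × ℝ) F h)
    + postcompCLM (𝕜 := ℝ) (vertL E F) (mulForm (-(2 * Real.pi * Complex.I)) (tForm E) h)

lemma hasDerivAt_phase (t l : ℝ) :
    HasDerivAt (fun l => phase t l) (-(2 * Real.pi * Complex.I) * t * phase t l) l := by
  unfold phase
  have : HasDerivAt (fun l : ℝ => ((-(2 * Real.pi * (t * l)) : ℝ) : ℂ) * Complex.I)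
      (((-(2 * Real.pi * (t * 1)) : ℝ) : ℂ) * Complex.I) l := by
    refine HasDerivAt.mul_const ?_ _
    exact (((hasDerivAt_id l).const_mul t).const_mul _).neg.ofReal_comp
  convert this.cexp using 1
  push_cast; ring

lemma partialFourierDeriv_apply (h : 𝓢(E × ℝ, F)) (p : E × ℝ) (v : E × ℝ) :
    partialFourierDeriv h p v = fderiv ℝ h p (v.1, 0)
      + v.2 • ((-(2 * Real.pi * Complex.I) * (p.2 : ℂ)) • h p) := by
  have : fderivCLM ℝ (E × ℝ) F h p = fderiv ℝ h p := rfl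
  simp [partialFourierDeriv, horizL, vertL, this]

lemma hasFDerivAt_phase_slice (h : 𝓢(E × ℝ, F)) (t : ℝ) (p : E × ℝ) :
    HasFDerivAt (fun p : E × ℝ => phase t p.2 • h (p.1, t))
      (phase t p.2 • partialFourierDeriv h (p.1, t)) p := by
  have h1 : HasFDerivAt (fun p : E × ℝ => h (p.1, t))
      ((fderiv ℝ h (p.1, t)).comp
        ((ContinuousLinearMap.inl ℝ E ℝ).comp (ContinuousLinearMap.fst ℝ E ℝ))) p := by
    have : HasFDerivAt (fun p : E × ℝ => (p.1, t))
        ((ContinuousLinearMap.inl ℝ E ℝ).comp (ContinuousLinearMap.fst ℝ E ℝ)) p := by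
      have := (hasFDerivAt_fst (𝕜 := ℝ) (p := p)).prodMk (hasFDerivAt_const t p)
      refine this.congr_fderiv ?_
      ext <;> simp
    exact (h.differentiableAt.hasFDerivAt).comp p this
  have h2 : HasFDerivAt (fun p : E × ℝ => phase t p.2) _ p :=
    ((hasDerivAt_phase t p.2).hasFDerivAt).comp p (hasFDerivAt_snd (𝕜 := ℝ) (p := p))
  refine (h2.smul h1).congr_fderiv ?_
  ext v
  · simp [partialFourierDeriv_apply]
  · simp only [ContinuousLinearMap.comp_apply, add_apply,
      smul_apply, partialFourierDeriv_apply]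
    simp [smul_smul]
    ring_nf

lemma hasFDerivAt_partialFourierFun (h : 𝓢(E × ℝ, F)) (p : E × ℝ) :
    HasFDerivAt (partialFourierFun h) (partialFourierFun (partialFourierDeriv h) p) p := by
  obtain ⟨C, hC, hb⟩ := exists_bound_slice (partialFourierDeriv h) 0
  refine hasFDerivAt_integral_of_dominated_of_fderiv_le (𝕜 := ℝ)
    (F := fun (p : E × ℝ) t => phase t p.2 • h (p.1, t))
    (F' := fun p t => phase t p.2 • partialFourierDeriv h (p.1, t))
    (bound := fun t => C * (1 + t ^ 2)⁻¹) Filter.univ_mem ?_ (integrable_phase_slice h p) ?_ ?_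
    (integrable_inv_one_add_sq.const_mul C) (.of_forall fun t p _ => hasFDerivAt_phase_slice h t p)
  · exact .of_forall fun p => (integrable_phase_slice h p).aestronglyMeasurable
  · exact (integrable_phase_slice (partialFourierDeriv h) p).aestronglyMeasurable
  · refine .of_forall fun t p _ => ?_
    rw [norm_smul, norm_phase, one_mul]
    simpa using hb p.1 t

lemma contDiff_partialFourierFun (n : ℕ) : ∀ {F : Type} [NormedAddCommGroup F] [NormedSpace ℝ F]
    [NormedSpace ℂ F] [IsScalarTower ℝ ℂ F] (h : 𝓢(E × ℝ, F)),
    ContDiff ℝ n (partialFourierFun h) := by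
  induction n with
  | zero =>
    intro F _ _ _ _ h
    refine contDiff_zero.2 (continuous_iff_continuousAt.2 fun p => ?_)
    exact (hasFDerivAt_partialFourierFun h p).continuousAt
  | succ n ih =>
    intro F _ _ _ _ h
    refine contDiff_succ_iff_hasFDerivAt.2 ⟨_, ih (partialFourierDeriv h), fun p => ?_⟩
    exact hasFDerivAt_partialFourierFun h p

lemma fderiv_partialFourierFun (h : 𝓢(E × ℝ, F)) :
    fderiv ℝ (partialFourierFun h) = partialFourierFun (partialFourierDeriv h) :=
  funext fun p => (hasFDerivAt_partialFourierFun h p).fderiv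

/-- The derivative in the last variable. -/
def dT {G : Type*} [NormedAddCommGroup G] [NormedSpace ℝ G] (h : 𝓢(E × ℝ, G)) : 𝓢(E × ℝ, G) :=
  ∂_{((0 : E), (1 : ℝ))} h

/-- The derivative in the direction `v` of `E`. -/
def dZ {G : Type*} [NormedAddCommGroup G] [NormedSpace ℝ G] (v : E) (h : 𝓢(E × ℝ, G)) :
    𝓢(E × ℝ, G) :=
  ∂_{(v, (0 : ℝ))} h

lemma dT_apply {G : Type*} [NormedAddCommGroup G] [NormedSpace ℝ G] (h : 𝓢(E × ℝ, G))
    (p : E × ℝ) : dT h p = fderiv ℝ h p (0, 1) := lineDerivOp_apply_eq_fderiv ..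

lemma dZ_apply {G : Type*} [NormedAddCommGroup G] [NormedSpace ℝ G] (v : E) (h : 𝓢(E × ℝ, G))
    (p : E × ℝ) : dZ v h p = fderiv ℝ h p (v, 0) := lineDerivOp_apply_eq_fderiv ..

lemma hasDerivAt_slice {G : Type*} [NormedAddCommGroup G] [NormedSpace ℝ G] (h : 𝓢(E × ℝ, G))
    (z : E) (t : ℝ) : HasDerivAt (fun t => h (z, t)) (dT h (z, t)) t := by
  rw [dT_apply]
  have h2 : HasDerivAt (fun t : ℝ => (z, t)) (0, 1) t :=
    (hasDerivAt_const t z).prodMk (hasDerivAt_id t)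
  exact (h.differentiableAt.hasFDerivAt).comp_hasDerivAt t h2

lemma partialFourierFun_lineDeriv_t (h : 𝓢(E × ℝ, F)) (p : E × ℝ) :
    partialFourierFun (dT h) p
      = (2 * Real.pi * Complex.I * (p.2 : ℂ)) • partialFourierFun h p := by
  unfold partialFourierFun
  have h1 (t : ℝ) := hasDerivAt_slice h p.1 t
  have h3 (t : ℝ) : HasDerivAt (fun t => phase t p.2)
      (-(2 * Real.pi * Complex.I) * p.2 * phase t p.2) t := by
    have := hasDerivAt_phase p.2 t
    simpa only [phase, mul_comm] using this
  have h4 (t : ℝ) := (h3 t).smul (h1 t)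
  have h5 : Integrable fun t => (-(2 * Real.pi * Complex.I) * (p.2 : ℂ)) • phase t p.2 • h (p.1, t) :=
    (integrable_phase_slice h p).smul _
  have key := integral_eq_zero_of_hasDerivAt_of_integrable h4
    ?_ (integrable_phase_slice h p)
  · have e1 : ∀ t : ℝ, (-(2 * Real.pi * Complex.I) * p.2 * phase t p.2) • h (p.1, t)
        = (-(2 * Real.pi * Complex.I) * p.2) • (phase t p.2 • h (p.1, t)) := fun t => by
      rw [smul_smul]
    simp only [e1] at key
    rw [integral_add (integrable_phase_slice (dT h) p)
      h5, integral_smul] at key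
    rw [eq_neg_of_add_eq_zero_left key, ← neg_smul]
    ring_nf
  · refine (integrable_phase_slice (dT h) p).add ?_
    simpa only [mul_smul (_ * (p.2 : ℂ))] using h5

lemma partialFourierFun_decay_snd (k : ℕ) : ∀ (h : 𝓢(E × ℝ, F)),
    ∃ C, ∀ p, |p.2| ^ k * ‖partialFourierFun h p‖ ≤ C := by
  induction k with
  | zero =>
    intro h
    obtain ⟨C, hC, hb⟩ := exists_bound_slice h 0
    refine ⟨∫ t, C * (1 + t ^ 2)⁻¹, fun p => ?_⟩
    rw [pow_zero, one_mul]
    refine norm_integral_le_of_norm_le (integrable_inv_one_add_sq.const_mul C)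
      (.of_forall fun t => ?_)
    rw [norm_smul, norm_phase, one_mul]
    simpa using hb p.1 t
  | succ k ih =>
    intro h
    obtain ⟨C, hC⟩ := ih (dT h)
    refine ⟨C, fun p => le_trans ?_ (hC p)⟩
    rw [partialFourierFun_lineDeriv_t, norm_smul]
    have : ‖(2 * Real.pi * Complex.I * (p.2 : ℂ))‖ = 2 * Real.pi * |p.2| := by
      simp [abs_of_pos Real.pi_pos]
    rw [this]
    have : 0 ≤ |p.2| ^ k * |p.2| * ‖partialFourierFun h p‖ := by positivity
    have h3 := Real.pi_gt_three
    calc _ = |p.2| ^ k * |p.2| * ‖partialFourierFun h p‖ := by ring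
      _ ≤ 2 * Real.pi * (|p.2| ^ k * |p.2| * ‖partialFourierFun h p‖) := by nlinarith
      _ = _ := by ring

lemma partialFourierFun_decay_fst (k : ℕ) (h : 𝓢(E × ℝ, F)) :
    ∃ C, ∀ p, ‖p.1‖ ^ k * ‖partialFourierFun h p‖ ≤ C := by
  obtain ⟨C, hC, hb⟩ := exists_bound_slice h k
  refine ⟨∫ t, C * (1 + t ^ 2)⁻¹, fun p => ?_⟩
  rw [← norm_norm p.1, ← norm_pow, ← norm_smul]
  unfold partialFourierFun
  rw [← integral_smul]
  refine norm_integral_le_of_norm_le (integrable_inv_one_add_sq.const_mul C)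
    (.of_forall fun t => ?_)
  rw [norm_smul, norm_smul, norm_phase, one_mul]
  simpa using hb p.1 t

lemma partialFourierFun_decay (k n : ℕ) : ∀ {F : Type} [NormedAddCommGroup F] [NormedSpace ℝ F]
    [NormedSpace ℂ F] [IsScalarTower ℝ ℂ F] (h : 𝓢(E × ℝ, F)),
    ∃ C, ∀ p, ‖p‖ ^ k * ‖iteratedFDeriv ℝ n (partialFourierFun h) p‖ ≤ C := by
  induction n with
  | zero =>
    intro F _ _ _ _ h
    obtain ⟨C₁, h₁⟩ := partialFourierFun_decay_fst k h
    obtain ⟨C₂, h₂⟩ := partialFourierFun_decay_snd k h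
    refine ⟨max C₁ C₂, fun p => ?_⟩
    rw [norm_iteratedFDeriv_zero, Prod.norm_def]
    rcases max_choice ‖p.1‖ ‖p.2‖ with e | e <;> rw [e]
    · exact (h₁ p).trans (le_max_left _ _)
    · exact (h₂ p).trans (le_max_right _ _)
  | succ n ih =>
    intro F _ _ _ _ h
    obtain ⟨C, hC⟩ := ih (partialFourierDeriv h)
    refine ⟨C, fun p => ?_⟩
    rw [← norm_iteratedFDeriv_fderiv, fderiv_partialFourierFun]
    exact hC p

/-- The partial Fourier transform of a Schwartz function in the last variable. -/
def pF (h : 𝓢(E × ℝ, F)) : 𝓢(E × ℝ, F) where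
  toFun := partialFourierFun h
  smooth' := contDiff_infty.2 fun n => contDiff_partialFourierFun n h
  decay' k n := partialFourierFun_decay k n h

lemma pF_apply (h : 𝓢(E × ℝ, F)) (z : E) (l : ℝ) :
    pF h (z, l) = ∫ t : ℝ, phase t l • h (z, t) := rfl

lemma pF_zero : pF (0 : 𝓢(E × ℝ, F)) = 0 := by
  ext ⟨z, l⟩; simp [pF_apply]

lemma pF_add (h k : 𝓢(E × ℝ, F)) : pF (h + k) = pF h + pF k := by
  ext ⟨z, l⟩
  simp only [pF_apply, add_apply, smul_add]
  exact integral_add (integrable_phase_slice h (z, l)) (integrable_phase_slice k (z, l))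

lemma pF_smul (c : ℂ) (h : 𝓢(E × ℝ, ℂ)) : pF (c • h) = c • pF h := by
  ext ⟨z, l⟩
  simp only [pF_apply, smul_apply, smul_eq_mul, mul_left_comm _ c]
  exact integral_const_mul _ _

lemma pF_sum {ι : Type*} (s : Finset ι) (h : ι → 𝓢(E × ℝ, F)) :
    pF (∑ i ∈ s, h i) = ∑ i ∈ s, pF (h i) := by
  classical
  induction s using Finset.induction_on with
  | empty => ext ⟨z, l⟩; simp [pF_apply]
  | insert a s ha ih => rw [Finset.sum_insert ha, Finset.sum_insert ha, pF_add, ih]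

lemma pF_lineDeriv_t (h : 𝓢(E × ℝ, F)) :
    pF (dT h) = mulForm (2 * Real.pi * Complex.I) (tForm E) (pF h) := by
  ext p
  rw [mulForm_apply]
  exact partialFourierFun_lineDeriv_t h p

lemma fderiv_pF (h : 𝓢(E × ℝ, ℂ)) (p v : E × ℝ) :
    fderiv ℝ (pF h) p v = pF (dZ v.1 h) p
      + v.2 • pF (mulForm (-(2 * Real.pi * Complex.I)) (tForm E) h) p := by
  have : fderiv ℝ (pF h) p = partialFourierFun (partialFourierDeriv h) p :=
    congrFun (fderiv_partialFourierFun h) p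
  obtain ⟨z, l⟩ := p
  rw [this, partialFourierFun, ContinuousLinearMap.integral_apply
    (integrable_phase_slice (partialFourierDeriv h) (z, l)), pF_apply, pF_apply, ← integral_smul,
    ← integral_add]
  · congr 1; ext t
    simp only [smul_apply, partialFourierDeriv_apply, dZ_apply, mulForm_apply,
      smul_eq_mul, Complex.real_smul, ContinuousLinearMap.coe_snd']
    ring
  · exact integrable_phase_slice _ (z, l)
  · exact (integrable_phase_slice _ (z, l)).smul _

lemma lineDeriv_pF (h : 𝓢(E × ℝ, ℂ)) (v : E) :
    dZ v (pF h) = pF (dZ v h) := by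
  ext p; rw [dZ_apply, fderiv_pF]; simp

lemma lineDeriv_t_pF (h : 𝓢(E × ℝ, ℂ)) :
    dT (pF h) = pF (mulForm (-(2 * Real.pi * Complex.I)) (tForm E) h) := by
  ext p
  rw [dT_apply, fderiv_pF]
  have : dZ (0 : E) h = 0 := by ext q; rw [dZ_apply]; exact map_zero _
  simp [this, pF_zero]

lemma pF_mulForm_fst (c : ℂ) (l : E →L[ℝ] ℝ) (h : 𝓢(E × ℝ, ℂ)) :
    pF (mulForm c (l.comp (ContinuousLinearMap.fst ℝ E ℝ)) h)
      = mulForm c (l.comp (ContinuousLinearMap.fst ℝ E ℝ)) (pF h) := by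
  ext ⟨z, s⟩
  simp only [pF_apply, mulForm_apply, smul_eq_mul, mul_left_comm (phase _ _)]
  simp only [ContinuousLinearMap.comp_apply, ContinuousLinearMap.coe_fst']
  exact integral_const_mul _ _

end Heis

namespace Heis
open SchwartzMap
open scoped LineDeriv ContDiff FourierTransform ComplexConjugate

section algebra
variable {D : Type*} [NormedAddCommGroup D] [NormedSpace ℝ D]

/-- Complex conjugation of Schwartz functions. -/
def cj (f : 𝓢(D, ℂ)) : 𝓢(D, ℂ) :=
  postcompCLM (𝕜 := ℝ) (Complex.conjCLE : ℂ →L[ℝ] ℂ) f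

@[simp] lemma cj_apply (f : 𝓢(D, ℂ)) (x : D) : cj f x = conj (f x) := rfl

/-- The product of two Schwartz functions. -/
def mulS (f g : 𝓢(D, ℂ)) : 𝓢(D, ℂ) := pairing (ContinuousLinearMap.mul ℂ ℂ) f g

@[simp] lemma mulS_apply (f g : 𝓢(D, ℂ)) (x : D) : mulS f g x = f x * g x := rfl

lemma lineDeriv_mulS (v : D) (f g : 𝓢(D, ℂ)) (x : D) :
    (∂_{v} (mulS f g) : 𝓢(D, ℂ)) x
      = (∂_{v} f : 𝓢(D, ℂ)) x * g x + f x * (∂_{v} g : 𝓢(D, ℂ)) x := by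
  simp only [lineDerivOp_apply_eq_fderiv]
  have : (⇑(mulS f g)) = fun x => f x * g x := rfl
  rw [this, fderiv_fun_mul f.differentiableAt g.differentiableAt]
  simp; ring

lemma lineDeriv_cj (v : D) (f : 𝓢(D, ℂ)) : ∂_{v} (cj f) = cj (∂_{v} f) := by
  ext x
  simp only [lineDerivOp_apply_eq_fderiv, cj_apply]
  have : (⇑(cj f)) = (Complex.conjCLE : ℂ →L[ℝ] ℂ) ∘ f := rfl
  rw [this, ((Complex.conjCLE : ℂ →L[ℝ] ℂ).hasFDerivAt.comp x
    f.differentiableAt.hasFDerivAt).fderiv]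
  simp

lemma lineDeriv_mulForm (c : ℂ) (l : D →L[ℝ] ℝ) (v : D) (f : 𝓢(D, ℂ)) (x : D) :
    (∂_{v} (mulForm c l f) : 𝓢(D, ℂ)) x
      = c * l v * f x + c * l x * (∂_{v} f : 𝓢(D, ℂ)) x := by
  simp only [lineDerivOp_apply_eq_fderiv]
  have : (⇑(mulForm c l f)) = fun x => (c * (l x : ℂ)) * f x := by
    ext x; simp
  have h1 : HasFDerivAt (fun x => (c * (l x : ℂ)))
      (c • (Complex.ofRealCLM.comp l)) x :=
    ((Complex.ofRealCLM.comp l).hasFDerivAt (x := x)).const_mul c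
  rw [this, (h1.fun_mul f.differentiableAt.hasFDerivAt).fderiv]
  simp; ring

end algebra

section measure
variable {D : Type*} [NormedAddCommGroup D] [NormedSpace ℝ D] [FiniteDimensional ℝ D]
  [MeasureSpace D] [BorelSpace D] [(volume : Measure D).IsAddHaarMeasure]

lemma integrable_mul_conj (f g : 𝓢(D, ℂ)) : Integrable fun x => f x * conj (g x) :=
  (mulS f (cj g)).integrable

lemma integrable_normSq (f : 𝓢(D, ℂ)) : Integrable fun x => ‖f x‖ ^ 2 := by
  refine (integrable_mul_conj f f).norm.congr (.of_forall fun x => ?_)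
  simp [sq]

/-- Integration by parts for the sesquilinear pairing. -/
lemma integral_lineDeriv_mul_conj (v : D) (f g : 𝓢(D, ℂ)) :
    ∫ x, (∂_{v} f : 𝓢(D, ℂ)) x * conj (g x) = - ∫ x, f x * conj ((∂_{v} g : 𝓢(D, ℂ)) x) := by
  have := SchwartzMap.integral_mul_lineDerivOp_right_eq_neg_left (μ := (volume : Measure D))
    f (cj g) v
  rw [lineDeriv_cj] at this
  simp only [cj_apply] at this
  rw [this, neg_neg]

end measure

section product
variable {E : Type} [NormedAddCommGroup E] [NormedSpace ℝ E] [FiniteDimensional ℝ E]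
  [MeasureSpace E] [BorelSpace E] [(volume : Measure E).IsAddHaarMeasure]

instance : (volume : Measure (E × ℝ)).IsAddHaarMeasure :=
  inferInstanceAs ((volume : Measure E).prod (volume : Measure ℝ)).IsAddHaarMeasure

lemma integral_prod_S (h : 𝓢(E × ℝ, ℂ)) : ∫ p, h p = ∫ z, ∫ t, h (z, t) :=
  integral_prod _ h.integrable

lemma integral_prod_S_symm (h : 𝓢(E × ℝ, ℂ)) : ∫ p, h p = ∫ t, ∫ z, h (z, t) :=
  integral_prod_symm _ h.integrable

/-- The restriction of a Schwartz function to a vertical line. -/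
def sliceT (z : E) (h : 𝓢(E × ℝ, ℂ)) : 𝓢(ℝ, ℂ) :=
  compCLM ℝ (g := fun t : ℝ => (z, t)) (by
      have : (fun t : ℝ => (z, t)) = fun t => (z, (0 : ℝ)) + ContinuousLinearMap.inr ℝ E ℝ t := by
        ext t <;> simp
      rw [this]; fun_prop)
    ⟨1, 1, fun t => by
      have := norm_snd_le (z, t)
      simp only at this
      linarith⟩ h

@[simp] lemma sliceT_apply (z : E) (h : 𝓢(E × ℝ, ℂ)) (t : ℝ) : sliceT z h t = h (z, t) := rfl

/-- The restriction of a Schwartz function to a horizontal slice. -/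
def sliceE (s : ℝ) (h : 𝓢(E × ℝ, ℂ)) : 𝓢(E, ℂ) :=
  compCLM ℝ (g := fun z : E => (z, s)) (by
      have : (fun z : E => (z, s)) = fun z => ((0 : E), s) + ContinuousLinearMap.inl ℝ E ℝ z := by
        ext t <;> simp
      rw [this]; fun_prop)
    ⟨1, 1, fun z => by
      have := norm_fst_le (z, s)
      simp only at this
      linarith⟩ h

@[simp] lemma sliceE_apply (z : E) (h : 𝓢(E × ℝ, ℂ)) (s : ℝ) : sliceE s h z = h (z, s) := rfl

lemma sliceE_dZ (v : E) (h : 𝓢(E × ℝ, ℂ)) (s : ℝ) : sliceE s (dZ v h) = ∂_{v} (sliceE s h) := by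
  ext z
  rw [lineDerivOp_apply_eq_fderiv, sliceE_apply, dZ_apply]
  have h2 : HasFDerivAt (fun z : E => (z, s)) (ContinuousLinearMap.inl ℝ E ℝ) z := by
    refine ((hasFDerivAt_id z).prodMk (hasFDerivAt_const s z)).congr_fderiv ?_
    ext <;> simp
  have : HasFDerivAt (fun z => h (z, s)) _ z := (h.differentiableAt.hasFDerivAt).comp z h2
  have h3 : ⇑(sliceE s h) = fun z => h (z, s) := rfl
  rw [h3, this.fderiv]; simp

lemma pF_eq_fourier (h : 𝓢(E × ℝ, ℂ)) (z : E) (l : ℝ) : pF h (z, l) = 𝓕 (sliceT z h) l := by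
  rw [pF_apply, fourier_coe, Real.fourier_eq]
  congr 1; ext t
  simp [phase, Real.fourierChar_apply, Circle.smul_def, mul_comm]

/-- Plancherel for the partial Fourier transform. -/
lemma integral_pF_mul_conj (f g : 𝓢(E × ℝ, ℂ)) :
    ∫ p, pF f p * conj (pF g p) = ∫ p, f p * conj (g p) := by
  have h1 := integral_prod_S (mulS (pF f) (cj (pF g)))
  have h2 := integral_prod_S (mulS f (cj g))
  simp only [mulS_apply, cj_apply] at h1 h2
  rw [h1, h2]
  congr 1; ext z
  have := SchwartzMap.integral_sesq_fourier_fourier (sliceT z g) (sliceT z f)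
    (innerSL ℂ (E := ℂ))
  simp only [innerSL_apply_apply, RCLike.inner_apply, ← pF_eq_fourier, sliceT_apply] at this
  exact this

lemma integral_pF_normSq (f : 𝓢(E × ℝ, ℂ)) : ∫ p, ‖pF f p‖ ^ 2 = ∫ p, ‖f p‖ ^ 2 := by
  have := integral_pF_mul_conj f f
  simp only [Complex.mul_conj, Complex.normSq_eq_norm_sq, integral_complex_ofReal] at this
  exact_mod_cast this

/-- Integrals over horizontal slices are integrable. -/
lemma integrable_intE (h : 𝓢(E × ℝ, ℂ)) : Integrable fun s => ∫ z, h (z, s) :=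
  (h.integrable (μ := (volume : Measure E).prod volume)).integral_prod_right

lemma intE_eq_Iic (h : 𝓢(E × ℝ, ℂ)) (s₀ : ℝ) :
    ∫ z, h (z, s₀) = ∫ s in Set.Iic s₀, ∫ z, dT h (z, s) := by
  rw [integral_integral_swap]
  · congr 1; ext z
    have h0 : Filter.Tendsto (fun s => h (z, s)) Filter.atBot (nhds 0) :=
      ((sliceT z h).tendsto_cocompact).mono_left _root_.atBot_le_cocompact
    have := integral_Iic_of_hasDerivAt_of_tendsto' (a := s₀)
      (fun s _ => hasDerivAt_slice h z s) (integrable_slice (dT h) z).integrableOn h0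
    rw [this, sub_zero]
  · have : Integrable (dT h) := (dT h).integrable
    exact this.swap.mono_measure (Measure.prod_mono Measure.restrict_le_self le_rfl)

lemma intE_eq_Ioi (h : 𝓢(E × ℝ, ℂ)) (s₀ : ℝ) :
    ∫ z, h (z, s₀) = - ∫ s in Set.Ioi s₀, ∫ z, dT h (z, s) := by
  have h1 := intE_eq_Iic h s₀
  have h2 : ∫ s, ∫ z, dT h (z, s) = 0 := by
    rw [← integral_prod_S_symm, integral_prod_S]
    refine integral_eq_zero_of_ae (.of_forall fun z => ?_)
    exact integral_eq_zero_of_hasDerivAt_of_integrable (fun s => hasDerivAt_slice h z s)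
      (integrable_slice (dT h) z) (integrable_slice h z)
  have h3 := intervalIntegral.integral_Iic_add_Ioi (b := s₀) (μ := volume)
    (integrable_intE (dT h)).integrableOn (integrable_intE (dT h)).integrableOn
  rw [h2, ← h1] at h3
  exact eq_neg_of_add_eq_zero_left h3

end product
end Heis

namespace Heis
open SchwartzMap
open scoped LineDeriv ContDiff FourierTransform ComplexConjugate

/-- Cauchy–Schwarz for a complex integrand dominated by a geometric mean. -/
lemma norm_integral_le_sqrt_mul_sqrt {α : Type*} [MeasurableSpace α] {μ : Measure α} {F : α → ℂ}
    {f g : α → ℝ} (hF : Integrable F μ) (hf : Integrable f μ) (hg : Integrable g μ)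
    (hf0 : ∀ x, 0 ≤ f x) (hg0 : ∀ x, 0 ≤ g x) (h : ∀ x, ‖F x‖ ^ 2 ≤ f x * g x) :
    ‖∫ x, F x ∂μ‖ ≤ √(∫ x, f x ∂μ) * √(∫ x, g x ∂μ) := by
  refine (norm_integral_le_integral_norm _).trans ?_
  rw [← Real.sqrt_mul (integral_nonneg hf0)]
  refine Real.le_sqrt_of_sq_le ?_
  have key : ∀ t : ℝ, 0 ≤ (∫ x, f x ∂μ) * (t * t) + (-(2 * ∫ x, ‖F x‖ ∂μ)) * t + ∫ x, g x ∂μ := by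
    intro t
    have e : (∫ x, f x ∂μ) * (t * t) + (-(2 * ∫ x, ‖F x‖ ∂μ)) * t + ∫ x, g x ∂μ
        = ∫ x, (f x * (t * t) - ‖F x‖ * (2 * t) + g x) ∂μ := by
      have h5 : Integrable (fun x => f x * (t * t) - ‖F x‖ * (2 * t)) μ :=
        (hf.mul_const _).sub (hF.norm.mul_const _)
      rw [integral_add h5 hg, integral_sub (hf.mul_const _) (hF.norm.mul_const _), integral_mul_const,
        integral_mul_const]
      ring
    rw [e]
    refine integral_nonneg fun x => ?_
    show 0 ≤ f x * (t * t) - ‖F x‖ * (2 * t) + g x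
    rcases (hf0 x).eq_or_lt with h0 | h0
    · have h1 := h x
      rw [← h0, zero_mul] at h1
      have h2 : ‖F x‖ = 0 := by nlinarith [norm_nonneg (F x)]
      rw [← h0, h2]; simpa using hg0 x
    · have h1 := h x
      have : 0 ≤ f x * (f x * (t * t) - ‖F x‖ * (2 * t) + g x) := by
        nlinarith [sq_nonneg (f x * t - ‖F x‖)]
      exact nonneg_of_mul_nonneg_right this h0
  have := discrim_le_zero key
  unfold discrim at this
  nlinarith

lemma norm_sum_mul_sq_le {ι : Type*} (s : Finset ι) (a b : ι → ℂ) :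
    ‖∑ i ∈ s, a i * conj (b i)‖ ^ 2 ≤ (∑ i ∈ s, ‖a i‖ ^ 2) * ∑ i ∈ s, ‖b i‖ ^ 2 := by
  have h1 : ‖∑ i ∈ s, a i * conj (b i)‖ ≤ ∑ i ∈ s, ‖a i‖ * ‖b i‖ :=
    (norm_sum_le _ _).trans (Finset.sum_le_sum fun i _ => by simp)
  exact (pow_le_pow_left₀ (norm_nonneg _) h1 2).trans (Finset.sum_mul_sq_le_sq_mul_sq s _ _)

lemma lineDeriv_comm {D : Type*} [NormedAddCommGroup D] [NormedSpace ℝ D] (v w : D) (f : 𝓢(D, ℂ)) :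
    (∂_{v} (∂_{w} f) : 𝓢(D, ℂ)) = ∂_{w} (∂_{v} f) := by
  have key : ∀ (a b : D) x, (∂_{a} (∂_{b} f) : 𝓢(D, ℂ)) x = fderiv ℝ (fderiv ℝ f) x a b := by
    intro a b x
    have h1 : (⇑(∂_{b} f : 𝓢(D, ℂ))) = fun y => fderiv ℝ f y b := by
      ext y; exact lineDerivOp_apply_eq_fderiv _ _ _
    have h2 : DifferentiableAt ℝ (fderiv ℝ f) x :=
      ((f.smooth 2).fderiv_right (m := 1) (by norm_num)).differentiable (by norm_num) x
    rw [lineDerivOp_apply_eq_fderiv, h1, fderiv_clm_apply h2 (differentiableAt_const b)]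
    simp
  ext x
  rw [key, key]
  exact ((f.smooth 2).contDiffAt.isSymmSndFDerivAt (by simp)).eq v w

/-- Linear data describing the horizontal fields `X_i = ∂_{e i} + 2 b i ∂_t` on `E × ℝ`. -/
structure HFrame (E : Type) [NormedAddCommGroup E] [NormedSpace ℝ E] (ι : Type) [Fintype ι]
    [DecidableEq ι] where
  e : ι → E
  c : ι → E →L[ℝ] ℝ
  b : ι → E →L[ℝ] ℝ
  c_e : ∀ i j, c i (e j) = if i = j then 1 else 0
  sum_ce : ∀ z, ∑ i, c i z • e i = z
  sum_cb : ∀ z, ∑ i, c i z * b i z = 0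
  i₀ : ι
  j₀ : ι
  ne : i₀ ≠ j₀
  comm : |b j₀ (e i₀) - b i₀ (e j₀)| = 2
  card : 4 ≤ Fintype.card ι

variable {E : Type} [NormedAddCommGroup E] [NormedSpace ℝ E]
variable {ι : Type} [Fintype ι] [DecidableEq ι]

namespace HFrame
variable (H : HFrame E ι)

/-- Half the dimension. -/
def m (_ : HFrame E ι) : ℝ := (Fintype.card ι : ℝ) / 2

lemma two_le_m : 2 ≤ H.m := by
  have : (4 : ℝ) ≤ Fintype.card ι := by exact_mod_cast H.card
  unfold m; linarith

/-- `|z|²`. -/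
def N (z : E) : ℝ := ∑ i, H.c i z ^ 2

lemma N_nonneg (z : E) : 0 ≤ H.N z := Finset.sum_nonneg fun _ _ => sq_nonneg _

/-- The field `X_i` at frequency one. -/
def XE (i : ι) (u : 𝓢(E, ℂ)) : 𝓢(E, ℂ) :=
  ∂_{H.e i} u + mulForm (4 * Real.pi * Complex.I) (H.b i) u

lemma XE_apply (i : ι) (u : 𝓢(E, ℂ)) (z : E) : H.XE i u z
    = (∂_{H.e i} u : 𝓢(E, ℂ)) z + 4 * Real.pi * Complex.I * H.b i z * u z := by
  simp [XE]

/-- Multiplication by the coordinate `c i`. -/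
def cE (i : ι) (u : 𝓢(E, ℂ)) : 𝓢(E, ℂ) := mulForm 1 (H.c i) u

@[simp] lemma cE_apply (i : ι) (u : 𝓢(E, ℂ)) (z : E) : H.cE i u z = H.c i z * u z := by
  simp [cE]

/-- The operator `z · ∂_z + m`. -/
def eulerE (u : 𝓢(E, ℂ)) : 𝓢(E, ℂ) := ∑ i, H.cE i (∂_{H.e i} u) + (H.m : ℂ) • u

lemma eulerE_apply (u : 𝓢(E, ℂ)) (z : E) : H.eulerE u z
    = ∑ i, H.c i z * (∂_{H.e i} u : 𝓢(E, ℂ)) z + H.m * u z := by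
  simp [eulerE]

/-- Density of the horizontal energy. -/
def gdE (u : 𝓢(E, ℂ)) (z : E) : ℝ := ∑ i, ‖H.XE i u z‖ ^ 2

/-- Density of the weighted norm. -/
def wdE (δ : ℝ) (u : 𝓢(E, ℂ)) (z : E) : ℝ := δ * ‖u z‖ ^ 2 + ∑ i, ‖H.cE i u z‖ ^ 2

lemma wdE_eq (δ : ℝ) (u : 𝓢(E, ℂ)) (z : E) : H.wdE δ u z = (δ + H.N z) * ‖u z‖ ^ 2 := by
  simp [wdE, N, mul_pow, Finset.sum_mul, add_mul]

lemma gdE_nonneg (u : 𝓢(E, ℂ)) (z : E) : 0 ≤ H.gdE u z :=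
  Finset.sum_nonneg fun _ _ => sq_nonneg _

lemma wdE_nonneg {δ : ℝ} (hδ : 0 ≤ δ) (u : 𝓢(E, ℂ)) (z : E) : 0 ≤ H.wdE δ u z := by
  unfold wdE; positivity

variable [FiniteDimensional ℝ E] [MeasureSpace E] [BorelSpace E]
  [(volume : Measure E).IsAddHaarMeasure]

lemma integrable_gdE (u : 𝓢(E, ℂ)) : Integrable (H.gdE u) :=
  integrable_finsetSum _ fun _ _ => integrable_normSq _

lemma integrable_wdE (δ : ℝ) (u : 𝓢(E, ℂ)) : Integrable (H.wdE δ u) :=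
  ((integrable_normSq _).const_mul _).add (integrable_finsetSum _ fun _ _ => integrable_normSq _)

/-- The horizontal energy. -/
def gradE (u : 𝓢(E, ℂ)) : ℝ := ∫ z, H.gdE u z

/-- The weighted norm. -/
def wE (δ : ℝ) (u : 𝓢(E, ℂ)) : ℝ := ∫ z, H.wdE δ u z

lemma gradE_nonneg (u : 𝓢(E, ℂ)) : 0 ≤ H.gradE u := integral_nonneg (H.gdE_nonneg u)

lemma integral_XE_mul_conj (i : ι) (u v : 𝓢(E, ℂ)) :
    ∫ z, H.XE i u z * conj (v z) = - ∫ z, u z * conj (H.XE i v z) := by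
  have h1 := integral_lineDeriv_mul_conj (H.e i) u v
  have h2 : ∀ z, H.XE i u z * conj (v z) = (∂_{H.e i} u : 𝓢(E, ℂ)) z * conj (v z)
      + mulForm (4 * Real.pi * Complex.I) (H.b i) u z * conj (v z) := fun z => by
    simp [XE, add_mul]
  have h3 : ∀ z, u z * conj (H.XE i v z) = u z * conj ((∂_{H.e i} v : 𝓢(E, ℂ)) z)
      - mulForm (4 * Real.pi * Complex.I) (H.b i) u z * conj (v z) := fun z => by
    simp [XE, Complex.conj_ofNat]; ring
  simp only [h2, h3]
  rw [integral_add (integrable_mul_conj _ _) (integrable_mul_conj _ _),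
    integral_sub (integrable_mul_conj _ _) (integrable_mul_conj _ _), h1]
  ring

lemma integral_XE_XE_mul_conj (u v : 𝓢(E, ℂ)) :
    ∫ z, (∑ i, H.XE i (H.XE i u) z) * conj (v z)
      = - ∑ i, ∫ z, H.XE i u z * conj (H.XE i v z) := by
  simp only [Finset.sum_mul]
  rw [integral_finsetSum _ fun _ _ => integrable_mul_conj _ _, ← Finset.sum_neg_distrib]
  exact Finset.sum_congr rfl fun i _ => H.integral_XE_mul_conj i _ _

/-- The uncertainty inequality coming from the commutator `[X_i, X_j]`. -/
lemma eight_pi_mul_le_gradE (u : 𝓢(E, ℂ)) : 8 * Real.pi * ∫ z, ‖u z‖ ^ 2 ≤ H.gradE u := by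
  set k : ℝ := H.b H.j₀ (H.e H.i₀) - H.b H.i₀ (H.e H.j₀) with hk
  have hcomm : ∀ z, H.XE H.i₀ (H.XE H.j₀ u) z - H.XE H.j₀ (H.XE H.i₀ u) z
      = 4 * Real.pi * Complex.I * k * u z := by
    intro z
    have hsymm : (∂_{H.e H.i₀} (∂_{H.e H.j₀} u) : 𝓢(E, ℂ)) z
        = (∂_{H.e H.j₀} (∂_{H.e H.i₀} u) : 𝓢(E, ℂ)) z := by
      rw [lineDeriv_comm]
    rw [XE_apply, XE_apply, XE_apply, XE_apply]
    have e1 : ∀ i j, (∂_{H.e i} (H.XE j u) : 𝓢(E, ℂ)) z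
        = (∂_{H.e i} (∂_{H.e j} u) : 𝓢(E, ℂ)) z
          + (4 * Real.pi * Complex.I * H.b j (H.e i) * u z
          + 4 * Real.pi * Complex.I * H.b j z * (∂_{H.e i} u : 𝓢(E, ℂ)) z) := fun i j => by
      rw [← lineDeriv_mulForm, ← add_apply, ← LineDeriv.lineDerivOp_add]; rfl
    rw [e1, e1, hsymm, hk]
    push_cast
    ring
  have h1 : ∫ z, (H.XE H.i₀ (H.XE H.j₀ u) z - H.XE H.j₀ (H.XE H.i₀ u) z) * conj (u z)
      = ((4 * Real.pi * k * ∫ z, ‖u z‖ ^ 2 : ℝ) : ℂ) * Complex.I := by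
    simp only [hcomm, mul_assoc, Complex.mul_conj, Complex.normSq_eq_norm_sq]
    rw [integral_const_mul, integral_const_mul, integral_const_mul, integral_const_mul,
      integral_complex_ofReal]
    push_cast; ring
  simp only [sub_mul] at h1
  rw [integral_sub (integrable_mul_conj _ _) (integrable_mul_conj _ _),
    H.integral_XE_mul_conj H.i₀ (H.XE H.j₀ u) u, H.integral_XE_mul_conj H.j₀ (H.XE H.i₀ u) u] at h1
  have h2 : ‖∫ z, H.XE H.j₀ u z * conj (H.XE H.i₀ u z)‖ ≤ 1 / 2 * H.gradE u := by
    refine (norm_integral_le_of_norm_le ((H.integrable_gdE u).const_mul (1 / 2))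
      (.of_forall fun z => ?_)).trans_eq (integral_const_mul _ _)
    have : ‖H.XE H.i₀ u z‖ ^ 2 + ‖H.XE H.j₀ u z‖ ^ 2 ≤ H.gdE u z := by
      rw [← Finset.sum_pair H.ne (f := fun i => ‖H.XE i u z‖ ^ 2)]
      exact Finset.sum_le_sum_of_subset_of_nonneg (Finset.subset_univ _) fun _ _ _ => sq_nonneg _
    simp only [norm_mul, RCLike.norm_conj]
    nlinarith [sq_nonneg (‖H.XE H.i₀ u z‖ - ‖H.XE H.j₀ u z‖)]
  have h3 : ∫ z, H.XE H.i₀ u z * conj (H.XE H.j₀ u z)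
      = conj (∫ z, H.XE H.j₀ u z * conj (H.XE H.i₀ u z)) := by
    rw [← integral_conj]; congr 1; ext z; simp [mul_comm]
  have h4 := congrArg norm h1
  rw [h3, norm_mul, Complex.norm_I, mul_one, Complex.norm_real, norm_mul, norm_mul,
    Real.norm_eq_abs k, H.comm, Real.norm_of_nonneg (by positivity),
    Real.norm_of_nonneg (integral_nonneg fun z => sq_nonneg _)] at h4
  have h5 := norm_sub_le (-∫ z, H.XE H.j₀ u z * conj (H.XE H.i₀ u z))
    (-conj (∫ z, H.XE H.j₀ u z * conj (H.XE H.i₀ u z)))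
  rw [norm_neg, norm_neg, RCLike.norm_conj] at h5
  linarith

end HFrame
end Heis

namespace Heis
open SchwartzMap
open scoped LineDeriv ContDiff FourierTransform ComplexConjugate

lemma hasTemperateGrowth_inv_add_sum_sq {D : Type*} [NormedAddCommGroup D] [NormedSpace ℝ D]
    {κ : Type*} [Fintype κ] (l : κ → D →L[ℝ] ℝ) {δ : ℝ} (hδ : 0 < δ) :
    Function.HasTemperateGrowth fun x => (δ + ∑ i, l i x ^ 2)⁻¹ := by
  let L : D →L[ℝ] EuclideanSpace ℝ κ :=
    (EuclideanSpace.equiv κ ℝ).symm.toContinuousLinearMap.comp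
      (ContinuousLinearMap.pi fun i => (√δ)⁻¹ • l i)
  have hL : ∀ x, ‖L x‖ ^ 2 = δ⁻¹ * ∑ i, l i x ^ 2 := by
    intro x
    rw [EuclideanSpace.norm_sq_eq, Finset.mul_sum]
    refine Finset.sum_congr rfl fun i _ => ?_
    have : (L x) i = (√δ)⁻¹ * l i x := rfl
    rw [this, Real.norm_eq_abs, sq_abs, mul_pow, inv_pow, Real.sq_sqrt hδ.le]
  have h1 : (fun x => (δ + ∑ i, l i x ^ 2)⁻¹)
      = fun x => δ⁻¹ * ((fun y => (1 + ‖y‖ ^ 2) ^ (-1 : ℝ)) ∘ L) x := by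
    ext x
    simp only [Function.comp, hL, Real.rpow_neg_one, ← mul_inv]
    congr 1
    field_simp
  rw [h1]
  exact (Function.HasTemperateGrowth.const _).mul
    ((Function.hasTemperateGrowth_one_add_norm_sq_rpow _ (-1)).comp (hasTemperateGrowth_clm L))

lemma integral_lineDeriv_eq_zero {D : Type*} [NormedAddCommGroup D] [NormedSpace ℝ D]
    [FiniteDimensional ℝ D] [MeasureSpace D] [BorelSpace D] [(volume : Measure D).IsAddHaarMeasure]
    (v : D) (f : 𝓢(D, ℂ)) : ∫ x, (∂_{v} f : 𝓢(D, ℂ)) x = 0 := by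
  have h1 : ∀ x, (∂_{v} f : 𝓢(D, ℂ)) x = fderiv ℝ f x v := fun x =>
    lineDerivOp_apply_eq_fderiv _ _ _
  have hi : Integrable fun x => fderiv ℝ f x v := by
    exact ((∂_{v} f : 𝓢(D, ℂ)).integrable (μ := volume)).congr (.of_forall h1)
  have := integral_mul_fderiv_eq_neg_fderiv_mul_of_integrable (μ := (volume : Measure D))
    (f := fun _ : D => (1 : ℂ)) (g := f) (v := v) (by simp) (by simpa using hi)
    (by simpa using f.integrable) (by simp) (fun x _ => f.differentiableAt)
  simpa [h1] using this

lemma lineDeriv_smulLeftCLM {D : Type*} [NormedAddCommGroup D] [NormedSpace ℝ D]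
    {g : D → ℂ} (hg : g.HasTemperateGrowth) (v : D) (f : 𝓢(D, ℂ)) (x : D) :
    (∂_{v} (smulLeftCLM ℂ g f) : 𝓢(D, ℂ)) x
      = fderiv ℝ g x v * f x + g x * (∂_{v} f : 𝓢(D, ℂ)) x := by
  simp only [lineDerivOp_apply_eq_fderiv]
  have : (⇑(smulLeftCLM ℂ g f)) = fun x => g x * f x := by
    ext x; simp [smulLeftCLM_apply_apply hg]
  rw [this, fderiv_fun_mul ((hg.1.differentiable (by simp)) x) f.differentiableAt]
  simp; ring

variable {E : Type} [NormedAddCommGroup E] [NormedSpace ℝ E]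
variable {ι : Type} [Fintype ι] [DecidableEq ι]

namespace HFrame
variable (H : HFrame E ι)

/-- The Hardy weight. -/
def hw (δ : ℝ) (z : E) : ℝ := (δ + H.N z)⁻¹

lemma hw_pos {δ : ℝ} (hδ : 0 < δ) (z : E) : 0 < H.hw δ z :=
  inv_pos.mpr (add_pos_of_pos_of_nonneg hδ (H.N_nonneg z))

lemma hw_growth {δ : ℝ} (hδ : 0 < δ) :
    Function.HasTemperateGrowth fun z => (H.hw δ z : ℂ) :=
  Function.Complex.hasTemperateGrowth_ofReal.comp (hasTemperateGrowth_inv_add_sum_sq H.c hδ)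

lemma fderiv_hw {δ : ℝ} (hδ : 0 < δ) (z : E) (i : ι) :
    fderiv ℝ (fun z => (H.hw δ z : ℂ)) z (H.e i) = ((-2 * H.hw δ z ^ 2 * H.c i z : ℝ) : ℂ) := by
  have h1 : HasFDerivAt (fun z => δ + H.N z) (∑ j, (2 * H.c j z) • H.c j) z := by
    refine HasFDerivAt.const_add _ ?_
    refine HasFDerivAt.fun_sum fun j _ => ?_
    have := ((H.c j).hasFDerivAt (x := z)).pow 2
    simpa using this
  have h2 : δ + H.N z ≠ 0 := (add_pos_of_pos_of_nonneg hδ (H.N_nonneg z)).ne'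
  have h3 := (hasDerivAt_inv h2).comp_hasFDerivAt z h1
  have h4 := (Complex.ofRealCLM.hasFDerivAt (x := (δ + H.N z)⁻¹)).comp z h3
  have h5 : (fun z => (H.hw δ z : ℂ)) = Complex.ofRealCLM ∘ (Inv.inv ∘ fun z => δ + H.N z) := rfl
  rw [h5, h4.fderiv]
  simp [H.c_e, hw]
  ring

variable [FiniteDimensional ℝ E] [MeasureSpace E] [BorelSpace E]
  [(volume : Measure E).IsAddHaarMeasure]

lemma integrable_hw_mul {δ : ℝ} (hδ : 0 < δ) (u : 𝓢(E, ℂ)) :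
    Integrable fun z => H.hw δ z * ‖u z‖ ^ 2 := by
  refine ((smulLeftCLM ℂ (fun z => (H.hw δ z : ℂ)) (mulS u (cj u))).integrable
    (μ := volume)).re.congr (.of_forall fun z => ?_)
  simp only [smulLeftCLM_apply_apply (H.hw_growth hδ), mulS_apply, cj_apply, Complex.mul_conj,
    Complex.normSq_eq_norm_sq, smul_eq_mul, ← Complex.ofReal_mul]
  rw [RCLike.re_to_complex, Complex.ofReal_re]

/-- Hardy's inequality for the horizontal energy. -/
lemma hardy {δ : ℝ} (hδ : 0 < δ) (u : 𝓢(E, ℂ)) :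
    (H.m - 1) ^ 2 * ∫ z, H.hw δ z * ‖u z‖ ^ 2 ≤ H.gradE u := by
  set α := H.m - 1 with hα
  have hα1 : 1 ≤ α := by linarith [H.two_le_m]
  let T : ι → 𝓢(E, ℂ) := fun i =>
    ∂_{H.e i} (smulLeftCLM ℂ (fun z => (H.hw δ z : ℂ)) (H.cE i (mulS u (cj u))))
  have hT : ∫ z, (∑ i, T i z) = 0 := by
    rw [integral_finsetSum _ fun i _ => (T i).integrable]
    exact Finset.sum_eq_zero fun i _ => integral_lineDeriv_eq_zero _ _
  have hTi : Integrable fun z => ∑ i, T i z := integrable_finsetSum _ fun i _ => (T i).integrable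
  have hTre : ∀ z i, (T i z).re = -2 * H.hw δ z ^ 2 * H.c i z ^ 2 * ‖u z‖ ^ 2
      + H.hw δ z * ‖u z‖ ^ 2
      + H.hw δ z * (2 * (H.c i z * (H.XE i u z * conj (u z)).re)) := by
    intro z i
    have e1 : (∂_{H.e i} (H.cE i (mulS u (cj u))) : 𝓢(E, ℂ)) z
        = mulS u (cj u) z + H.c i z * ((∂_{H.e i} u : 𝓢(E, ℂ)) z * conj (u z)
          + u z * conj ((∂_{H.e i} u : 𝓢(E, ℂ)) z)) := by
      rw [cE, lineDeriv_mulForm, lineDeriv_mulS, lineDeriv_cj]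
      simp [H.c_e]
    simp only [T, lineDeriv_smulLeftCLM (H.hw_growth hδ), e1, fderiv_hw H hδ, cE_apply,
      mulS_apply, cj_apply, XE_apply]
    have e2 : ‖u z‖ ^ 2 = (u z).re ^ 2 + (u z).im ^ 2 := by
      rw [← Complex.normSq_eq_norm_sq, Complex.normSq_apply]; ring
    rw [e2]
    simp [-Complex.ofReal_pow]
    ring
  have hpt : ∀ z, α ^ 2 * (H.hw δ z * ‖u z‖ ^ 2) ≤ H.gdE u z + α * (∑ i, T i z).re := by
    intro z
    have hφ := H.hw_pos hδ z
    have hN : H.hw δ z * H.N z ≤ 1 := by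
      have h1 : H.hw δ z * (δ + H.N z) = 1 :=
        inv_mul_cancel₀ (add_pos_of_pos_of_nonneg hδ (H.N_nonneg z)).ne'
      nlinarith
    have h0 : 0 ≤ ∑ i, ‖H.XE i u z + (α * H.hw δ z * H.c i z : ℝ) * u z‖ ^ 2 :=
      Finset.sum_nonneg fun _ _ => sq_nonneg _
    have h1 : ∀ i, ‖H.XE i u z + (α * H.hw δ z * H.c i z : ℝ) * u z‖ ^ 2
        = ‖H.XE i u z‖ ^ 2 + (α * H.hw δ z) * (2 * (H.c i z * (H.XE i u z * conj (u z)).re))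
          + α ^ 2 * H.hw δ z ^ 2 * ‖u z‖ ^ 2 * H.c i z ^ 2 := by
      intro i
      rw [← Complex.normSq_eq_norm_sq, ← Complex.normSq_eq_norm_sq, ← Complex.normSq_eq_norm_sq,
        Complex.normSq_add]
      simp [Complex.normSq_apply]
      ring
    simp only [h1, Finset.sum_add_distrib, ← Finset.mul_sum] at h0
    rw [Complex.re_sum]
    simp only [hTre, Finset.sum_add_distrib, ← Finset.mul_sum, ← Finset.sum_mul]
    rw [Finset.sum_const, Finset.card_univ, nsmul_eq_mul]
    have hm : (Fintype.card ι : ℝ) = 2 * (α + 1) := by rw [hα, m]; ring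
    rw [hm]
    change 0 ≤ H.gdE u z + _ * (2 * _) + _ * H.N z at h0
    set S := ∑ i, H.c i z * (H.XE i u z * conj (u z)).re
    have hN' : ∑ i, H.c i z ^ 2 = H.N z := rfl
    rw [hN']
    have h2 : 0 ≤ (α ^ 2 + 2 * α) * (H.hw δ z * ‖u z‖ ^ 2) * (1 - H.hw δ z * H.N z) := by
      have := sub_nonneg.mpr hN
      positivity
    nlinarith
  have h3 := integral_mono ((H.integrable_hw_mul hδ u).const_mul (α ^ 2))
    ((H.integrable_gdE u).add (hTi.re.const_mul α)) hpt
  have h5 : ∫ z, (H.gdE u z + α * (∑ i, T i z).re) = H.gradE u := by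
    have h4 : ∫ z, (∑ i, T i z).re = 0 := by
      have := integral_re hTi
      simp only [RCLike.re_to_complex] at this
      rw [this, hT]; simp
    have h6 : Integrable fun z => α * (∑ i, T i z).re := hTi.re.const_mul α
    rw [integral_add (H.integrable_gdE u) h6, integral_const_mul, h4, mul_zero, add_zero]
    rfl
  rw [integral_const_mul] at h3
  refine h3.trans_eq h5

lemma norm_integral_mul_conj_le {δ : ℝ} (hδ : 0 < δ) (u v : 𝓢(E, ℂ)) :
    (H.m - 1) * ‖∫ z, v z * conj (u z)‖ ≤ √(H.wE δ v) * √(H.gradE u) := by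
  have hα : 0 ≤ H.m - 1 := by linarith [H.two_le_m]
  have h1 := norm_integral_le_sqrt_mul_sqrt (integrable_mul_conj v u) (H.integrable_wdE δ v)
    (H.integrable_hw_mul hδ u) (H.wdE_nonneg hδ.le v)
    (fun z => mul_nonneg (H.hw_pos hδ z).le (sq_nonneg _)) fun z => by
      rw [H.wdE_eq, norm_mul, RCLike.norm_conj, mul_pow, hw]
      have : δ + H.N z ≠ 0 := (add_pos_of_pos_of_nonneg hδ (H.N_nonneg z)).ne'
      apply le_of_eq
      field_simp
  calc _ ≤ (H.m - 1) * (√(H.wE δ v) * √(∫ z, H.hw δ z * ‖u z‖ ^ 2)) := by gcongr; exact h1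
    _ = √(H.wE δ v) * √((H.m - 1) ^ 2 * ∫ z, H.hw δ z * ‖u z‖ ^ 2) := by
      rw [Real.sqrt_mul (sq_nonneg _), Real.sqrt_sq hα]; ring
    _ ≤ _ := by gcongr; exact H.hardy hδ u

lemma norm_integral_mul_conj_le' {δ : ℝ} (hδ : 0 < δ) (u v : 𝓢(E, ℂ)) :
    ‖∫ z, v z * conj (u z)‖ ≤ √(H.wE δ v) * √(H.gradE u) := by
  have h1 := H.norm_integral_mul_conj_le hδ u v
  have h2 := H.two_le_m
  nlinarith [norm_nonneg (∫ z, v z * conj (u z))]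

lemma norm_integral_eulerE_mul_conj_le {δ : ℝ} (hδ : 0 < δ) (u v : 𝓢(E, ℂ)) :
    ‖∫ z, H.eulerE v z * conj (u z)‖ ≤ 3 * (√(H.wE δ v) * √(H.gradE u)) := by
  have e1 : ∀ i, ∫ z, (H.c i z * (∂_{H.e i} v : 𝓢(E, ℂ)) z) * conj (u z)
      = - (∫ z, v z * conj (u z))
        - ∫ z, v z * conj (H.c i z * (∂_{H.e i} u : 𝓢(E, ℂ)) z) := by
    intro i
    have h := integral_lineDeriv_mul_conj (H.e i) v (H.cE i u)
    have h2 : ∀ z, (∂_{H.e i} (H.cE i u) : 𝓢(E, ℂ)) z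
        = u z + H.c i z * (∂_{H.e i} u : 𝓢(E, ℂ)) z := fun z => by
      rw [cE, lineDeriv_mulForm]; simp [H.c_e]
    have h3 : ∀ z, v z * conj ((∂_{H.e i} (H.cE i u) : 𝓢(E, ℂ)) z)
        = v z * conj (u z) + v z * conj (H.cE i (∂_{H.e i} u) z) := fun z => by
      rw [h2, cE_apply, map_add, mul_add]
    simp only [h3] at h
    rw [integral_add (integrable_mul_conj _ _) (integrable_mul_conj _ _)] at h
    simp only [cE_apply] at h
    rw [show (∫ z, (H.c i z * (∂_{H.e i} v : 𝓢(E, ℂ)) z) * conj (u z))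
      = ∫ z, (∂_{H.e i} v : 𝓢(E, ℂ)) z * conj (H.c i z * u z) by
        congr 1; ext z; simp; ring, h]
    ring
  have e2 : ∫ z, H.eulerE v z * conj (u z)
      = -(H.m * ∫ z, v z * conj (u z)) - ∫ z, ∑ i, (H.cE i v z) * conj (H.XE i u z) := by
    have a1 : ∀ z, H.eulerE v z * conj (u z)
        = (∑ i, (H.c i z * (∂_{H.e i} v : 𝓢(E, ℂ)) z) * conj (u z))
          + H.m * (v z * conj (u z)) := fun z => by
      rw [eulerE_apply, add_mul, Finset.sum_mul]; ring
    have a2 : ∀ z, ∑ i, (H.cE i v z) * conj (H.XE i u z)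
        = ∑ i, v z * conj (H.c i z * (∂_{H.e i} u : 𝓢(E, ℂ)) z) := fun z => by
      have : (∑ i, ((H.c i z : ℂ) * H.b i z)) = 0 := by exact_mod_cast H.sum_cb z
      have a3 : ∑ i, (H.cE i v z) * conj (H.XE i u z)
        = ∑ i, v z * conj (H.c i z * (∂_{H.e i} u : 𝓢(E, ℂ)) z)
          + (∑ i, ((H.c i z : ℂ) * H.b i z)) * (v z * conj (4 * Real.pi * Complex.I * u z)) := by
        rw [Finset.sum_mul, ← Finset.sum_add_distrib]
        refine Finset.sum_congr rfl fun i _ => ?_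
        rw [XE_apply]; simp; ring
      rw [a3, this]; ring
    have i1 : ∀ i, Integrable fun z => (H.c i z * (∂_{H.e i} v : 𝓢(E, ℂ)) z) * conj (u z) :=
      fun i => by simpa using integrable_mul_conj (H.cE i (∂_{H.e i} v)) u
    have i2 : ∀ i, Integrable fun z => v z * conj (H.c i z * (∂_{H.e i} u : 𝓢(E, ℂ)) z) :=
      fun i => by simpa only [cE_apply] using integrable_mul_conj v (H.cE i (∂_{H.e i} u))
    simp only [a1, a2]
    rw [integral_add (integrable_finsetSum _ fun i _ => i1 i)
      ((integrable_mul_conj _ _).const_mul _), integral_finsetSum _ fun i _ => i1 i,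
      integral_finsetSum _ fun i _ => i2 i, integral_const_mul]
    simp only [e1, Finset.sum_sub_distrib, Finset.sum_const, Finset.card_univ, nsmul_eq_mul]
    have hm : (Fintype.card ι : ℂ) = 2 * (H.m : ℂ) := by rw [m]; push_cast; ring
    rw [hm]; ring
  have h1 := H.norm_integral_mul_conj_le hδ u v
  have h2 := norm_integral_le_sqrt_mul_sqrt
    (F := fun z => ∑ i, (H.cE i v z) * conj (H.XE i u z))
    (integrable_finsetSum _ fun i _ => integrable_mul_conj (H.cE i v) (H.XE i u))
    (H.integrable_wdE δ v) (H.integrable_gdE u) (H.wdE_nonneg hδ.le v) (H.gdE_nonneg u)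
    fun z => by
      refine (norm_sum_mul_sq_le _ _ _).trans ?_
      refine mul_le_mul_of_nonneg_right ?_ (H.gdE_nonneg u z)
      have : 0 ≤ δ * ‖v z‖ ^ 2 := by positivity
      unfold wdE; linarith
  change _ ≤ √(H.wE δ v) * √(H.gradE u) at h2
  have hm2 := H.two_le_m
  rw [e2]
  refine (norm_sub_le _ _).trans ?_
  rw [norm_neg, norm_mul, Complex.norm_real, Real.norm_of_nonneg (by linarith)]
  have h3 : H.m * ‖∫ z, v z * conj (u z)‖ ≤ 2 * ((H.m - 1) * ‖∫ z, v z * conj (u z)‖) := by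
    nlinarith [norm_nonneg (∫ z, v z * conj (u z))]
  linarith

end HFrame
end Heis

namespace Heis
open SchwartzMap
open scoped LineDeriv ContDiff FourierTransform ComplexConjugate

variable {E : Type} [NormedAddCommGroup E] [NormedSpace ℝ E]
variable {ι : Type} [Fintype ι] [DecidableEq ι]

lemma dT_lineDeriv (h : 𝓢(E × ℝ, ℂ)) : dT h = ∂_{((0 : E), (1 : ℝ))} h := rfl

lemma dZ_lineDeriv (v : E) (h : 𝓢(E × ℝ, ℂ)) : dZ v h = ∂_{(v, (0 : ℝ))} h := rfl

namespace HFrame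
variable (H : HFrame E ι)

/-- The field `X_i` at frequency one, acting on functions with a parameter. -/
def XV (i : ι) (h : 𝓢(E × ℝ, ℂ)) : 𝓢(E × ℝ, ℂ) :=
  dZ (H.e i) h + mulForm (4 * Real.pi * Complex.I) ((H.b i).comp (ContinuousLinearMap.fst ℝ E ℝ)) h

/-- Multiplication by the coordinate `c i` for functions with a parameter. -/
def cV (i : ι) (h : 𝓢(E × ℝ, ℂ)) : 𝓢(E × ℝ, ℂ) :=
  mulForm 1 ((H.c i).comp (ContinuousLinearMap.fst ℝ E ℝ)) h

/-- The operator `z · ∂_z + m` for functions with a parameter. -/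
def eulerV (h : 𝓢(E × ℝ, ℂ)) : 𝓢(E × ℝ, ℂ) := ∑ i, H.cV i (dZ (H.e i) h) + (H.m : ℂ) • h

/-- The sublaplacian at frequency one for functions with a parameter. -/
def lapV (h : 𝓢(E × ℝ, ℂ)) : 𝓢(E × ℝ, ℂ) := ∑ i, H.XV i (H.XV i h)

@[simp] lemma cV_apply (i : ι) (h : 𝓢(E × ℝ, ℂ)) (p : E × ℝ) : H.cV i h p = H.c i p.1 * h p := by
  simp [cV]

lemma XV_apply (i : ι) (h : 𝓢(E × ℝ, ℂ)) (p : E × ℝ) :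
    H.XV i h p = dZ (H.e i) h p + 4 * Real.pi * Complex.I * H.b i p.1 * h p := by
  simp [XV]

lemma eulerV_apply (h : 𝓢(E × ℝ, ℂ)) (p : E × ℝ) :
    H.eulerV h p = ∑ i, H.c i p.1 * dZ (H.e i) h p + H.m * h p := by
  simp [eulerV]

lemma lapV_apply (h : 𝓢(E × ℝ, ℂ)) (p : E × ℝ) :
    H.lapV h p = ∑ i, H.XV i (H.XV i h) p := by
  simp [lapV]

lemma pF_XV (i : ι) (h : 𝓢(E × ℝ, ℂ)) : pF (H.XV i h) = H.XV i (pF h) := by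
  rw [XV, pF_add, pF_mulForm_fst, ← lineDeriv_pF]; rfl

lemma pF_cV (i : ι) (h : 𝓢(E × ℝ, ℂ)) : pF (H.cV i h) = H.cV i (pF h) :=
  pF_mulForm_fst _ _ _

lemma pF_eulerV (h : 𝓢(E × ℝ, ℂ)) : pF (H.eulerV h) = H.eulerV (pF h) := by
  simp only [eulerV, pF_add, pF_smul, pF_sum, pF_cV, lineDeriv_pF]

lemma pF_lapV (h : 𝓢(E × ℝ, ℂ)) : pF (H.lapV h) = H.lapV (pF h) := by
  simp only [lapV, pF_sum, pF_XV]

lemma dT_XV (i : ι) (h : 𝓢(E × ℝ, ℂ)) : dT (H.XV i h) = H.XV i (dT h) := by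
  ext p
  rw [XV_apply, XV, dT_lineDeriv, LineDeriv.lineDerivOp_add, add_apply, lineDeriv_mulForm,
    dZ_lineDeriv, lineDeriv_comm]
  simp [dT_lineDeriv, dZ_lineDeriv]

lemma dT_lapV (h : 𝓢(E × ℝ, ℂ)) : dT (H.lapV h) = H.lapV (dT h) := by
  rw [lapV, dT_lineDeriv, LineDeriv.lineDerivOp_sum]
  simp only [← dT_lineDeriv, dT_XV, lapV]

variable [FiniteDimensional ℝ E] [MeasureSpace E] [BorelSpace E]
  [(volume : Measure E).IsAddHaarMeasure]

lemma sliceE_XV (i : ι) (s : ℝ) (h : 𝓢(E × ℝ, ℂ)) :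
    sliceE s (H.XV i h) = H.XE i (sliceE s h) := by
  ext z; rw [XE_apply, ← sliceE_dZ]; simp [XV]

lemma sliceE_cV (i : ι) (s : ℝ) (h : 𝓢(E × ℝ, ℂ)) :
    sliceE s (H.cV i h) = H.cE i (sliceE s h) := by
  ext z; simp

lemma sliceE_eulerV (s : ℝ) (h : 𝓢(E × ℝ, ℂ)) :
    sliceE s (H.eulerV h) = H.eulerE (sliceE s h) := by
  ext z; rw [eulerE_apply]; simp [eulerV_apply, ← sliceE_dZ]

/-- The squared `L²` norm on a slice. -/
def lE (u : 𝓢(E, ℂ)) : ℝ := ∫ z, ‖u z‖ ^ 2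

/-- The squared `L²` norm. -/
def lV (h : 𝓢(E × ℝ, ℂ)) : ℝ := ∫ p, ‖h p‖ ^ 2

/-- The squared weighted norm. -/
def wV (δ : ℝ) (h : 𝓢(E × ℝ, ℂ)) : ℝ := δ * lV h + ∑ i, lV (H.cV i h)

lemma lE_nonneg (u : 𝓢(E, ℂ)) : 0 ≤ lE u := integral_nonneg fun _ => sq_nonneg _

lemma lV_nonneg (h : 𝓢(E × ℝ, ℂ)) : 0 ≤ lV h := integral_nonneg fun _ => sq_nonneg _

lemma wV_nonneg {δ : ℝ} (hδ : 0 ≤ δ) (h : 𝓢(E × ℝ, ℂ)) : 0 ≤ H.wV δ h :=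
  add_nonneg (mul_nonneg hδ (lV_nonneg _)) (Finset.sum_nonneg fun _ _ => lV_nonneg _)

lemma wE_nonneg {δ : ℝ} (hδ : 0 ≤ δ) (u : 𝓢(E, ℂ)) : 0 ≤ H.wE δ u :=
  integral_nonneg (H.wdE_nonneg hδ u)

lemma wE_eq (δ : ℝ) (u : 𝓢(E, ℂ)) : H.wE δ u = δ * lE u + ∑ i, lE (H.cE i u) := by
  unfold wE wdE
  rw [integral_add ((integrable_normSq _).const_mul _)
    (integrable_finsetSum _ fun _ _ => integrable_normSq _), integral_const_mul,
    integral_finsetSum _ fun _ _ => integrable_normSq _]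
  rfl

lemma integral_mul_conj_self (u : 𝓢(E, ℂ)) : ∫ z, u z * conj (u z) = (lE u : ℂ) := by
  simp only [Complex.mul_conj, Complex.normSq_eq_norm_sq]
  exact integral_complex_ofReal

lemma integrable_lE_slice (h : 𝓢(E × ℝ, ℂ)) : Integrable fun s => lE (sliceE s h) := by
  refine (integrable_intE (mulS h (cj h))).re.congr (.of_forall fun s => ?_)
  have := integral_mul_conj_self (sliceE s h)
  simp only [sliceE_apply] at this
  simp [this]

lemma integral_lE_slice (h : 𝓢(E × ℝ, ℂ)) : ∫ s, lE (sliceE s h) = lV h := by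
  have h1 := integral_prod_S_symm (mulS h (cj h))
  simp only [mulS_apply, cj_apply, Complex.mul_conj, Complex.normSq_eq_norm_sq,
    integral_complex_ofReal] at h1
  exact_mod_cast h1.symm

lemma lV_pF (h : 𝓢(E × ℝ, ℂ)) : lV (pF h) = lV h := integral_pF_normSq h

lemma wV_pF (δ : ℝ) (h : 𝓢(E × ℝ, ℂ)) : H.wV δ (pF h) = H.wV δ h := by
  simp only [wV, ← pF_cV, lV_pF]

lemma integrable_wE_slice (δ : ℝ) (h : 𝓢(E × ℝ, ℂ)) :
    Integrable fun s => H.wE δ (sliceE s h) := by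
  simp only [wE_eq, ← sliceE_cV]
  exact ((integrable_lE_slice _).const_mul _).add
    (integrable_finsetSum _ fun _ _ => integrable_lE_slice _)

lemma integral_wE_slice (δ : ℝ) (h : 𝓢(E × ℝ, ℂ)) :
    ∫ s, H.wE δ (sliceE s h) = H.wV δ h := by
  simp only [wE_eq, ← sliceE_cV, wV]
  rw [integral_add ((integrable_lE_slice _).const_mul _)
    (integrable_finsetSum _ fun _ _ => integrable_lE_slice _), integral_const_mul,
    integral_finsetSum _ fun _ _ => integrable_lE_slice _]
  simp only [integral_lE_slice]

lemma norm_integral_sq_le_lE (u v : 𝓢(E, ℂ)) :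
    ‖∫ z, v z * conj (u z)‖ ≤ √(lE v / (8 * Real.pi)) * √(H.gradE u) := by
  have h1 := norm_integral_le_sqrt_mul_sqrt (integrable_mul_conj v u) (integrable_normSq v)
    (integrable_normSq u) (fun _ => sq_nonneg _) (fun _ => sq_nonneg _)
    (fun z => by rw [norm_mul, RCLike.norm_conj, mul_pow])
  have h2 := H.eight_pi_mul_le_gradE u
  have hp := Real.pi_pos
  change _ ≤ √(lE v) * √(lE u) at h1
  change 8 * Real.pi * lE u ≤ _ at h2
  calc _ ≤ √(lE v) * √(lE u) := h1
    _ = √(lE v / (8 * Real.pi)) * √(8 * Real.pi * lE u) := by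
      rw [← Real.sqrt_mul (lE_nonneg _), ← Real.sqrt_mul (by have := lE_nonneg v; positivity)]
      congr 1; field_simp
    _ ≤ _ := by gcongr

/-- Weighted density controlling the pairing of the slices of `pF G` with a function of finite
horizontal energy. -/
def nu (δ R₁ R₂ : ℝ) (G G₁ G₂ G₃ : 𝓢(E × ℝ, ℂ)) (s : ℝ) : ℝ :=
  R₁ * H.wE δ (sliceE s (pF G)) + R₂ / (8 * Real.pi) * lE (sliceE s (pF G))
    + 3 / (4 * Real.pi ^ 2 * (R₁ + R₂)) * (H.wE δ (sliceE s (pF G₁))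
      + lE (sliceE s (pF G₂)) / (8 * Real.pi) + 9 * H.wE δ (sliceE s (pF G₃)))

/-- The integral of `nu`. -/
def Nu (δ R₁ R₂ : ℝ) (G G₁ G₂ G₃ : 𝓢(E × ℝ, ℂ)) : ℝ :=
  R₁ * H.wV δ G + R₂ / (8 * Real.pi) * lV G
    + 3 / (4 * Real.pi ^ 2 * (R₁ + R₂)) * (H.wV δ G₁ + lV G₂ / (8 * Real.pi) + 9 * H.wV δ G₃)

lemma integrable_nu (δ R₁ R₂ : ℝ) (G G₁ G₂ G₃ : 𝓢(E × ℝ, ℂ)) :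
    Integrable (H.nu δ R₁ R₂ G G₁ G₂ G₃) :=
  (((H.integrable_wE_slice _ _).const_mul _).add ((integrable_lE_slice _).const_mul _)).add
    ((((H.integrable_wE_slice _ _).add ((integrable_lE_slice _).div_const _)).add
      ((H.integrable_wE_slice _ _).const_mul _)).const_mul _)

lemma integral_nu (δ R₁ R₂ : ℝ) (G G₁ G₂ G₃ : 𝓢(E × ℝ, ℂ)) :
    ∫ s, H.nu δ R₁ R₂ G G₁ G₂ G₃ s = H.Nu δ R₁ R₂ G G₁ G₂ G₃ := by
  have a1 := (H.integrable_wE_slice δ (pF G)).const_mul R₁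
  have a2 := (integrable_lE_slice (pF G)).const_mul (R₂ / (8 * Real.pi))
  have a3 := H.integrable_wE_slice δ (pF G₁)
  have a4 := (integrable_lE_slice (pF G₂)).div_const (8 * Real.pi)
  have a5 := (H.integrable_wE_slice δ (pF G₃)).const_mul 9
  unfold nu Nu
  have a34 : Integrable fun s => H.wE δ (sliceE s (pF G₁)) + lE (sliceE s (pF G₂)) / (8 * Real.pi) :=
    a3.add a4
  have a12 : Integrable fun s => R₁ * H.wE δ (sliceE s (pF G))
      + R₂ / (8 * Real.pi) * lE (sliceE s (pF G)) := a1.add a2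
  have a345 : Integrable fun s => H.wE δ (sliceE s (pF G₁)) + lE (sliceE s (pF G₂)) / (8 * Real.pi)
      + 9 * H.wE δ (sliceE s (pF G₃)) := a34.add a5
  rw [integral_add a12 (a345.const_mul _), integral_add a1 a2, integral_const_mul,
    integral_const_mul, integral_const_mul, integral_add a34 a5, integral_add a3 a4,
    integral_const_mul, integral_div]
  simp only [integral_wE_slice, integral_lE_slice, lV_pF, wV_pF]

lemma Nu_nonneg {δ R₁ R₂ : ℝ} (hδ : 0 ≤ δ) (h1 : 0 ≤ R₁) (h2 : 0 ≤ R₂)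
    (G G₁ G₂ G₃ : 𝓢(E × ℝ, ℂ)) : 0 ≤ H.Nu δ R₁ R₂ G G₁ G₂ G₃ := by
  have := Real.pi_pos
  have := H.wV_nonneg hδ G
  have := H.wV_nonneg hδ G₁
  have := H.wV_nonneg hδ G₃
  have := lV_nonneg G
  have := lV_nonneg G₂
  unfold Nu; positivity

lemma slice_bound {δ R₁ R₂ : ℝ} (hδ : 0 < δ) (h1 : 0 < R₁) (h2 : 0 < R₂)
    {G G₁ G₂ G₃ : 𝓢(E × ℝ, ℂ)} (hG : dT G = G₁ + G₂ + H.eulerV G₃) (u : 𝓢(E, ℂ)) (s : ℝ) :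
    (R₁ + R₂ + s ^ 2 / (R₁ + R₂)) * ‖∫ z, pF G (z, s) * conj (u z)‖ ^ 2
      ≤ H.gradE u * H.nu δ R₁ R₂ G G₁ G₂ G₃ s := by
  have hp := Real.pi_pos
  have sq1 : ∀ {x a b : ℝ}, 0 ≤ x → 0 ≤ a → 0 ≤ b → x ≤ √a * √b → x ^ 2 ≤ a * b := by
    intro x a b hx ha hb h
    have := pow_le_pow_left₀ hx h 2
    rwa [mul_pow, Real.sq_sqrt ha, Real.sq_sqrt hb] at this
  set I := ∫ z, pF G (z, s) * conj (u z) with hI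
  have b1 : ‖I‖ ^ 2 ≤ H.wE δ (sliceE s (pF G)) * H.gradE u :=
    sq1 (norm_nonneg _) (H.wE_nonneg hδ.le _) (H.gradE_nonneg u)
      (H.norm_integral_mul_conj_le' hδ u (sliceE s (pF G)))
  have b2 : ‖I‖ ^ 2 ≤ lE (sliceE s (pF G)) / (8 * Real.pi) * H.gradE u :=
    sq1 (norm_nonneg _) (by have := lE_nonneg (sliceE s (pF G)); positivity) (H.gradE_nonneg u)
      (H.norm_integral_sq_le_lE u (sliceE s (pF G)))
  have e : 2 * Real.pi * Complex.I * s * I = (∫ z, pF G₁ (z, s) * conj (u z))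
      + (∫ z, pF G₂ (z, s) * conj (u z)) + ∫ z, H.eulerE (sliceE s (pF G₃)) z * conj (u z) := by
    have k : ∀ z, 2 * Real.pi * Complex.I * s * (pF G (z, s) * conj (u z))
        = pF G₁ (z, s) * conj (u z) + pF G₂ (z, s) * conj (u z)
          + H.eulerE (sliceE s (pF G₃)) z * conj (u z) := by
      intro z
      have h3 := congrArg (fun h => h (z, s)) (pF_lineDeriv_t G)
      rw [hG, pF_add, pF_add, pF_eulerV] at h3
      rw [← sliceE_eulerV, sliceE_apply, ← add_mul, ← add_mul]
      simp only [add_apply] at h3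
      rw [h3]
      simp [tForm]; ring
    rw [hI, ← integral_const_mul]
    simp only [k]
    have i1 := integrable_mul_conj (sliceE s (pF G₁)) u
    have i2 := integrable_mul_conj (sliceE s (pF G₂)) u
    have i3 := integrable_mul_conj (H.eulerE (sliceE s (pF G₃))) u
    have i12 : Integrable fun z => pF G₁ (z, s) * conj (u z) + pF G₂ (z, s) * conj (u z) := i1.add i2
    rw [integral_add i12 i3]
    congr 1
    exact integral_add i1 i2
  have b3 : (2 * Real.pi * s) ^ 2 * ‖I‖ ^ 2 ≤ 3 * H.gradE u * (H.wE δ (sliceE s (pF G₁))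
      + lE (sliceE s (pF G₂)) / (8 * Real.pi) + 9 * H.wE δ (sliceE s (pF G₃))) := by
    have c1 := H.norm_integral_mul_conj_le' hδ u (sliceE s (pF G₁))
    have c2 := H.norm_integral_sq_le_lE u (sliceE s (pF G₂))
    have c3 := H.norm_integral_eulerE_mul_conj_le hδ u (sliceE s (pF G₃))
    simp only [sliceE_apply] at c1 c2
    have c0 := congrArg norm e
    rw [norm_mul] at c0
    have c4 : ‖(2 * Real.pi * Complex.I * s : ℂ)‖ = |2 * Real.pi * s| := by
      simp [abs_mul]
    have c5 := (norm_add_le ((∫ z, pF G₁ (z, s) * conj (u z)) + ∫ z, pF G₂ (z, s) * conj (u z))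
      (∫ z, H.eulerE (sliceE s (pF G₃)) z * conj (u z)))
    have c6 := norm_add_le (∫ z, pF G₁ (z, s) * conj (u z)) (∫ z, pF G₂ (z, s) * conj (u z))
    rw [← c0, c4] at c5
    set a := √(H.wE δ (sliceE s (pF G₁))) with ha
    set b := √(lE (sliceE s (pF G₂)) / (8 * Real.pi)) with hb
    set c := √(H.wE δ (sliceE s (pF G₃))) with hc
    set g := √(H.gradE u) with hg
    have c7 : |2 * Real.pi * s| * ‖I‖ ≤ (a + b + 3 * c) * g := by linarith
    have c8 := pow_le_pow_left₀ (by positivity) c7 2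
    rw [mul_pow, sq_abs] at c8
    have ea : a ^ 2 = H.wE δ (sliceE s (pF G₁)) := Real.sq_sqrt (H.wE_nonneg hδ.le _)
    have eb : b ^ 2 = lE (sliceE s (pF G₂)) / (8 * Real.pi) :=
      Real.sq_sqrt (by have := lE_nonneg (sliceE s (pF G₂)); positivity)
    have ec : c ^ 2 = H.wE δ (sliceE s (pF G₃)) := Real.sq_sqrt (H.wE_nonneg hδ.le _)
    have eg : g ^ 2 = H.gradE u := Real.sq_sqrt (H.gradE_nonneg u)
    rw [← ea, ← eb, ← ec, ← eg]
    refine c8.trans ?_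
    have : (a + b + 3 * c) ^ 2 ≤ 3 * (a ^ 2 + b ^ 2 + 9 * c ^ 2) := by
      nlinarith [sq_nonneg (a - b), sq_nonneg (a - 3 * c), sq_nonneg (b - 3 * c)]
    rw [mul_pow]
    nlinarith [sq_nonneg g]
  have e2 : s ^ 2 / (R₁ + R₂) * ‖I‖ ^ 2
      = 1 / (4 * Real.pi ^ 2 * (R₁ + R₂)) * ((2 * Real.pi * s) ^ 2 * ‖I‖ ^ 2) := by
    field_simp; ring
  have b4 : s ^ 2 / (R₁ + R₂) * ‖I‖ ^ 2 ≤ 1 / (4 * Real.pi ^ 2 * (R₁ + R₂)) *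
      (3 * H.gradE u * (H.wE δ (sliceE s (pF G₁))
      + lE (sliceE s (pF G₂)) / (8 * Real.pi) + 9 * H.wE δ (sliceE s (pF G₃)))) := by
    rw [e2]; gcongr
  calc _ = R₁ * ‖I‖ ^ 2 + R₂ * ‖I‖ ^ 2 + s ^ 2 / (R₁ + R₂) * ‖I‖ ^ 2 := by ring
    _ ≤ _ := add_le_add_three (mul_le_mul_of_nonneg_left b1 h1.le)
      (mul_le_mul_of_nonneg_left b2 h2.le) b4
    _ = _ := by unfold nu; ring

end HFrame
end Heis

namespace Heis
open SchwartzMap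
open scoped LineDeriv ContDiff FourierTransform ComplexConjugate

lemma integral_inv_add_sq_div {R : ℝ} (hR : 0 < R) :
    Integrable (fun s : ℝ => (R + s ^ 2 / R)⁻¹) ∧ ∫ s : ℝ, (R + s ^ 2 / R)⁻¹ = Real.pi := by
  have e : (fun s : ℝ => (R + s ^ 2 / R)⁻¹) = fun s => R⁻¹ * (1 + (R⁻¹ * s) ^ 2)⁻¹ := by
    ext s
    rw [← mul_inv]; congr 1
    field_simp
  rw [e]
  constructor
  · exact (integrable_inv_one_add_sq.comp_mul_left' (inv_ne_zero hR.ne')).const_mul _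
  · rw [integral_const_mul, Measure.integral_comp_mul_left (fun x : ℝ => (1 + x ^ 2)⁻¹),
      integral_univ_inv_one_add_sq, inv_inv, abs_of_pos hR, smul_eq_mul]
    field_simp

/-- Interpolation: an `L¹` bound for a function of one variable from a weighted `L²` bound. -/
lemma integral_norm_le_of_weighted {J : ℝ → ℂ} {R B c : ℝ} {ν : ℝ → ℝ} (hJ : Integrable J)
    (hν : Integrable ν) (hR : 0 < R) (hc : 0 < c)
    (h : ∀ s, (R + s ^ 2 / R) * ‖J s‖ ^ 2 ≤ B * ν s) :
    ∫ s, ‖J s‖ ≤ 1 / 2 * (c * Real.pi + B * (∫ s, ν s) / c) := by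
  obtain ⟨h1, h2⟩ := integral_inv_add_sq_div hR
  have h3 : ∀ s, ‖J s‖ ≤ 1 / 2 * (c * (R + s ^ 2 / R)⁻¹ + (B / c) * ν s) := by
    intro s
    have hw : 0 < R + s ^ 2 / R := by positivity
    have h4 : (R + s ^ 2 / R) * ‖J s‖ ^ 2 / c ≤ (B / c) * ν s := by
      rw [div_mul_eq_mul_div]; exact div_le_div_of_nonneg_right (h s) hc.le
    have h5 : 2 * ‖J s‖ ≤ c * (R + s ^ 2 / R)⁻¹ + (R + s ^ 2 / R) * ‖J s‖ ^ 2 / c := by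
      set w := R + s ^ 2 / R
      have : c * w⁻¹ + w * ‖J s‖ ^ 2 / c - 2 * ‖J s‖ = (c - w * ‖J s‖) ^ 2 / (w * c) := by
        field_simp; ring
      have h6 : 0 ≤ (c - w * ‖J s‖) ^ 2 / (w * c) := by positivity
      linarith
    linarith
  have h4 : Integrable fun s => c * (R + s ^ 2 / R)⁻¹ + (B / c) * ν s :=
    (h1.const_mul c).add (hν.const_mul _)
  refine (integral_mono hJ.norm (h4.const_mul (1 / 2)) h3).trans_eq ?_
  rw [integral_const_mul, integral_add (h1.const_mul c) (hν.const_mul _), integral_const_mul,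
    integral_const_mul, h2]
  ring

variable {E : Type} [NormedAddCommGroup E] [NormedSpace ℝ E]
variable {ι : Type} [Fintype ι] [DecidableEq ι]

namespace HFrame
variable (H : HFrame E ι)

variable [FiniteDimensional ℝ E] [MeasureSpace E] [BorelSpace E]
  [(volume : Measure E).IsAddHaarMeasure]

/-- Energy density as a Schwartz function. -/
def energyS (Φ : 𝓢(E × ℝ, ℂ)) : 𝓢(E × ℝ, ℂ) := ∑ i, mulS (H.XV i Φ) (cj (H.XV i Φ))

lemma intE_energyS (Φ : 𝓢(E × ℝ, ℂ)) (s : ℝ) :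
    ∫ z, H.energyS Φ (z, s) = ((H.gradE (sliceE s Φ) : ℝ) : ℂ) := by
  rw [gradE, ← integral_complex_ofReal]
  congr 1; ext z
  simp only [energyS, sum_apply, gdE, mulS_apply, cj_apply, Complex.mul_conj,
    Complex.normSq_eq_norm_sq, ← sliceE_XV, sliceE_apply]
  push_cast; rfl

lemma intE_dT_energyS {Φ Γ : 𝓢(E × ℝ, ℂ)} {σ : ℂ}
    (hΦ : dT (H.lapV Φ) = (-(2 * Real.pi * Complex.I)) • (Γ - σ • Φ)) (s : ℝ) :
    (∫ z, dT (H.energyS Φ) (z, s)).re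
      = 4 * Real.pi * (σ.im * lE (sliceE s Φ)
        - (∫ z, Γ (z, s) * conj (Φ (z, s))).im) := by
  have e1 : ∀ z, dT (H.energyS Φ) (z, s)
      = ∑ i, (H.XE i (sliceE s (dT Φ)) z * conj (H.XE i (sliceE s Φ) z)
        + H.XE i (sliceE s Φ) z * conj (H.XE i (sliceE s (dT Φ)) z)) := by
    intro z
    rw [dT_lineDeriv, energyS, LineDeriv.lineDerivOp_sum, sum_apply]
    refine Finset.sum_congr rfl fun i _ => ?_
    rw [lineDeriv_mulS, lineDeriv_cj]
    simp only [← dT_lineDeriv, dT_XV, ← sliceE_XV, sliceE_apply, cj_apply]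
  set A := ∑ i, ∫ z, H.XE i (sliceE s (dT Φ)) z * conj (H.XE i (sliceE s Φ) z) with hA
  have e2 : ∫ z, dT (H.energyS Φ) (z, s) = A + conj A := by
    have i0 : ∀ i, Integrable fun z => H.XE i (sliceE s (dT Φ)) z * conj (H.XE i (sliceE s Φ) z)
        + H.XE i (sliceE s Φ) z * conj (H.XE i (sliceE s (dT Φ)) z) := fun i =>
      (integrable_mul_conj _ _).add (integrable_mul_conj _ _)
    simp only [e1]
    rw [integral_finsetSum _ fun i _ => i0 i, hA, map_sum, ← Finset.sum_add_distrib]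
    refine Finset.sum_congr rfl fun i _ => ?_
    rw [integral_add (integrable_mul_conj _ _) (integrable_mul_conj _ _), ← integral_conj]
    congr 2; ext z; simp [mul_comm]
  have e3 : A = 2 * Real.pi * Complex.I * ((∫ z, Γ (z, s) * conj (Φ (z, s)))
      - σ * (lE (sliceE s Φ) : ℝ)) := by
    have h1 := H.integral_XE_XE_mul_conj (sliceE s (dT Φ)) (sliceE s Φ)
    have h2 : ∀ z, (∑ i, H.XE i (H.XE i (sliceE s (dT Φ))) z) * conj (sliceE s Φ z)
        = -(2 * Real.pi * Complex.I) * (Γ (z, s) * conj (Φ (z, s))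
          - σ * (sliceE s Φ z * conj (sliceE s Φ z))) := by
      intro z
      have h3 : ∑ i, H.XE i (H.XE i (sliceE s (dT Φ))) z = dT (H.lapV Φ) (z, s) := by
        rw [dT_lapV, lapV_apply]; simp only [← sliceE_XV, sliceE_apply]
      rw [h3, hΦ]; simp; ring
    have i1 : Integrable fun z => Γ (z, s) * conj (Φ (z, s)) :=
      integrable_mul_conj (sliceE s Γ) (sliceE s Φ)
    simp only [h2] at h1
    rw [integral_const_mul, integral_sub i1 ((integrable_mul_conj _ _).const_mul _),
      integral_const_mul, integral_mul_conj_self, ← hA] at h1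
    rw [eq_comm, neg_eq_iff_eq_neg] at h1
    rw [h1]
    ring
  rw [e2, Complex.add_re, Complex.conj_re, e3]
  simp
  ring

/-- Uniform bound for the horizontal energy of slices of a solution. -/
lemma gradE_slice_le {δ R₁ R₂ : ℝ} (hδ : 0 < δ) (h1 : 0 < R₁) (h2 : 0 < R₂) {σ : ℂ}
    (hσ : σ.im ≠ 0) {F G G₁ G₂ G₃ : 𝓢(E × ℝ, ℂ)} (hG : dT G = G₁ + G₂ + H.eulerV G₃)
    (hF : mulForm 1 (tForm E) (H.lapV F) + σ • F = G) (s₀ : ℝ) :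
    H.gradE (sliceE s₀ (pF F)) ≤ 16 * Real.pi ^ 3 * H.Nu δ R₁ R₂ G G₁ G₂ G₃ := by
  have hp := Real.pi_pos
  set Φ := pF F with hΦd
  set Γ := pF G with hΓd
  have hΦ : dT (H.lapV Φ) = (-(2 * Real.pi * Complex.I)) • (Γ - σ • Φ) := by
    rw [hΓd, ← hF, hΦd, pF_add, pF_smul, add_sub_cancel_right, ← pF_smul, ← pF_lapV,
      lineDeriv_t_pF]
    congr 1; ext p; simp [mul_assoc]
  set J : ℝ → ℂ := fun s => ∫ z, Γ (z, s) * conj (Φ (z, s)) with hJd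
  have hJ : Integrable J := integrable_intE (mulS Γ (cj Φ))
  set B := 4 * Real.pi * ∫ s, ‖J s‖ with hB
  have hder := H.intE_dT_energyS hΦ
  have hre : ∀ s, H.gradE (sliceE s Φ) = (∫ z, H.energyS Φ (z, s)).re := fun s => by
    rw [intE_energyS, Complex.ofReal_re]
  have hdi := integrable_intE (dT (H.energyS Φ))
  have hdi' : Integrable fun s => (∫ z, dT (H.energyS Φ) (z, s)).re := hdi.re
  have hJ4 : Integrable fun s => 4 * Real.pi * ‖J s‖ := hJ.norm.const_mul _
  have hle : ∀ (S : Set ℝ), ∫ s in S, 4 * Real.pi * ‖J s‖ ≤ B := fun S => by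
    rw [hB, ← integral_const_mul]
    exact setIntegral_le_integral hJ4 (.of_forall fun s => by positivity)
  have hq : ∀ s, H.gradE (sliceE s Φ) ≤ B := by
    intro s
    rw [hre]
    rcases lt_or_gt_of_ne hσ with h | h
    · rw [intE_eq_Iic]
      have e := integral_re (hdi.integrableOn (s := Set.Iic s))
      simp only [RCLike.re_to_complex] at e
      rw [← e]
      refine (integral_mono hdi'.integrableOn hJ4.integrableOn fun s => ?_).trans (hle _)
      simp only
      rw [hder, mul_assoc (4 : ℝ), mul_assoc (4 : ℝ)]
      have a1 := (Complex.abs_im_le_norm (J s))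
      have a2 : σ.im * lE (sliceE s Φ) ≤ 0 := mul_nonpos_of_nonpos_of_nonneg h.le (lE_nonneg _)
      have a3 := neg_abs_le (J s).im
      gcongr
      change σ.im * lE (sliceE s Φ) - (J s).im ≤ _
      linarith
    · rw [intE_eq_Ioi, Complex.neg_re]
      have e := integral_re (hdi.integrableOn (s := Set.Ioi s))
      simp only [RCLike.re_to_complex] at e
      rw [← e, ← integral_neg]
      refine (integral_mono hdi'.neg.integrableOn hJ4.integrableOn fun s => ?_).trans (hle _)
      simp only [Pi.neg_apply]
      rw [hder, mul_assoc (4 : ℝ), mul_assoc (4 : ℝ), ← mul_neg, ← mul_neg]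
      have a1 := (Complex.abs_im_le_norm (J s))
      have a2 : 0 ≤ σ.im * lE (sliceE s Φ) := mul_nonneg h.le (lE_nonneg _)
      have a3 := le_abs_self (J s).im
      gcongr
      change -(σ.im * lE (sliceE s Φ) - (J s).im) ≤ _
      linarith
  have hB0 : 0 ≤ B := (H.gradE_nonneg _).trans (hq 0)
  have hnu0 : ∀ s, 0 ≤ H.nu δ R₁ R₂ G G₁ G₂ G₃ s := fun s => by
    have := H.wE_nonneg hδ.le (sliceE s (pF G))
    have := H.wE_nonneg hδ.le (sliceE s (pF G₁))
    have := H.wE_nonneg hδ.le (sliceE s (pF G₃))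
    have := lE_nonneg (sliceE s (pF G))
    have := lE_nonneg (sliceE s (pF G₂))
    unfold nu; positivity
  set N := H.Nu δ R₁ R₂ G G₁ G₂ G₃ with hN
  have hN0 : 0 ≤ N := H.Nu_nonneg hδ.le h1.le h2.le G G₁ G₂ G₃
  refine (hq s₀).trans (le_of_forall_pos_le_add fun ε hε => ?_)
  set ε' := ε / (16 * Real.pi ^ 3) with hε'
  have hε0 : 0 < ε' := by positivity
  have hcN : 0 < 4 * Real.pi * (N + ε') := by positivity
  have key := integral_norm_le_of_weighted hJ (H.integrable_nu δ R₁ R₂ G G₁ G₂ G₃)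
    (add_pos h1 h2) hcN (B := B) fun s =>
      (H.slice_bound hδ h1 h2 hG (sliceE s Φ) s).trans
        (mul_le_mul_of_nonneg_right (hq s) (hnu0 s))
  rw [integral_nu, ← hN] at key
  have k1 : B * N / (4 * Real.pi * (N + ε')) ≤ B / (4 * Real.pi) := by
    rw [div_le_div_iff₀ hcN (by positivity)]
    have : 0 ≤ B * Real.pi * ε' := by positivity
    nlinarith
  have k2 : B ≤ 4 * Real.pi * (1 / 2 * (4 * Real.pi * (N + ε') * Real.pi + B / (4 * Real.pi))) := by
    refine (mul_le_mul_of_nonneg_left key (by positivity : 0 ≤ 4 * Real.pi)).trans ?_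
    gcongr
  have k3 : 4 * Real.pi * (1 / 2 * (4 * Real.pi * (N + ε') * Real.pi + B / (4 * Real.pi)))
      = 8 * Real.pi ^ 3 * (N + ε') + B / 2 := by field_simp; ring
  have k4 : 16 * Real.pi ^ 3 * ε' = ε := by rw [hε']; field_simp
  linarith

/-- Bilinear bound for a solution tested against a second family. -/
lemma norm_integral_solution_mul_conj_le {δ R₁ R₂ : ℝ} (hδ : 0 < δ) (h1 : 0 < R₁) (h2 : 0 < R₂)
    {σ : ℂ} (hσ : σ.im ≠ 0) {F G G₁ G₂ G₃ P P₁ P₂ P₃ : 𝓢(E × ℝ, ℂ)}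
    (hG : dT G = G₁ + G₂ + H.eulerV G₃) (hP : dT P = P₁ + P₂ + H.eulerV P₃)
    (hF : mulForm 1 (tForm E) (H.lapV F) + σ • F = G) {C : ℝ} (hC : 0 < C) :
    ‖∫ p, F p * conj (P p)‖ ≤ 2 * Real.pi ^ 2 * (C * H.Nu δ R₁ R₂ G G₁ G₂ G₃
      + H.Nu δ R₁ R₂ P P₁ P₂ P₃ / C) := by
  have hp := Real.pi_pos
  have hq := H.gradE_slice_le hδ h1 h2 hσ hG hF
  set N := H.Nu δ R₁ R₂ G G₁ G₂ G₃ with hN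
  set M := H.Nu δ R₁ R₂ P P₁ P₂ P₃ with hM
  have hN0 : 0 ≤ N := H.Nu_nonneg hδ.le h1.le h2.le G G₁ G₂ G₃
  have hM0 : 0 ≤ M := H.Nu_nonneg hδ.le h1.le h2.le P P₁ P₂ P₃
  set J : ℝ → ℂ := fun s => ∫ z, pF P (z, s) * conj (pF F (z, s)) with hJd
  have hJ : Integrable J := integrable_intE (mulS (pF P) (cj (pF F)))
  have e1 : ‖∫ p, F p * conj (P p)‖ ≤ ∫ s, ‖J s‖ := by
    have e2 : ∫ p, F p * conj (P p) = conj (∫ p, P p * conj (F p)) := by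
      rw [← integral_conj]; congr 1; ext z; simp [mul_comm]
    have e3 := integral_prod_S_symm (mulS (pF P) (cj (pF F)))
    simp only [mulS_apply, cj_apply, integral_pF_mul_conj] at e3
    rw [e2, RCLike.norm_conj, e3]
    exact norm_integral_le_integral_norm _
  have hnu0 : ∀ s, 0 ≤ H.nu δ R₁ R₂ P P₁ P₂ P₃ s := fun s => by
    have := H.wE_nonneg hδ.le (sliceE s (pF P))
    have := H.wE_nonneg hδ.le (sliceE s (pF P₁))
    have := H.wE_nonneg hδ.le (sliceE s (pF P₃))
    have := lE_nonneg (sliceE s (pF P))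
    have := lE_nonneg (sliceE s (pF P₂))
    unfold nu; positivity
  refine e1.trans (le_of_forall_pos_le_add fun ε hε => ?_)
  set ε' := C * ε / (2 * Real.pi ^ 2) with hε'
  have hε0 : 0 < ε' := by positivity
  have hcN : 0 < 4 * Real.pi * (M + ε') / C := by positivity
  have key := integral_norm_le_of_weighted hJ (H.integrable_nu δ R₁ R₂ P P₁ P₂ P₃)
    (add_pos h1 h2) hcN (B := 16 * Real.pi ^ 3 * N) fun s =>
      (H.slice_bound hδ h1 h2 hP (sliceE s (pF F)) s).trans
        (mul_le_mul_of_nonneg_right (hq s) (hnu0 s))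
  rw [integral_nu, ← hM] at key
  have k1 : 16 * Real.pi ^ 3 * N * M / (4 * Real.pi * (M + ε') / C) ≤ 4 * Real.pi ^ 2 * C * N := by
    rw [div_le_iff₀ hcN]
    have e : 4 * Real.pi ^ 2 * C * N * (4 * Real.pi * (M + ε') / C)
      = 16 * Real.pi ^ 3 * N * M + 16 * Real.pi ^ 3 * N * ε' := by field_simp; ring
    rw [e]
    have : 0 ≤ 16 * Real.pi ^ 3 * N * ε' := by positivity
    linarith
  have k3 : 1 / 2 * (4 * Real.pi * (M + ε') / C * Real.pi + 4 * Real.pi ^ 2 * C * N)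
      = 2 * Real.pi ^ 2 * (C * N + M / C) + 2 * Real.pi ^ 2 * ε' / C := by field_simp; ring
  have k4 : 2 * Real.pi ^ 2 * ε' / C = ε := by rw [hε']; field_simp
  rw [← k4, ← k3]
  exact key.trans (by gcongr)

end HFrame
end Heis

namespace Heis
open SchwartzMap
open scoped LineDeriv ContDiff FourierTransform ComplexConjugate

lemma contDiff_of_forall_tsupport {f : ℝ → ℝ} (h : ∀ x ∈ tsupport f, ContDiffAt ℝ ∞ f x) :
    ContDiff ℝ ∞ f := by
  refine contDiff_iff_contDiffAt.2 fun x => ?_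
  by_cases hx : x ∈ tsupport f
  · exact h x hx
  · exact contDiffAt_const.congr_of_eventuallyEq (notMem_tsupport_iff_eventuallyEq.1 hx)

/-- Smooth functions on the line supported in `[r/4, 7r/4]`. -/
structure Cutoff (r : ℝ) (κ : ℝ → ℝ) : Prop where
  smooth : ContDiff ℝ ∞ κ
  supp : ∀ l, l ∉ Set.Icc (r / 4) (7 * r / 4) → κ l = 0

namespace Cutoff
variable {r : ℝ} {κ : ℝ → ℝ}

lemma tsupport_subset (h : Cutoff r κ) : tsupport κ ⊆ Set.Icc (r / 4) (7 * r / 4) :=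
  closure_minimal (fun l hl => by_contra fun hn => hl (h.supp l hn)) isClosed_Icc

lemma deriv (h : Cutoff r κ) : Cutoff r (deriv κ) where
  smooth := (contDiff_infty_iff_deriv.1 h.smooth).2
  supp l hl := by
    have : l ∉ tsupport (_root_.deriv κ) := fun hn => hl (h.tsupport_subset (tsupport_deriv_subset hn))
    exact image_eq_zero_of_notMem_tsupport this

lemma const_mul (h : Cutoff r κ) (c : ℝ) : Cutoff r fun l => c * κ l where
  smooth := contDiff_const.mul h.smooth
  supp l hl := by simp [h.supp l hl]

lemma mul_rpow (hr : 0 < r) (h : Cutoff r κ) (s : ℝ) : Cutoff r fun l => κ l * l ^ s where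
  smooth := by
    refine contDiff_of_forall_tsupport fun l hl => ?_
    have h1 := h.tsupport_subset (closure_mono (Function.support_mul_subset_left κ _) hl)
    exact h.smooth.contDiffAt.mul
      (Real.contDiffAt_rpow_const_of_ne (by have := h1.1; intro h0; linarith))
  supp l hl := by simp [h.supp l hl]

lemma hasTemperateGrowth (h : Cutoff r κ) : Function.HasTemperateGrowth κ :=
  HasCompactSupport.hasTemperateGrowth
    (HasCompactSupport.of_support_subset_isCompact isCompact_Icc
      (subset_closure.trans h.tsupport_subset)) h.smooth

lemma pos_of_ne (hr : 0 < r) (h : Cutoff r κ) {l : ℝ} (hl : κ l ≠ 0) : 0 < l := by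
  by_contra hn
  exact hl (h.supp l fun h2 => by have := h2.1; linarith)

end Cutoff

/-- A smooth cutoff equal to one on `[r/8, 15r/8]`. -/
def bumpR {r : ℝ} (hr : 0 < r) : ContDiffBump r where
  rIn := 7 * r / 8
  rOut := 15 * r / 16
  rIn_pos := by positivity
  rIn_lt_rOut := by linarith

/-- A smooth positive function equal to `l ^ (-1/2)` on `[r/8, 15r/8]`. -/
def scaleFun {r : ℝ} (hr : 0 < r) (l : ℝ) : ℝ := 1 + bumpR hr l * (l ^ (-(1 / 2) : ℝ) - 1)

section scale
variable {r : ℝ} (hr : 0 < r)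

lemma scaleFun_eq {l : ℝ} (h1 : r / 8 ≤ l) (h2 : l ≤ 15 * r / 8) :
    scaleFun hr l = l ^ (-(1 / 2) : ℝ) := by
  have : bumpR hr l = 1 := by
    refine (bumpR hr).one_of_mem_closedBall ?_
    rw [Metric.mem_closedBall, Real.dist_eq, abs_le]
    change -(7 * r / 8) ≤ _ ∧ _ ≤ 7 * r / 8
    constructor <;> linarith
  rw [scaleFun, this]; ring

lemma scaleFun_growth : Function.HasTemperateGrowth (scaleFun hr) := by
  refine (Function.HasTemperateGrowth.const 1).add ?_
  have hs : Function.support (fun l => bumpR hr l * (l ^ (-(1 / 2) : ℝ) - 1))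
      ⊆ Metric.ball r (15 * r / 16) := by
    rw [← (show (bumpR hr).rOut = 15 * r / 16 from rfl), ← (bumpR hr).support_eq]
    exact Function.support_mul_subset_left _ _
  refine HasCompactSupport.hasTemperateGrowth
    (HasCompactSupport.of_support_subset_isCompact (isCompact_closedBall r (15 * r / 16))
      (hs.trans Metric.ball_subset_closedBall)) ?_
  refine contDiff_of_forall_tsupport fun l hl => ?_
  have h1 : l ∈ Metric.closedBall r (15 * r / 16) :=
    closure_minimal (hs.trans Metric.ball_subset_closedBall) Metric.isClosed_closedBall hl
  rw [Metric.mem_closedBall, Real.dist_eq, abs_le] at h1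
  have h2 : l ≠ 0 := by intro h; rw [h] at h1; linarith [h1.1]
  exact (bumpR hr).contDiffAt.mul
    ((Real.contDiffAt_rpow_const_of_ne h2).sub contDiffAt_const)

lemma exists_scaleFun_lower : ∃ c : ℝ, 0 < c ∧ ∀ l, c ≤ scaleFun hr l := by
  refine ⟨min 1 ((2 * r) ^ (-(1 / 2) : ℝ)), lt_min one_pos (by positivity), fun l => ?_⟩
  set c := min 1 ((2 * r) ^ (-(1 / 2) : ℝ))
  by_cases h0 : bumpR hr l = 0
  · rw [scaleFun, h0, zero_mul, add_zero]; exact min_le_left _ _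
  · have h1 : l ∈ Function.support (bumpR hr) := h0
    rw [(bumpR hr).support_eq, Metric.mem_ball, Real.dist_eq, abs_lt] at h1
    change -(15 * r / 16) < _ ∧ _ < 15 * r / 16 at h1
    have h2 : (2 * r) ^ (-(1 / 2) : ℝ) ≤ l ^ (-(1 / 2) : ℝ) :=
      Real.rpow_le_rpow_of_nonpos (by linarith [h1.1]) (by linarith [h1.2]) (by norm_num)
    have h3 : c ≤ l ^ (-(1 / 2) : ℝ) := (min_le_right _ _).trans h2
    have h4 : c ≤ 1 := min_le_left _ _
    have h5 := (bumpR hr).nonneg (x := l)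
    have h6 := (bumpR hr).le_one (x := l)
    unfold scaleFun
    nlinarith

end scale

variable {E : Type} [NormedAddCommGroup E] [NormedSpace ℝ E]
variable {ι : Type} [Fintype ι] [DecidableEq ι]

/-- The smooth change of variables `(z, l) ↦ (scaleFun l • z, l)`. -/
def scaleMap {r : ℝ} (hr : 0 < r) (p : E × ℝ) : E × ℝ := (scaleFun hr p.2 • p.1, p.2)

lemma scaleMap_growth {r : ℝ} (hr : 0 < r) :
    Function.HasTemperateGrowth (scaleMap hr : E × ℝ → E × ℝ) := by
  have h1 : (scaleMap hr : E × ℝ → E × ℝ) = fun p =>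
      ContinuousLinearMap.inl ℝ E ℝ (scaleFun hr p.2 • p.1) + ContinuousLinearMap.inr ℝ E ℝ p.2 := by
    ext p <;> simp [scaleMap]
  have h2 : Function.HasTemperateGrowth fun p : E × ℝ => scaleFun hr p.2 • p.1 :=
    ((scaleFun_growth hr).comp (hasTemperateGrowth_clm (ContinuousLinearMap.snd ℝ E ℝ))).smul
      (hasTemperateGrowth_clm (ContinuousLinearMap.fst ℝ E ℝ))
  rw [h1]
  exact ((hasTemperateGrowth_clm (ContinuousLinearMap.inl ℝ E ℝ)).comp h2).add
    ((hasTemperateGrowth_clm ((ContinuousLinearMap.inr ℝ E ℝ).comp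
      (ContinuousLinearMap.snd ℝ E ℝ))))

/-- Composition with `scaleMap`. -/
def scaleS {r : ℝ} (hr : 0 < r) (h : 𝓢(E × ℝ, ℂ)) : 𝓢(E × ℝ, ℂ) :=
  compCLM ℝ (g := scaleMap hr) (scaleMap_growth hr) (by
    obtain ⟨c, hc, hl⟩ := exists_scaleFun_lower hr
    refine ⟨1, c⁻¹ + 1, fun p => ?_⟩
    have h1 : ‖p.1‖ ≤ c⁻¹ * ‖scaleMap hr p‖ := by
      have h2 : ‖scaleFun hr p.2 • p.1‖ ≤ ‖scaleMap hr p‖ := norm_fst_le (scaleMap hr p)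
      have h3 : 0 < scaleFun hr p.2 := hc.trans_le (hl _)
      rw [norm_smul, Real.norm_of_nonneg h3.le] at h2
      rw [inv_mul_eq_div, le_div_iff₀ hc]
      nlinarith [hl p.2, norm_nonneg p.1]
    have h2 : ‖p.2‖ ≤ ‖scaleMap hr p‖ := norm_snd_le (scaleMap hr p)
    have h3 := norm_nonneg (scaleMap hr p)
    have h4 : 0 < c⁻¹ := inv_pos.mpr hc
    rw [pow_one, Prod.norm_def]
    refine max_le ?_ ?_ <;> nlinarith) h

namespace HFrame
variable (H : HFrame E ι)

/-- Localisation in the frequency `l` combined with the unitary rescaling `z ↦ l ^ (-1/2) z`. -/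
def loc {r : ℝ} (hr : 0 < r) (κ : ℝ → ℝ) (h : 𝓢(E × ℝ, ℂ)) : 𝓢(E × ℝ, ℂ) :=
  smulLeftCLM ℂ (fun p : E × ℝ => ((κ p.2 * p.2 ^ (-(H.m / 2)) : ℝ) : ℂ)) (scaleS hr h)

variable {r : ℝ} (hr : 0 < r) {κ : ℝ → ℝ}

lemma loc_apply (hκ : Cutoff r κ) (h : 𝓢(E × ℝ, ℂ)) (z : E) (l : ℝ) :
    H.loc hr κ h (z, l)
      = ((κ l * l ^ (-(H.m / 2)) : ℝ) : ℂ) * h (l ^ (-(1 / 2) : ℝ) • z, l) := by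
  have hg : Function.HasTemperateGrowth
      fun p : E × ℝ => ((κ p.2 * p.2 ^ (-(H.m / 2)) : ℝ) : ℂ) :=
    Function.Complex.hasTemperateGrowth_ofReal.comp
      ((hκ.mul_rpow hr _).hasTemperateGrowth.comp
        (hasTemperateGrowth_clm (ContinuousLinearMap.snd ℝ E ℝ)))
  rw [loc, smulLeftCLM_apply_apply hg, smul_eq_mul]
  by_cases hl : l ∈ Set.Icc (r / 4) (7 * r / 4)
  · have : scaleS hr h (z, l) = h (scaleFun hr l • z, l) := rfl
    rw [this, scaleFun_eq hr (by linarith [hl.1]) (by linarith [hl.2])]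
  · simp [hκ.supp l hl]

lemma cV_loc (hκ : Cutoff r κ) (h : 𝓢(E × ℝ, ℂ)) (i : ι) :
    H.cV i (H.loc hr κ h) = H.loc hr (fun l => κ l * l ^ (1 / 2 : ℝ)) (H.cV i h) := by
  ext ⟨z, l⟩
  rw [cV_apply, loc_apply H hr hκ, loc_apply H hr (hκ.mul_rpow hr _), cV_apply]
  by_cases h0 : κ l = 0
  · simp [h0]
  have hl := hκ.pos_of_ne hr h0
  have e : l ^ (1 / 2 : ℝ) * l ^ (-(1 / 2) : ℝ) = 1 := by
    rw [← Real.rpow_add hl]; norm_num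
  have e' : ((l ^ (1 / 2 : ℝ) : ℝ) : ℂ) * ((l ^ (-(1 / 2) : ℝ) : ℝ) : ℂ) = 1 := by exact_mod_cast e
  simp only [map_smul, smul_eq_mul, Complex.ofReal_mul]
  linear_combination (-(κ l * (l ^ (-(H.m / 2)) : ℝ) * H.c i z
    * h (l ^ (-(1 / 2) : ℝ) • z, l) : ℂ)) * e'

/-- The field `X_i` after a partial Fourier transform. -/
def XL (i : ι) (h : 𝓢(E × ℝ, ℂ)) : 𝓢(E × ℝ, ℂ) :=
  dZ (H.e i) h + mulForm (4 * Real.pi * Complex.I) ((H.b i).comp (ContinuousLinearMap.fst ℝ E ℝ))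
    (mulForm 1 (tForm E) h)

lemma XL_apply (i : ι) (h : 𝓢(E × ℝ, ℂ)) (z : E) (l : ℝ) :
    H.XL i h (z, l) = dZ (H.e i) h (z, l) + 4 * Real.pi * Complex.I * H.b i z * l * h (z, l) := by
  simp [XL, tForm]; ring

variable [FiniteDimensional ℝ E] [MeasureSpace E] [BorelSpace E]
  [(volume : Measure E).IsAddHaarMeasure]

lemma dZ_loc (hκ : Cutoff r κ) (h : 𝓢(E × ℝ, ℂ)) (v : E) :
    dZ v (H.loc hr κ h) = H.loc hr (fun l => κ l * l ^ (-(1 / 2) : ℝ)) (dZ v h) := by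
  ext ⟨z, l⟩
  rw [loc_apply H hr (hκ.mul_rpow hr _)]
  have e0 : ∀ k : 𝓢(E × ℝ, ℂ), ∀ y : E, dZ v k (y, l) = fderiv ℝ (sliceE l k) y v := fun k y => by
    rw [← sliceE_apply, sliceE_dZ, lineDerivOp_apply_eq_fderiv]
  rw [e0, e0]
  have e1 : ⇑(sliceE l (H.loc hr κ h)) = fun z => ((κ l * l ^ (-(H.m / 2)) : ℝ) : ℂ)
      * sliceE l h (l ^ (-(1 / 2) : ℝ) • z) := by
    ext z; exact H.loc_apply hr hκ h z l
  have h1 : HasFDerivAt (fun z : E => l ^ (-(1 / 2) : ℝ) • z)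
      (l ^ (-(1 / 2) : ℝ) • ContinuousLinearMap.id ℝ E) z := (hasFDerivAt_id z).const_smul _
  have h2 := ((sliceE l h).differentiableAt (x := l ^ (-(1 / 2) : ℝ) • z)).hasFDerivAt.comp z h1
  rw [e1]
  erw [(h2.const_mul _).fderiv]
  simp; ring

lemma XV_loc (hκ : Cutoff r κ) (h : 𝓢(E × ℝ, ℂ)) (i : ι) :
    H.XV i (H.loc hr κ h) = H.loc hr (fun l => κ l * l ^ (-(1 / 2) : ℝ)) (H.XL i h) := by
  ext ⟨z, l⟩
  rw [XV_apply, dZ_loc H hr hκ, loc_apply H hr hκ, loc_apply H hr (hκ.mul_rpow hr _),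
    loc_apply H hr (hκ.mul_rpow hr _), XL_apply]
  by_cases h0 : κ l = 0
  · simp [h0]
  have hl := hκ.pos_of_ne hr h0
  have e : l ^ (-(1 / 2) : ℝ) * l ^ (-(1 / 2) : ℝ) * l = 1 := by
    rw [← Real.rpow_add hl]; norm_num
    rw [Real.rpow_neg_one]; field_simp
  have e' : ((l ^ (-(1 / 2) : ℝ) : ℝ) : ℂ) * ((l ^ (-(1 / 2) : ℝ) : ℝ) : ℂ) * (l : ℂ) = 1 := by
    exact_mod_cast e
  simp only [map_smul, smul_eq_mul, Complex.ofReal_mul]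
  linear_combination (-(κ l * (l ^ (-(H.m / 2)) : ℝ) * H.b i z * (4 * Real.pi * Complex.I)
    * h (l ^ (-(1 / 2) : ℝ) • z, l) : ℂ)) * e'

/-- The sublaplacian after a partial Fourier transform. -/
def lapL (h : 𝓢(E × ℝ, ℂ)) : 𝓢(E × ℝ, ℂ) := ∑ i, H.XL i (H.XL i h)

lemma mulForm_lapV_loc (hκ : Cutoff r κ) (h : 𝓢(E × ℝ, ℂ)) :
    mulForm 1 (tForm E) (H.lapV (H.loc hr κ h)) = H.loc hr κ (H.lapL h) := by
  ext ⟨z, l⟩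
  rw [mulForm_apply, lapV_apply, loc_apply H hr hκ, lapL, sum_apply]
  simp only [XV_loc H hr hκ, XV_loc H hr (hκ.mul_rpow hr _),
    loc_apply H hr ((hκ.mul_rpow hr _).mul_rpow hr _)]
  rw [← Finset.mul_sum]
  by_cases h0 : κ l = 0
  · simp [h0]
  have hl := hκ.pos_of_ne hr h0
  have e : l ^ (-(1 / 2) : ℝ) * l ^ (-(1 / 2) : ℝ) * l = 1 := by
    rw [← Real.rpow_add hl]; norm_num
    rw [Real.rpow_neg_one]; field_simp
  have e' : ((l ^ (-(1 / 2) : ℝ) : ℝ) : ℂ) * ((l ^ (-(1 / 2) : ℝ) : ℝ) : ℂ) * (l : ℂ) = 1 := by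
    exact_mod_cast e
  set S := ∑ i, (H.XL i (H.XL i h)) (l ^ (-(1 / 2) : ℝ) • z, l)
  simp only [smul_eq_mul, Complex.ofReal_mul, tForm, ContinuousLinearMap.coe_snd']
  linear_combination (κ l * (l ^ (-(H.m / 2)) : ℝ) * S : ℂ) * e'

lemma loc_add (h k : 𝓢(E × ℝ, ℂ)) : H.loc hr κ (h + k) = H.loc hr κ h + H.loc hr κ k := by
  simp [loc, scaleS]

lemma loc_smul (c : ℂ) (hκ : Cutoff r κ) (h : 𝓢(E × ℝ, ℂ)) :
    H.loc hr κ (c • h) = c • H.loc hr κ h := by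
  ext ⟨z, l⟩; rw [smul_apply, loc_apply H hr hκ, loc_apply H hr hκ]; simp; ring

lemma loc_eq (hκ : Cutoff r κ) {f g : 𝓢(E × ℝ, ℂ)} {σ : ℂ} (h : H.lapL f + σ • f = g) :
    mulForm 1 (tForm E) (H.lapV (H.loc hr κ f)) + σ • H.loc hr κ f = H.loc hr κ g := by
  rw [mulForm_lapV_loc H hr hκ, ← loc_smul H hr σ hκ, ← loc_add, h]

lemma dT_loc (hκ : Cutoff r κ) (h : 𝓢(E × ℝ, ℂ)) :
    dT (H.loc hr κ h) = H.loc hr (deriv κ) h + H.loc hr κ (dT h)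
      + H.eulerV (H.loc hr (fun l => -(1 / 2) * (κ l * l ^ (-1 : ℝ))) h) := by
  have hκ2 := (hκ.mul_rpow hr (-1)).const_mul (-(1 / 2))
  ext ⟨z, l⟩
  simp only [add_apply]
  rw [eulerV_apply]
  simp only [dZ_loc H hr hκ2, loc_apply H hr hκ2, loc_apply H hr (hκ2.mul_rpow hr _),
    loc_apply H hr hκ, loc_apply H hr hκ.deriv]
  have hd := hasDerivAt_slice (H.loc hr κ h) z l
  simp only [loc_apply H hr hκ] at hd
  have hs : ∀ y : E, ∑ i, H.c i z * dZ (H.e i) h (y, l) = fderiv ℝ h (y, l) (z, 0) := by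
    intro y
    conv_rhs => rw [← H.sum_ce z]
    have : ((∑ i, H.c i z • H.e i, 0) : E × ℝ) = ∑ i, H.c i z • (H.e i, (0 : ℝ)) := by
      rw [Prod.ext_iff]; simp [Prod.fst_sum, Prod.snd_sum]
    rw [this, map_sum]
    refine Finset.sum_congr rfl fun i _ => ?_
    rw [map_smul, dZ_apply, Complex.real_smul]
  rcases le_or_gt l 0 with hl | hl
  · have h0 : ∀ᶠ s in nhds l, κ s = 0 := by
      filter_upwards [Iio_mem_nhds (show l < r / 4 by linarith)] with s hs
      exact hκ.supp s fun h2 => by have := h2.1; exact absurd hs (not_lt.mpr this)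
    have h1 : HasDerivAt (fun s => ((κ s * s ^ (-(H.m / 2)) : ℝ) : ℂ)
        * h (s ^ (-(1 / 2) : ℝ) • z, s)) 0 l := by
      refine (hasDerivAt_const l (0 : ℂ)).congr_of_eventuallyEq ?_
      filter_upwards [h0] with s hs
      simp [hs]
    rw [hd.unique h1, h0.self_of_nhds]
    have : deriv κ l = 0 := hκ.deriv.supp l fun h2 => by have := h2.1; linarith
    simp [this]
  · have k1 : HasDerivAt κ (deriv κ l) l := (hκ.smooth.differentiable (by simp) l).hasDerivAt
    have k2 := Real.hasDerivAt_rpow_const (x := l) (p := -(H.m / 2)) (Or.inl hl.ne')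
    have k3 := Real.hasDerivAt_rpow_const (x := l) (p := (-(1 / 2) : ℝ)) (Or.inl hl.ne')
    have k4 : HasDerivAt (fun s : ℝ => (s ^ (-(1 / 2) : ℝ) • z, s))
        ((-(1 / 2) * l ^ (-(1 / 2) - 1 : ℝ)) • z, (1 : ℝ)) l :=
      (k3.smul_const z).prodMk (hasDerivAt_id l)
    have k5 : HasDerivAt (fun s : ℝ => h (s ^ (-(1 / 2) : ℝ) • z, s))
        (fderiv ℝ h (l ^ (-(1 / 2) : ℝ) • z, l)
          ((-(1 / 2) * l ^ (-(1 / 2) - 1 : ℝ)) • z, (1 : ℝ))) l :=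
      HasFDerivAt.comp_hasDerivAt (f := fun s : ℝ => (s ^ (-(1 / 2) : ℝ) • z, s)) l
        (h.differentiableAt (x := (l ^ (-(1 / 2) : ℝ) • z, l))).hasFDerivAt k4
    have k6 := ((k1.mul k2).ofReal_comp).mul k5
    rw [hd.unique k6]
    have e1 : fderiv ℝ h (l ^ (-(1 / 2) : ℝ) • z, l) ((-(1 / 2) * l ^ (-(1 / 2) - 1 : ℝ)) • z, (1 : ℝ))
        = dT h (l ^ (-(1 / 2) : ℝ) • z, l)
          + ((-(1 / 2) * l ^ (-(1 / 2) - 1 : ℝ) : ℝ) : ℂ)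
            * ∑ i, H.c i z * dZ (H.e i) h (l ^ (-(1 / 2) : ℝ) • z, l) := by
      rw [hs, dT_apply, ← Complex.real_smul, ← map_smul, ← map_add]
      congr 1; simp
    rw [e1]
    have p1 : l ^ (-(1 / 2) - 1 : ℝ) = l ^ (-1 : ℝ) * l ^ (-(1 / 2) : ℝ) := by
      rw [← Real.rpow_add hl]; norm_num
    have p2 : l ^ (-(H.m / 2) - 1) = l ^ (-1 : ℝ) * l ^ (-(H.m / 2)) := by
      rw [← Real.rpow_add hl]; congr 1; ring
    rw [p1, p2]
    set S := ∑ i, H.c i z * dZ (H.e i) h (l ^ (-(1 / 2) : ℝ) • z, l) with hS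
    have p3 : ∀ a : ℂ, ∑ i, (H.c i z : ℂ) * (a * dZ (H.e i) h (l ^ (-(1 / 2) : ℝ) • z, l)) = a * S := by
      intro a; rw [hS, Finset.mul_sum]; exact Finset.sum_congr rfl fun i _ => by ring
    rw [p3]
    simp only [Pi.mul_apply]
    push_cast
    ring

end HFrame
end Heis

namespace Heis
open SchwartzMap
open scoped LineDeriv ContDiff FourierTransform ComplexConjugate

variable {E : Type} [NormedAddCommGroup E] [NormedSpace ℝ E]
variable {ι : Type} [Fintype ι] [DecidableEq ι]

lemma Cutoff.mul {r : ℝ} {κ κ' : ℝ → ℝ} (h : Cutoff r κ) (h' : Cutoff r κ') :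
    Cutoff r fun l => κ l * κ' l where
  smooth := h.smooth.mul h'.smooth
  supp l hl := by simp [h.supp l hl]

lemma Cutoff.growth_snd {r : ℝ} {κ : ℝ → ℝ} (h : Cutoff r κ) :
    Function.HasTemperateGrowth fun p : E × ℝ => ((κ p.2 : ℝ) : ℂ) :=
  Function.Complex.hasTemperateGrowth_ofReal.comp
    (h.hasTemperateGrowth.comp (hasTemperateGrowth_clm (ContinuousLinearMap.snd ℝ E ℝ)))

namespace HFrame
variable (H : HFrame E ι)

include H in
lemma finrank_eq : Module.finrank ℝ E = Fintype.card ι := by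
  have e : E ≃ₗ[ℝ] (ι → ℝ) :=
    { toFun := fun z i => H.c i z
      map_add' := fun x y => by ext i; simp
      map_smul' := fun a x => by ext i; simp
      invFun := fun v => ∑ i, v i • H.e i
      left_inv := fun z => H.sum_ce z
      right_inv := fun v => by ext i; simp [H.c_e] }
  rw [e.finrank_eq, Module.finrank_fintype_fun_eq_card]

variable [FiniteDimensional ℝ E] [MeasureSpace E] [BorelSpace E]
  [(volume : Measure E).IsAddHaarMeasure]
variable {r : ℝ} (hr : 0 < r) {κ κ' : ℝ → ℝ}

lemma integral_loc_mul_conj (hκ : Cutoff r κ) (hκ' : Cutoff r κ') (f g : 𝓢(E × ℝ, ℂ)) :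
    ∫ p, H.loc hr κ f p * conj (H.loc hr κ' g p)
      = ∫ p, ((κ p.2 * κ' p.2 : ℝ) : ℂ) * (f p * conj (g p)) := by
  have hg := (hκ.mul hκ').growth_snd (E := E)
  have e1 := integral_prod_S_symm (mulS (H.loc hr κ f) (cj (H.loc hr κ' g)))
  have e2 := integral_prod_S_symm
    (mulS (smulLeftCLM ℂ (fun p : E × ℝ => ((κ p.2 * κ' p.2 : ℝ) : ℂ)) f) (cj g))
  simp only [mulS_apply, cj_apply, smulLeftCLM_apply_apply hg, smul_eq_mul, mul_assoc] at e1 e2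
  rw [e1, e2]
  refine integral_congr_ae (.of_forall fun l => ?_)
  simp only [loc_apply H hr hκ, loc_apply H hr hκ']
  by_cases h0 : κ l = 0
  · simp [h0]
  have hl := hκ.pos_of_ne hr h0
  have k := Measure.integral_comp_smul (volume : Measure E)
    (fun z => ((κ l * κ' l : ℝ) : ℂ) * (f (z, l) * conj (g (z, l)))) (l ^ (-(1 / 2) : ℝ))
  have a1 : l ^ (-(H.m / 2)) * l ^ (-(H.m / 2))
      * |((l ^ (-(1 / 2) : ℝ)) ^ Module.finrank ℝ E)⁻¹| = 1 := by
    rw [abs_of_pos (by positivity), H.finrank_eq, ← Real.rpow_natCast, ← Real.rpow_mul hl.le,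
      ← Real.rpow_neg hl.le, ← Real.rpow_add hl, ← Real.rpow_add hl]
    have : -(H.m / 2) + -(H.m / 2) + -(-(1 / 2) * (Fintype.card ι : ℝ)) = 0 := by
      unfold m; ring
    rw [this, Real.rpow_zero]
  have a2 : ((l ^ (-(H.m / 2)) * l ^ (-(H.m / 2)) : ℝ) : ℂ)
      * ((|((l ^ (-(1 / 2) : ℝ)) ^ Module.finrank ℝ E)⁻¹| : ℝ) : ℂ) = 1 := by
    exact_mod_cast a1
  rw [Complex.real_smul] at k
  have a3 : ∀ z : E, ((κ l * l ^ (-(H.m / 2)) : ℝ) : ℂ) * (f (l ^ (-(1 / 2) : ℝ) • z, l)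
      * conj (((κ' l * l ^ (-(H.m / 2)) : ℝ) : ℂ) * g (l ^ (-(1 / 2) : ℝ) • z, l)))
      = ((l ^ (-(H.m / 2)) * l ^ (-(H.m / 2)) : ℝ) : ℂ) * (((κ l * κ' l : ℝ) : ℂ)
        * (f (l ^ (-(1 / 2) : ℝ) • z, l) * conj (g (l ^ (-(1 / 2) : ℝ) • z, l)))) := by
    intro z
    simp only [map_mul, Complex.conj_ofReal, Complex.ofReal_mul]
    ring
  simp only [mul_assoc, a3]
  rw [integral_const_mul]
  erw [k]
  rw [← mul_assoc, a2, one_mul]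

lemma lV_loc (hκ : Cutoff r κ) (h : 𝓢(E × ℝ, ℂ)) :
    lV (H.loc hr κ h) = ∫ p, κ p.2 ^ 2 * ‖h p‖ ^ 2 := by
  have := H.integral_loc_mul_conj hr hκ hκ h h
  simp only [Complex.mul_conj, Complex.normSq_eq_norm_sq] at this
  simp only [← Complex.ofReal_mul] at this
  rw [integral_complex_ofReal, integral_complex_ofReal] at this
  have := Complex.ofReal_injective this
  simpa only [lV, sq] using this

lemma integrable_mul_normSq {k : ℝ → ℝ} {B : ℝ} (hk : Continuous k) (hB : ∀ l, |k l| ≤ B)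
    (h : 𝓢(E × ℝ, ℂ)) : Integrable fun p => k p.2 * ‖h p‖ ^ 2 :=
  (integrable_normSq h).bdd_mul (c := B) (hk.comp continuous_snd).aestronglyMeasurable
    (.of_forall fun p => hB p.2)

lemma integral_mul_N {k : ℝ → ℝ} {B : ℝ} (hk : Continuous k) (hB : ∀ l, |k l| ≤ B)
    (h : 𝓢(E × ℝ, ℂ)) :
    ∑ i, ∫ p, k p.2 * ‖H.cV i h p‖ ^ 2 = ∫ p, k p.2 * (H.N p.1 * ‖h p‖ ^ 2) := by
  rw [← integral_finsetSum _ fun i _ => integrable_mul_normSq hk hB _]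
  refine integral_congr_ae (.of_forall fun p => ?_)
  simp [N, mul_pow, Finset.sum_mul, Finset.mul_sum]

lemma wV_loc_le (hκ : Cutoff r κ) {k : ℝ → ℝ} {B a b δ : ℝ} (hk : Continuous k)
    (hB : ∀ l, |k l| ≤ B) (ha : ∀ l, 0 < l → κ l ^ 2 * δ ≤ a * k l)
    (hb : ∀ l, 0 < l → κ l ^ 2 * l ≤ b * k l) (hk0 : ∀ l ≤ 0, k l = 0) (h : 𝓢(E × ℝ, ℂ)) :
    H.wV δ (H.loc hr κ h) ≤ a * (∫ p, k p.2 * ‖h p‖ ^ 2)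
      + b * ∫ p, k p.2 * (H.N p.1 * ‖h p‖ ^ 2) := by
  have hpos : ∀ l, κ l ≠ 0 → 0 < l := fun l => hκ.pos_of_ne hr
  have ha' : ∀ l, κ l ^ 2 * δ ≤ a * k l := fun l => by
    rcases le_or_gt l 0 with hl | hl
    · have : κ l = 0 := by by_contra h0; linarith [hpos l h0]
      simp [this, hk0 l hl]
    · exact ha l hl
  have hκ1 := hκ.mul_rpow hr (1 / 2)
  have hb' : ∀ l, (κ l * l ^ (1 / 2 : ℝ)) ^ 2 ≤ b * k l := fun l => by
    rcases le_or_gt l 0 with hl | hl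
    · have : κ l = 0 := by by_contra h0; linarith [hpos l h0]
      simp [this, hk0 l hl]
    · rw [mul_pow, ← Real.rpow_natCast (l ^ (1 / 2 : ℝ)), ← Real.rpow_mul hl.le]
      norm_num
      exact hb l hl
  have i2 : ∀ (k : 𝓢(E × ℝ, ℂ)) {κ : ℝ → ℝ}, Cutoff r κ →
      Integrable fun p => κ p.2 ^ 2 * ‖k p‖ ^ 2 := fun k κ hκ => by
    have := (integrable_normSq (smulLeftCLM ℂ (fun p : E × ℝ => ((κ p.2 : ℝ) : ℂ)) k))
    simpa [smulLeftCLM_apply_apply hκ.growth_snd, mul_pow] using this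
  unfold wV
  refine add_le_add ?_ ?_
  · rw [lV_loc H hr hκ, ← integral_const_mul, ← integral_const_mul]
    refine integral_mono ((i2 h hκ).const_mul _) ((integrable_mul_normSq hk hB h).const_mul _)
      fun p => ?_
    have := mul_le_mul_of_nonneg_right (ha' p.2) (sq_nonneg ‖h p‖)
    show δ * (κ p.2 ^ 2 * ‖h p‖ ^ 2) ≤ a * (k p.2 * ‖h p‖ ^ 2)
    linarith
  · rw [← H.integral_mul_N hk hB, Finset.mul_sum]
    refine Finset.sum_le_sum fun i _ => ?_
    rw [cV_loc H hr hκ, lV_loc H hr hκ1, ← integral_const_mul]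
    refine integral_mono (i2 _ hκ1) ((integrable_mul_normSq hk hB _).const_mul _) fun p => ?_
    have := mul_le_mul_of_nonneg_right (hb' p.2) (sq_nonneg ‖H.cV i h p‖)
    show (κ p.2 * p.2 ^ (1 / 2 : ℝ)) ^ 2 * ‖H.cV i h p‖ ^ 2 ≤ b * (k p.2 * ‖H.cV i h p‖ ^ 2)
    linarith

end HFrame
end Heis

namespace Heis
open SchwartzMap
open scoped LineDeriv ContDiff FourierTransform ComplexConjugate

/-- A fixed smooth bump supported in `[1/4, 7/4]`. -/
def chi (s : ℝ) : ℝ := expNegInvGlue (1 - (4 / 3 * (s - 1)) ^ 2)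

lemma chi_cutoff : Cutoff 1 chi where
  smooth := (expNegInvGlue.contDiff (n := ⊤)).comp (by fun_prop)
  supp s hs := by
    refine expNegInvGlue.zero_of_nonpos ?_
    rw [Set.mem_Icc, not_and_or, not_le, not_le] at hs
    rcases hs with h | h <;> nlinarith

lemma chi_nonneg (s : ℝ) : 0 ≤ chi s := expNegInvGlue.nonneg _

lemma deriv_chi_sq_le (s : ℝ) : deriv chi s ^ 2 ≤ 15 / 4 * (s - 1) ^ 2 := by
  rcases le_or_gt (1 - (4 / 3 * (s - 1)) ^ 2) 0 with h | h
  · have hmin : IsLocalMin chi s := .of_forall fun y => by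
      rw [chi, expNegInvGlue.zero_of_nonpos h]; exact chi_nonneg y
    rw [hmin.deriv_eq_zero, zero_pow two_ne_zero]; positivity
  · set u := 1 - (4 / 3 * (s - 1)) ^ 2 with hu
    have e : chi =ᶠ[nhds s] fun s => Real.exp (-(1 - (4 / 3 * (s - 1)) ^ 2)⁻¹) := by
      have : ∀ᶠ s in nhds s, 0 < 1 - (4 / 3 * (s - 1)) ^ 2 :=
        (by fun_prop : Continuous fun s : ℝ => 1 - (4 / 3 * (s - 1)) ^ 2).continuousAt.eventually
          (lt_mem_nhds h)
      filter_upwards [this] with y hy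
      simp only [chi, expNegInvGlue, not_le.mpr hy, if_false]
    have h1 : HasDerivAt (fun s : ℝ => 1 - (4 / 3 * (s - 1)) ^ 2) (-(2 * (4 / 3 * (s - 1)) * (4 / 3))) s := by
      refine HasDerivAt.congr_deriv
        (((((hasDerivAt_id s).sub_const 1).const_mul (4 / 3)).pow 2).const_sub 1) ?_
      simp
    have h2 : HasDerivAt (fun s : ℝ => Real.exp (-(1 - (4 / 3 * (s - 1)) ^ 2)⁻¹))
        (Real.exp (-(1 - (4 / 3 * (s - 1)) ^ 2)⁻¹)
          * -(-(-(2 * (4 / 3 * (s - 1)) * (4 / 3))) / (1 - (4 / 3 * (s - 1)) ^ 2) ^ 2)) s :=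
      ((h1.inv h.ne').neg).exp
    have h3 : deriv chi s = Real.exp (-u⁻¹) * (u⁻¹ ^ 2 * -(2 * (4 / 3 * (s - 1)) * (4 / 3))) := by
      rw [e.deriv_eq]
      refine (HasDerivAt.deriv h2).trans ?_
      rw [← hu, inv_pow, neg_neg, mul_comm (2 * _), ← neg_div, div_eq_mul_inv]; ring
    set y := u⁻¹ with hy
    have hy0 : 0 < y := inv_pos.mpr h
    have k1 : y / 2 * Real.exp (-(y / 2)) ≤ Real.exp (-1) := by
      have := Real.add_one_le_exp (y / 2 - 1)
      calc y / 2 * Real.exp (-(y / 2)) ≤ Real.exp (y / 2 - 1) * Real.exp (-(y / 2)) := by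
            gcongr; linarith
        _ = _ := by rw [← Real.exp_add]; congr 1; ring
    have k2 : (y / 2 * Real.exp (-(y / 2))) ^ 4 ≤ Real.exp (-1) ^ 4 :=
      pow_le_pow_left₀ (by positivity) k1 4
    have k3 : Real.exp (-(y / 2)) ^ 4 = Real.exp (-y) ^ 2 := by
      rw [← Real.exp_nat_mul, ← Real.exp_nat_mul]; congr 1; push_cast; ring
    have k4 : Real.exp (-1) ^ 4 ≤ 1 / 54 := by
      have : Real.exp (-1) < 0.3678794412 := Real.exp_neg_one_lt_d9
      calc Real.exp (-1) ^ 4 ≤ 0.3678794412 ^ 4 := by gcongr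
        _ ≤ _ := by norm_num
    have k5 : y ^ 4 * Real.exp (-y) ^ 2 ≤ 16 / 54 := by
      rw [mul_pow, div_pow, k3] at k2; linarith
    rw [h3]
    have : (Real.exp (-y) * (y ^ 2 * -(2 * (4 / 3 * (s - 1)) * (4 / 3)))) ^ 2
        = (y ^ 4 * Real.exp (-y) ^ 2) * (1024 / 81 * (s - 1) ^ 2) := by ring
    rw [this]
    nlinarith [sq_nonneg (s - 1)]

lemma chi_sq_ge {s : ℝ} (h1 : 5 / 8 ≤ s) (h2 : s ≤ 11 / 8) : 1 / 15 ≤ chi s ^ 2 := by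
  have hu : 3 / 4 ≤ 1 - (4 / 3 * (s - 1)) ^ 2 := by nlinarith
  simp only [chi, expNegInvGlue, not_le.mpr (show 0 < 1 - (4 / 3 * (s - 1)) ^ 2 by linarith), if_false]
  have h3 : (1 - (4 / 3 * (s - 1)) ^ 2)⁻¹ ≤ 4 / 3 := by
    rw [inv_le_comm₀ (by linarith) (by norm_num)]; linarith
  calc (1 / 15 : ℝ) ≤ Real.exp (-(4 / 3)) ^ 2 := by
        rw [← Real.exp_nat_mul]
        have : Real.exp (8 / 3) ≤ 15 := by
          have h := Real.exp_one_lt_d9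
          have h5 : Real.exp (8 / 3) ^ 3 = Real.exp 1 ^ 8 := by
            rw [← Real.exp_nat_mul, ← Real.exp_nat_mul]; congr 1; norm_num
          refine le_of_pow_le_pow_left₀ (n := 3) (by norm_num) (by norm_num) ?_
          rw [h5]
          calc Real.exp 1 ^ 8 ≤ 2.7182818286 ^ 8 := by gcongr
            _ ≤ _ := by norm_num
        rw [show ((2 : ℕ) : ℝ) * -(4 / 3) = -(8 / 3) by norm_num, Real.exp_neg, one_div]
        gcongr
    _ ≤ _ := by gcongr

/-- The weight `χ²`. -/
def k₁ (s : ℝ) : ℝ := chi s ^ 2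

/-- The weight `s χ'(s)²`. -/
def k₂ (s : ℝ) : ℝ := s * deriv chi s ^ 2

lemma continuous_k₁ : Continuous k₁ := chi_cutoff.smooth.continuous.pow 2

lemma continuous_k₂ : Continuous k₂ := continuous_id.mul (chi_cutoff.deriv.smooth.continuous.pow 2)

lemma k₁_supp {s : ℝ} (hs : s ∉ Set.Icc (1 / 4 : ℝ) (7 / 4)) : k₁ s = 0 := by
  simp [k₁, chi_cutoff.supp s (by simpa using hs)]

lemma k₂_supp {s : ℝ} (hs : s ∉ Set.Icc (1 / 4 : ℝ) (7 / 4)) : k₂ s = 0 := by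
  simp [k₂, chi_cutoff.deriv.supp s (by simpa using hs)]

lemma k₁_nonneg (s : ℝ) : 0 ≤ k₁ s := sq_nonneg _

section average
variable {k : ℝ → ℝ}

lemma integrable_comp_exp (hk : Continuous k)
    (hs : ∀ s, s ∉ Set.Icc (1 / 4 : ℝ) (7 / 4) → k s = 0) : Integrable fun v => k (Real.exp v) := by
  refine (hk.comp Real.continuous_exp).integrable_of_hasCompactSupport
    (HasCompactSupport.intro (isCompact_Icc (a := Real.log (1 / 4)) (b := Real.log (7 / 4)))
      fun v hv => hs _ fun h => hv ?_)
  exact ⟨(Real.log_le_iff_le_exp (by norm_num)).2 h.1, (Real.le_log_iff_exp_le (by norm_num)).2 h.2⟩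

lemma integral_dilate (hs : ∀ s, s ∉ Set.Icc (1 / 4 : ℝ) (7 / 4) → k s = 0) (l : ℝ) :
    ∫ η, k (l / Real.exp η) = if 0 < l then ∫ v, k (Real.exp v) else 0 := by
  split_ifs with hl
  · rw [← integral_sub_left_eq_self (fun v => k (Real.exp v)) volume (Real.log l)]
    simp only [Real.exp_sub, Real.exp_log hl]
  · have : ∀ η, k (l / Real.exp η) = 0 := fun η => hs _ fun h => by
      have : l / Real.exp η ≤ 0 := div_nonpos_of_nonpos_of_nonneg (not_lt.mp hl) (Real.exp_pos _).le
      linarith [h.1]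
    simp [this]

lemma integrable_dilate (hk : Continuous k)
    (hs : ∀ s, s ∉ Set.Icc (1 / 4 : ℝ) (7 / 4) → k s = 0) (l : ℝ) :
    Integrable fun η => k (l / Real.exp η) := by
  rcases lt_or_ge 0 l with hl | hl
  · have := (integrable_comp_exp hk hs).comp_sub_left (Real.log l)
    simpa only [Real.exp_sub, Real.exp_log hl] using this
  · have : ∀ η, k (l / Real.exp η) = 0 := fun η => hs _ fun h => by
      have : l / Real.exp η ≤ 0 := div_nonpos_of_nonpos_of_nonneg hl (Real.exp_pos _).le
      linarith [h.1]
    simp [this]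

variable {E : Type} [NormedAddCommGroup E] [NormedSpace ℝ E]
  [FiniteDimensional ℝ E] [MeasureSpace E] [BorelSpace E]
  [(volume : Measure E).IsAddHaarMeasure]
variable {G : Type} [NormedAddCommGroup G] [NormedSpace ℝ G] {Q : E × ℝ → G}

lemma integrable_dilate_prod (hk : Continuous k)
    (hs : ∀ s, s ∉ Set.Icc (1 / 4 : ℝ) (7 / 4) → k s = 0) (hQc : Continuous Q) (hQ : Integrable Q) :
    Integrable (fun q : ℝ × (E × ℝ) => k (q.2.2 / Real.exp q.1) • Q q.2)
      ((volume : Measure ℝ).prod volume) := by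
  have hc : Continuous fun q : ℝ × (E × ℝ) => k (q.2.2 / Real.exp q.1) • Q q.2 := by
    refine Continuous.smul (hk.comp ?_) (hQc.comp continuous_snd)
    exact (continuous_snd.comp continuous_snd).div (Real.continuous_exp.comp continuous_fst)
      fun q => (Real.exp_pos _).ne'
  rw [integrable_prod_iff' hc.aestronglyMeasurable]
  refine ⟨.of_forall fun p => (integrable_dilate hk hs p.2).smul_const (Q p), ?_⟩
  have hs' : ∀ s, s ∉ Set.Icc (1 / 4 : ℝ) (7 / 4) → |k s| = 0 := fun s h => by simp [hs s h]
  simp only [norm_smul, Real.norm_eq_abs, integral_mul_const, integral_dilate hs']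
  have : (fun p : E × ℝ => (if 0 < p.2 then ∫ v, |k (Real.exp v)| else 0) * ‖Q p‖)
      = fun p => (∫ v, |k (Real.exp v)|) * (Set.indicator {p : E × ℝ | 0 < p.2} (fun p => ‖Q p‖) p) := by
    ext p
    by_cases h : 0 < p.2 <;> simp [h]
  rw [this]
  exact (hQ.norm.indicator (measurableSet_lt measurable_const measurable_snd)).const_mul _

lemma integrable_dilate_average (hk : Continuous k)
    (hs : ∀ s, s ∉ Set.Icc (1 / 4 : ℝ) (7 / 4) → k s = 0) (hQc : Continuous Q) (hQ : Integrable Q) :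
    Integrable fun η : ℝ => ∫ p : E × ℝ, k (p.2 / Real.exp η) • Q p :=
  (integrable_dilate_prod hk hs hQc hQ).integral_prod_left

lemma integral_dilate_average [CompleteSpace G] (hk : Continuous k)
    (hs : ∀ s, s ∉ Set.Icc (1 / 4 : ℝ) (7 / 4) → k s = 0) (hQc : Continuous Q) (hQ : Integrable Q) :
    ∫ η : ℝ, ∫ p : E × ℝ, k (p.2 / Real.exp η) • Q p
      = (∫ v, k (Real.exp v)) • ∫ p in {p : E × ℝ | 0 < p.2}, Q p := by
  rw [integral_integral_swap (integrable_dilate_prod hk hs hQc hQ)]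
  simp only [integral_smul_const, integral_dilate hs]
  rw [← integral_indicator (measurableSet_lt measurable_const measurable_snd), ← integral_smul]
  refine integral_congr_ae (.of_forall fun p => ?_)
  by_cases h : 0 < p.2 <;> simp [h]

end average

lemma one_div_twenty_le : 1 / 20 ≤ ∫ v, k₁ (Real.exp v) := by
  have hlog : 3 / 4 ≤ Real.log (11 / 8) - Real.log (5 / 8) := by
    rw [← Real.log_div (by norm_num) (by norm_num), Real.le_log_iff_exp_le (by norm_num)]
    refine le_of_pow_le_pow_left₀ (n := 4) (by norm_num) (by norm_num) ?_
    have h5 : Real.exp (3 / 4) ^ 4 = Real.exp 1 ^ 3 := by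
      rw [← Real.exp_nat_mul, ← Real.exp_nat_mul]; congr 1; norm_num
    rw [h5]
    calc Real.exp 1 ^ 3 ≤ 2.7182818286 ^ 3 := by gcongr; exact Real.exp_one_lt_d9.le
      _ ≤ _ := by norm_num
  have hi := integrable_comp_exp continuous_k₁ fun _ => k₁_supp
  calc (1 / 20 : ℝ) ≤ (Real.log (11 / 8) - Real.log (5 / 8)) * (1 / 15) := by linarith
    _ = ∫ v in Set.Icc (Real.log (5 / 8)) (Real.log (11 / 8)), (1 / 15 : ℝ) := by
        rw [setIntegral_const, smul_eq_mul, Real.volume_real_Icc_of_le (by linarith)]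
    _ ≤ ∫ v in Set.Icc (Real.log (5 / 8)) (Real.log (11 / 8)), k₁ (Real.exp v) := by
        refine setIntegral_mono_on (by simp) hi.integrableOn measurableSet_Icc fun v hv => ?_
        exact chi_sq_ge ((Real.log_le_iff_le_exp (by norm_num)).1 hv.1)
          ((Real.le_log_iff_exp_le (by norm_num)).1 hv.2)
    _ ≤ _ := setIntegral_le_integral hi (.of_forall fun v => k₁_nonneg _)

lemma integral_k₂_le : ∫ v, k₂ (Real.exp v) ≤ 5 / 4 := by
  have hab : Real.log (1 / 4) ≤ Real.log (7 / 4) := Real.log_le_log (by norm_num) (by norm_num)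
  have hi := integrable_comp_exp continuous_k₂ fun _ => k₂_supp
  have hc : Continuous fun v : ℝ => 15 / 4 * ((Real.exp v - 1) ^ 2 * Real.exp v) := by fun_prop
  calc ∫ v, k₂ (Real.exp v)
      = ∫ v in Set.Icc (Real.log (1 / 4)) (Real.log (7 / 4)), k₂ (Real.exp v) := by
        symm
        refine setIntegral_eq_integral_of_forall_compl_eq_zero fun v hv => k₂_supp fun h => hv ?_
        exact ⟨(Real.log_le_iff_le_exp (by norm_num)).2 h.1,
          (Real.le_log_iff_exp_le (by norm_num)).2 h.2⟩
    _ ≤ ∫ v in Set.Icc (Real.log (1 / 4)) (Real.log (7 / 4)),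
          15 / 4 * ((Real.exp v - 1) ^ 2 * Real.exp v) := by
        refine setIntegral_mono_on hi.integrableOn hc.integrableOn_Icc measurableSet_Icc
          fun v _ => ?_
        have := mul_le_mul_of_nonneg_left (deriv_chi_sq_le (Real.exp v)) (Real.exp_pos v).le
        unfold k₂; linarith
    _ = 5 / 4 * (Real.exp (Real.log (7 / 4)) - 1) ^ 3
          - 5 / 4 * (Real.exp (Real.log (1 / 4)) - 1) ^ 3 := by
        rw [integral_Icc_eq_integral_Ioc, ← intervalIntegral.integral_of_le hab]
        refine intervalIntegral.integral_eq_sub_of_hasDerivAt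
          (f := fun v => 5 / 4 * (Real.exp v - 1) ^ 3) (fun v _ => ?_) (hc.intervalIntegrable _ _)
        refine HasDerivAt.congr_deriv
          ((((Real.hasDerivAt_exp v).sub_const 1).pow 3).const_mul (5 / 4)) ?_
        simp only [Nat.cast_ofNat, Nat.add_one_sub_one]; ring
    _ ≤ 5 / 4 := by
        rw [Real.exp_log (by norm_num), Real.exp_log (by norm_num)]; norm_num

end Heis

namespace Heis
open SchwartzMap
open scoped LineDeriv ContDiff FourierTransform ComplexConjugate

/-- The cutoff `χ` dilated to frequency `r`. -/
def chiR (r l : ℝ) : ℝ := chi (l / r)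

lemma chiR_cutoff {r : ℝ} (hr : 0 < r) : Cutoff r (chiR r) where
  smooth := chi_cutoff.smooth.comp (contDiff_id.div_const r)
  supp l hl := chi_cutoff.supp _ fun h => hl ⟨by have := (le_div_iff₀ hr).1 h.1; linarith,
    by have := (div_le_iff₀ hr).1 h.2; linarith⟩

lemma deriv_chiR (r l : ℝ) : deriv (chiR r) l = deriv chi (l / r) / r := by
  have h : HasDerivAt (fun l : ℝ => l / r) (1 / r) l := (hasDerivAt_id l).div_const r
  have h2 : HasDerivAt (fun l => chi (l / r)) (deriv chi (l / r) * (1 / r)) l :=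
    HasDerivAt.comp (h₂ := chi) (h := fun l => l / r) l
      (chi_cutoff.smooth.differentiable (by simp) (l / r)).hasDerivAt h
  exact h2.deriv.trans (by ring)

lemma exists_k_bound {k : ℝ → ℝ} (hk : Continuous k)
    (hs : ∀ s, s ∉ Set.Icc (1 / 4 : ℝ) (7 / 4) → k s = 0) : ∃ B, ∀ l, |k l| ≤ B := by
  obtain ⟨B, hB⟩ := (HasCompactSupport.intro isCompact_Icc hs).exists_bound_of_continuous hk
  exact ⟨B, hB⟩

variable {E : Type} [NormedAddCommGroup E] [NormedSpace ℝ E]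
variable {ι : Type} [Fintype ι] [DecidableEq ι]

namespace HFrame
variable (H : HFrame E ι)
variable [FiniteDimensional ℝ E] [MeasureSpace E] [BorelSpace E]
  [(volume : Measure E).IsAddHaarMeasure]
variable {r : ℝ} (hr : 0 < r)

/-- The localised mass `∫ k(l / r) ‖h‖²`. -/
def massK (k : ℝ → ℝ) (r : ℝ) (h : 𝓢(E × ℝ, ℂ)) : ℝ := ∫ p, k (p.2 / r) * ‖h p‖ ^ 2

/-- The localised second moment `∫ k(l / r) |z|² ‖h‖²`. -/
def momentK (k : ℝ → ℝ) (r : ℝ) (h : 𝓢(E × ℝ, ℂ)) : ℝ :=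
  ∫ p, k (p.2 / r) * (H.N p.1 * ‖h p‖ ^ 2)

lemma massK_nonneg {k : ℝ → ℝ} (hk : ∀ s, 0 ≤ k s) (r : ℝ) (h : 𝓢(E × ℝ, ℂ)) :
    0 ≤ massK k r h := integral_nonneg fun _ => mul_nonneg (hk _) (sq_nonneg _)

include hr in
lemma wV_loc_chi_le (h : 𝓢(E × ℝ, ℂ)) : H.wV (1 / 4 * r) (H.loc hr (chiR r) h)
    ≤ 1 / 4 * r * massK k₁ r h + 7 / 4 * r * H.momentK k₁ r h := by
  obtain ⟨B, hB⟩ := exists_k_bound continuous_k₁ fun _ => k₁_supp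
  refine H.wV_loc_le hr (chiR_cutoff hr) (k := fun l => k₁ (l / r))
    (continuous_k₁.comp (continuous_id.div_const r)) (fun l => hB _) (fun l _ => ?_)
    (fun l hl => ?_) (fun l hl => k₁_supp fun h => ?_) h
  · simp only [chiR, k₁]; linarith
  · by_cases hm : l ∈ Set.Icc (r / 4) (7 * r / 4)
    · have : l ≤ 7 / 4 * r := by linarith [hm.2]
      simp only [k₁]
      rw [mul_comm]
      exact mul_le_mul_of_nonneg_right this (sq_nonneg _)
    · have := (chiR_cutoff hr).supp l hm
      rw [this, zero_pow two_ne_zero, zero_mul]; simp only [k₁]; positivity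
  · have : l / r ≤ 0 := div_nonpos_of_nonpos_of_nonneg hl hr.le
    linarith [h.1]

include hr in
lemma wV_loc_deriv_chi_le (h : 𝓢(E × ℝ, ℂ)) : H.wV (1 / 4 * r) (H.loc hr (deriv (chiR r)) h)
    ≤ 1 / r * massK k₂ r h + 1 / r * H.momentK k₂ r h := by
  obtain ⟨B, hB⟩ := exists_k_bound continuous_k₂ fun _ => k₂_supp
  refine H.wV_loc_le hr (chiR_cutoff hr).deriv (k := fun l => k₂ (l / r))
    (continuous_k₂.comp (continuous_id.div_const r)) (fun l => hB _) (fun l hl => ?_)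
    (fun l hl => ?_) (fun l hl => k₂_supp fun h => ?_) h
  · by_cases hm : l ∈ Set.Icc (r / 4) (7 * r / 4)
    · have h1 : 1 / 4 ≤ l / r := by rw [le_div_iff₀ hr]; linarith [hm.1]
      rw [deriv_chiR]
      have : (deriv chi (l / r) / r) ^ 2 * (1 / 4 * r) = 1 / r * (1 / 4 * deriv chi (l / r) ^ 2) := by
        field_simp
      rw [this]
      simp only [k₂]
      gcongr
    · rw [(chiR_cutoff hr).deriv.supp l hm, zero_pow two_ne_zero, zero_mul]
      simp only [k₂]; positivity
  · rw [deriv_chiR]; simp only [k₂]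
    refine le_of_eq ?_
    field_simp
  · have : l / r ≤ 0 := div_nonpos_of_nonpos_of_nonneg hl hr.le
    linarith [h.1]

include hr in
lemma wV_loc_div_chi_le (h : 𝓢(E × ℝ, ℂ)) :
    H.wV (1 / 4 * r) (H.loc hr (fun l => -(1 / 2) * (chiR r l * l ^ (-1 : ℝ))) h)
    ≤ 1 / r * massK k₁ r h + 1 / r * H.momentK k₁ r h := by
  obtain ⟨B, hB⟩ := exists_k_bound continuous_k₁ fun _ => k₁_supp
  have hc := ((chiR_cutoff hr).mul_rpow hr (-1)).const_mul (-(1 / 2))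
  refine H.wV_loc_le hr hc (k := fun l => k₁ (l / r))
    (continuous_k₁.comp (continuous_id.div_const r)) (fun l => hB _) (fun l hl => ?_)
    (fun l hl => ?_) (fun l hl => k₁_supp fun h => ?_) h
  · by_cases hm : l ∈ Set.Icc (r / 4) (7 * r / 4)
    · have h1 : r / 4 ≤ l := hm.1
      have e : (-(1 / 2) * (chiR r l * l ^ (-1 : ℝ))) ^ 2 * (1 / 4 * r)
          = (r / (16 * l ^ 2)) * chi (l / r) ^ 2 := by
        rw [Real.rpow_neg_one, chiR]; field_simp; ring
      rw [e]; simp only [k₁]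
      gcongr ?_ * _
      rw [div_le_div_iff₀ (by positivity) hr]; nlinarith
    · have := hc.supp l hm
      rw [this, zero_pow two_ne_zero, zero_mul]; simp only [k₁]; positivity
  · by_cases hm : l ∈ Set.Icc (r / 4) (7 * r / 4)
    · have h1 : r / 4 ≤ l := hm.1
      have e : (-(1 / 2) * (chiR r l * l ^ (-1 : ℝ))) ^ 2 * l = (1 / (4 * l)) * chi (l / r) ^ 2 := by
        rw [Real.rpow_neg_one, chiR]; field_simp; ring
      rw [e]; simp only [k₁]
      gcongr ?_ * _
      exact one_div_le_one_div_of_le hr (by linarith)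
    · have := hc.supp l hm
      rw [this, zero_pow two_ne_zero, zero_mul]; simp only [k₁]; positivity
  · have : l / r ≤ 0 := div_nonpos_of_nonpos_of_nonneg hl hr.le
    linarith [h.1]

lemma lV_loc_chi (h : 𝓢(E × ℝ, ℂ)) : lV (H.loc hr (chiR r) h) = massK k₁ r h :=
  H.lV_loc hr (chiR_cutoff hr) h

/-- The bound for the source quantity at frequency `r`. -/
def srcK (r : ℝ) (h : 𝓢(E × ℝ, ℂ)) : ℝ :=
  11 / 10 * (1 / 4 * massK k₁ r h + 7 / 4 * H.momentK k₁ r h) + 11 / 10 / (8 * Real.pi) * massK k₁ r h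
    + 3 / (4 * Real.pi ^ 2 * (11 / 10)) * (massK k₂ r h + H.momentK k₂ r h
      + massK k₁ r (dT h) / (8 * Real.pi) + 9 * (massK k₁ r h + H.momentK k₁ r h))

lemma Nu_loc_le (h : 𝓢(E × ℝ, ℂ)) :
    H.Nu (1 / 4 * r) (11 / 10 / r) (11 / 10) (H.loc hr (chiR r) h) (H.loc hr (deriv (chiR r)) h)
      (H.loc hr (chiR r) (dT h)) (H.loc hr (fun l => -(1 / 2) * (chiR r l * l ^ (-1 : ℝ))) h)
      ≤ H.srcK r h := by
  have a1 := H.wV_loc_chi_le hr h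
  have a2 := H.wV_loc_deriv_chi_le hr h
  have a3 := H.wV_loc_div_chi_le hr h
  unfold Nu srcK
  rw [lV_loc_chi, lV_loc_chi]
  have n1 := massK_nonneg k₁_nonneg r (dT h)
  have n2 : 0 ≤ H.wV (1 / 4 * r) (H.loc hr (deriv (chiR r)) h) := H.wV_nonneg (by positivity) _
  have n3 : 0 ≤ H.wV (1 / 4 * r) (H.loc hr (fun l => -(1 / 2) * (chiR r l * l ^ (-1 : ℝ))) h) :=
    H.wV_nonneg (by positivity) _
  set A := massK k₁ r h
  set B := H.momentK k₁ r h
  set A2 := massK k₂ r h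
  set B2 := H.momentK k₂ r h
  set D := massK k₁ r (dT h)
  set W1 := H.wV (1 / 4 * r) (H.loc hr (chiR r) h)
  set W2 := H.wV (1 / 4 * r) (H.loc hr (deriv (chiR r)) h)
  set W3 := H.wV (1 / 4 * r) (H.loc hr (fun l => -(1 / 2) * (chiR r l * l ^ (-1 : ℝ))) h)
  have b2 : r * W2 ≤ A2 + B2 := by
    calc r * W2 ≤ r * (1 / r * A2 + 1 / r * B2) := by gcongr
      _ = _ := by field_simp
  have b3 : r * W3 ≤ A + B := by
    calc r * W3 ≤ r * (1 / r * A + 1 / r * B) := by gcongr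
      _ = _ := by field_simp
  gcongr ?_ + _ + ?_
  · calc 11 / 10 / r * W1 ≤ 11 / 10 / r * (1 / 4 * r * A + 7 / 4 * r * B) := by gcongr
      _ = _ := by field_simp
  · have hπ := Real.pi_pos
    have e : 3 / (4 * Real.pi ^ 2 * (11 / 10 / r + 11 / 10)) * (W2 + D / (8 * Real.pi) + 9 * W3)
        = 3 / (4 * Real.pi ^ 2 * (11 / 10)) * ((r * W2 + r * (D / (8 * Real.pi)) + 9 * (r * W3)) / (1 + r)) := by
      field_simp
    rw [e]
    gcongr
    have hD : 0 ≤ D / (8 * Real.pi) := by positivity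
    rw [div_le_iff₀ (by positivity)]
    have : 0 ≤ r * W2 := by positivity
    have : 0 ≤ r * W3 := by positivity
    nlinarith

end HFrame
end Heis

namespace Heis
open SchwartzMap
open scoped LineDeriv ContDiff FourierTransform ComplexConjugate

variable {E : Type} [NormedAddCommGroup E] [NormedSpace ℝ E]
variable {ι : Type} [Fintype ι] [DecidableEq ι]

namespace HFrame
variable (H : HFrame E ι)
variable [FiniteDimensional ℝ E] [MeasureSpace E] [BorelSpace E]
  [(volume : Measure E).IsAddHaarMeasure]

lemma N_mul_normSq_eq (h : 𝓢(E × ℝ, ℂ)) (p : E × ℝ) :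
    H.N p.1 * ‖h p‖ ^ 2 = ∑ i, ‖H.cV i h p‖ ^ 2 := by
  simp [N, mul_pow, Finset.sum_mul]

lemma continuous_N_mul (h : 𝓢(E × ℝ, ℂ)) : Continuous fun p => H.N p.1 * ‖h p‖ ^ 2 := by
  simp only [N_mul_normSq_eq]
  exact continuous_finsetSum _ fun i _ => (H.cV i h).continuous.norm.pow 2

lemma integrable_N_mul (h : 𝓢(E × ℝ, ℂ)) : Integrable fun p => H.N p.1 * ‖h p‖ ^ 2 := by
  simp only [N_mul_normSq_eq]
  exact integrable_finsetSum _ fun i _ => integrable_normSq _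

/-- The mass in the half-space `0 < l`. -/
def halfM (h : 𝓢(E × ℝ, ℂ)) : ℝ := ∫ p in {p : E × ℝ | 0 < p.2}, ‖h p‖ ^ 2

/-- The second moment in the half-space `0 < l`. -/
def halfZ (h : 𝓢(E × ℝ, ℂ)) : ℝ := ∫ p in {p : E × ℝ | 0 < p.2}, H.N p.1 * ‖h p‖ ^ 2

lemma halfM_nonneg (h : 𝓢(E × ℝ, ℂ)) : 0 ≤ halfM h := integral_nonneg fun _ => sq_nonneg _

lemma halfZ_nonneg (h : 𝓢(E × ℝ, ℂ)) : 0 ≤ H.halfZ h :=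
  integral_nonneg fun _ => mul_nonneg (H.N_nonneg _) (sq_nonneg _)

section
variable {k : ℝ → ℝ} (hk : Continuous k) (hs : ∀ s, s ∉ Set.Icc (1 / 4 : ℝ) (7 / 4) → k s = 0)
  (h : 𝓢(E × ℝ, ℂ))
include hk hs

lemma integrable_massK : Integrable fun η => massK k (Real.exp η) h :=
  integrable_dilate_average hk hs (h.continuous.norm.pow 2) (integrable_normSq h)

lemma integral_massK : ∫ η, massK k (Real.exp η) h = (∫ v, k (Real.exp v)) * halfM h :=
  integral_dilate_average hk hs (h.continuous.norm.pow 2) (integrable_normSq h)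

lemma integrable_momentK : Integrable fun η => H.momentK k (Real.exp η) h :=
  integrable_dilate_average hk hs (H.continuous_N_mul h) (H.integrable_N_mul h)

lemma integral_momentK : ∫ η, H.momentK k (Real.exp η) h = (∫ v, k (Real.exp v)) * H.halfZ h :=
  integral_dilate_average hk hs (H.continuous_N_mul h) (H.integrable_N_mul h)

end

/-- A linear combination of localised quantities with the shape of `srcK`. -/
def halfS (h : 𝓢(E × ℝ, ℂ)) : ℝ :=
  halfM h + H.halfZ h + halfM (dT h) / (4 * Real.pi ^ 2)

lemma integrable_srcK (h : 𝓢(E × ℝ, ℂ)) : Integrable fun η => H.srcK (Real.exp η) h := by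
  have a1 := integrable_massK continuous_k₁ (fun _ => k₁_supp) h
  have a2 := integrable_massK continuous_k₂ (fun _ => k₂_supp) h
  have a3 := integrable_massK continuous_k₁ (fun _ => k₁_supp) (dT h)
  have b1 := H.integrable_momentK continuous_k₁ (fun _ => k₁_supp) h
  have b2 := H.integrable_momentK continuous_k₂ (fun _ => k₂_supp) h
  exact ((((a1.const_mul _).add (b1.const_mul _)).const_mul _).add (a1.const_mul _)).add
    ((((a2.add b2).add (a3.div_const _)).add ((a1.add b1).const_mul _)).const_mul _)

lemma integral_srcK (h : 𝓢(E × ℝ, ℂ)) : ∫ η, H.srcK (Real.exp η) h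
    = (∫ v, k₁ (Real.exp v)) * (11 / 10 * (1 / 4 * halfM h + 7 / 4 * H.halfZ h)
        + 11 / 10 / (8 * Real.pi) * halfM h
        + 3 / (4 * Real.pi ^ 2 * (11 / 10)) * (halfM (dT h) / (8 * Real.pi)
          + 9 * (halfM h + H.halfZ h)))
      + (∫ v, k₂ (Real.exp v)) * (3 / (4 * Real.pi ^ 2 * (11 / 10)) * (halfM h + H.halfZ h)) := by
  have a1 := integrable_massK continuous_k₁ (fun _ => k₁_supp) h
  have a2 := integrable_massK continuous_k₂ (fun _ => k₂_supp) h
  have a3 := integrable_massK continuous_k₁ (fun _ => k₁_supp) (dT h)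
  have b1 := H.integrable_momentK continuous_k₁ (fun _ => k₁_supp) h
  have b2 := H.integrable_momentK continuous_k₂ (fun _ => k₂_supp) h
  unfold srcK
  have c1 := (((a1.const_mul (1 / 4)).add (b1.const_mul (7 / 4))).const_mul (11 / 10))
  have c2 := a1.const_mul (11 / 10 / (8 * Real.pi))
  have c2' : Integrable fun η => massK k₂ (Real.exp η) h + H.momentK k₂ (Real.exp η) h := a2.add b2
  have c3 : Integrable fun η => massK k₂ (Real.exp η) h + H.momentK k₂ (Real.exp η) h
      + massK k₁ (Real.exp η) (dT h) / (8 * Real.pi) := c2'.add (a3.div_const (8 * Real.pi))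
  have c4 := (a1.add b1).const_mul 9
  have c5 := (c3.add c4).const_mul (3 / (4 * Real.pi ^ 2 * (11 / 10)))
  have e1 := integral_add (c1.add c2) c5
  simp only [Pi.add_apply] at e1 c1 c2 c4 c5
  rw [e1, integral_add c1 c2, integral_const_mul, integral_add (a1.const_mul _) (b1.const_mul _),
    integral_const_mul, integral_const_mul, integral_const_mul, integral_const_mul,
    integral_add c3 c4, integral_const_mul, integral_add a1 b1, integral_add c2' (a3.div_const _),
    integral_div, integral_add a2 b2,
    integral_massK continuous_k₁ (fun _ => k₁_supp), integral_massK continuous_k₂ (fun _ => k₂_supp),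
    integral_massK continuous_k₁ (fun _ => k₁_supp),
    integral_momentK H continuous_k₁ (fun _ => k₁_supp),
    integral_momentK H continuous_k₂ (fun _ => k₂_supp)]
  ring

lemma integral_srcK_le (h : 𝓢(E × ℝ, ℂ)) : 2 * Real.pi ^ 2 * ∫ η, H.srcK (Real.exp η) h
    ≤ (∫ v, k₁ (Real.exp v)) * (85 * H.halfS h) := by
  rw [integral_srcK]
  have h1 := one_div_twenty_le
  have h2 := integral_k₂_le
  have p1 := Real.pi_gt_d4
  have p2 := Real.pi_lt_d4
  have hA := halfM_nonneg h
  have hB := H.halfZ_nonneg h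
  have hD := halfM_nonneg (dT h)
  unfold halfS
  set m₁ := ∫ v, k₁ (Real.exp v)
  set m₂ := ∫ v, k₂ (Real.exp v)
  set A := halfM h
  set B := H.halfZ h
  set D := halfM (dT h)
  have hm : m₂ ≤ 25 * m₁ := by linarith
  have e : 2 * Real.pi ^ 2 * (m₁ * (11 / 10 * (1 / 4 * A + 7 / 4 * B) + 11 / 10 / (8 * Real.pi) * A
        + 3 / (4 * Real.pi ^ 2 * (11 / 10)) * (D / (8 * Real.pi) + 9 * (A + B)))
      + m₂ * (3 / (4 * Real.pi ^ 2 * (11 / 10)) * (A + B)))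
      = m₁ * (11 / 20 * Real.pi ^ 2 * A + 77 / 20 * Real.pi ^ 2 * B + 11 / 40 * Real.pi * A
        + 15 / (88 * Real.pi) * D + 135 / 11 * (A + B)) + m₂ * (15 / 11 * (A + B)) := by
    field_simp; ring
  rw [e]
  have g1 : m₂ * (15 / 11 * (A + B)) ≤ m₁ * (375 / 11 * (A + B)) := by nlinarith
  have g2 : Real.pi ^ 2 ≤ 9.8697 := by nlinarith
  have g3 : 15 / (88 * Real.pi) * D ≤ 85 * (D / (4 * Real.pi ^ 2)) := by
    rw [div_mul_eq_mul_div, mul_div_assoc', div_le_div_iff₀ (by positivity) (by positivity)]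
    have : 0 ≤ D * Real.pi := by positivity
    nlinarith
  have g4 : 11 / 20 * Real.pi ^ 2 * A ≤ 11 / 20 * 9.8697 * A := by gcongr
  have g5 : 77 / 20 * Real.pi ^ 2 * B ≤ 77 / 20 * 9.8697 * B := by gcongr
  have g6 : 11 / 40 * Real.pi * A ≤ 11 / 40 * 3.1416 * A := by gcongr
  have hm1 : 0 ≤ m₁ := by linarith
  have g7 := mul_le_mul_of_nonneg_left (show 11 / 20 * Real.pi ^ 2 * A + 77 / 20 * Real.pi ^ 2 * B
    + 11 / 40 * Real.pi * A + 15 / (88 * Real.pi) * D + 135 / 11 * (A + B) + 375 / 11 * (A + B)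
      ≤ 85 * (A + B + D / (4 * Real.pi ^ 2)) by linarith) hm1
  linarith

/-- The frequency-side estimate on the half-space of positive frequencies. -/
lemma norm_integral_half_le {σ : ℂ} (hσ : σ.im ≠ 0) {f g q : 𝓢(E × ℝ, ℂ)}
    (hf : H.lapL f + σ • f = g) {C : ℝ} (hC : 0 < C) :
    ‖∫ p in {p : E × ℝ | 0 < p.2}, f p * conj (q p)‖ ≤ 85 * (C * H.halfS g + H.halfS q / C) := by
  have hpt : ∀ η : ℝ, ‖∫ p : E × ℝ, k₁ (p.2 / Real.exp η) • (f p * conj (q p))‖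
      ≤ 2 * Real.pi ^ 2 * (C * H.srcK (Real.exp η) g + H.srcK (Real.exp η) q / C) := by
    intro η
    have hr := Real.exp_pos η
    have hχ := chiR_cutoff hr
    have key := H.norm_integral_solution_mul_conj_le (δ := 1 / 4 * Real.exp η)
      (R₁ := 11 / 10 / Real.exp η) (R₂ := 11 / 10) (by positivity) (by positivity) (by norm_num) hσ
      (H.dT_loc hr hχ g) (H.dT_loc hr hχ q) (H.loc_eq hr hχ hf) hC
    rw [H.integral_loc_mul_conj hr hχ hχ] at key
    have e : ∀ p : E × ℝ, k₁ (p.2 / Real.exp η) • (f p * conj (q p))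
        = ((chiR (Real.exp η) p.2 * chiR (Real.exp η) p.2 : ℝ) : ℂ) * (f p * conj (q p)) := by
      intro p; rw [Complex.real_smul, k₁, sq, chiR]
    simp only [e]
    refine key.trans ?_
    have n1 := H.Nu_loc_le hr g
    have n2 := H.Nu_loc_le hr q
    gcongr
  have h_int := ((H.integrable_srcK g).const_mul C).add ((H.integrable_srcK q).div_const C)
  have hb := norm_integral_le_of_norm_le (h_int.const_mul (2 * Real.pi ^ 2)) (.of_forall hpt)
  have hfq : Continuous fun p : E × ℝ => f p * conj (q p) :=
    f.continuous.mul (Complex.continuous_conj.comp q.continuous)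
  rw [integral_dilate_average continuous_k₁ (fun _ => k₁_supp) hfq (integrable_mul_conj f q),
    norm_smul, integral_const_mul] at hb
  simp only [Pi.add_apply] at hb
  rw [integral_add ((H.integrable_srcK g).const_mul C) ((H.integrable_srcK q).div_const C),
    integral_const_mul, integral_div] at hb
  have h1 := one_div_twenty_le
  have s1 := H.integral_srcK_le g
  have s2 := H.integral_srcK_le q
  set m₁ := ∫ v, k₁ (Real.exp v)
  have hm1 : 0 < m₁ := by linarith
  rw [Real.norm_of_nonneg hm1.le] at hb
  refine le_of_mul_le_mul_left (hb.trans ?_) hm1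
  calc _ = C * (2 * Real.pi ^ 2 * ∫ η, H.srcK (Real.exp η) g)
        + (2 * Real.pi ^ 2 * ∫ η, H.srcK (Real.exp η) q) / C := by ring
    _ ≤ C * (m₁ * (85 * H.halfS g)) + (m₁ * (85 * H.halfS q)) / C := by gcongr
    _ = _ := by ring

end HFrame
end Heis

namespace Heis
open SchwartzMap
open scoped LineDeriv ContDiff FourierTransform ComplexConjugate

variable {E : Type} [NormedAddCommGroup E] [NormedSpace ℝ E]
variable {ι : Type} [Fintype ι] [DecidableEq ι]

namespace HFrame
variable (H : HFrame E ι)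
variable [FiniteDimensional ℝ E] [MeasureSpace E] [BorelSpace E]
  [(volume : Measure E).IsAddHaarMeasure]

/-- The reflection of the last variable. -/
def flipE (E : Type) [NormedAddCommGroup E] [NormedSpace ℝ E] : (E × ℝ) ≃L[ℝ] (E × ℝ) :=
  (ContinuousLinearEquiv.refl ℝ E).prodCongr (ContinuousLinearEquiv.neg ℝ)

lemma flipE_apply (p : E × ℝ) : flipE E p = (p.1, -p.2) := rfl

/-- The pullback of a Schwartz function under the reflection of the last variable. -/
def flipS (h : 𝓢(E × ℝ, ℂ)) : 𝓢(E × ℝ, ℂ) := compCLMOfContinuousLinearEquiv ℂ (flipE E) h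

lemma flipS_apply (h : 𝓢(E × ℝ, ℂ)) (z : E) (l : ℝ) : flipS h (z, l) = h (z, -l) := rfl

lemma fderiv_flipS (h : 𝓢(E × ℝ, ℂ)) (p v : E × ℝ) :
    fderiv ℝ (flipS h) p v = fderiv ℝ h (flipE E p) (flipE E v) := by
  have h1 := h.differentiableAt (x := flipE E p)
  have : ⇑(flipS h) = h ∘ (flipE E) := rfl
  rw [this, (h1.hasFDerivAt.comp p (flipE E).hasFDerivAt).fderiv]; rfl

lemma dT_flipS (h : 𝓢(E × ℝ, ℂ)) : dT (flipS h) = - flipS (dT h) := by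
  ext ⟨z, l⟩
  rw [dT_apply, fderiv_flipS, neg_apply, flipS_apply, dT_apply, ← map_neg]
  simp [flipE_apply]

lemma dZ_flipS (v : E) (h : 𝓢(E × ℝ, ℂ)) : dZ v (flipS h) = flipS (dZ v h) := by
  ext ⟨z, l⟩
  rw [dZ_apply, fderiv_flipS, flipS_apply, dZ_apply]
  simp [flipE_apply]

/-- The frame with the opposite orientation. -/
@[simps] def flip : HFrame E ι where
  e := H.e
  c := H.c
  b i := - H.b i
  c_e := H.c_e
  sum_ce := H.sum_ce
  sum_cb z := by simpa using H.sum_cb z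
  i₀ := H.i₀
  j₀ := H.j₀
  ne := H.ne
  comm := by
    rw [← H.comm, abs_sub_comm]
    congr 1; simp; ring
  card := H.card

lemma XL_flip (i : ι) (h : 𝓢(E × ℝ, ℂ)) : H.flip.XL i (flipS h) = flipS (H.XL i h) := by
  ext ⟨z, l⟩
  rw [XL_apply, flipS_apply, flipS_apply, XL_apply, flip_e, dZ_flipS, flipS_apply]
  simp

lemma lapL_flip (h : 𝓢(E × ℝ, ℂ)) : H.flip.lapL (flipS h) = flipS (H.lapL h) := by
  simp only [lapL, XL_flip]
  exact (map_sum (compCLMOfContinuousLinearEquiv ℂ (flipE E)) _ _).symm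

lemma measurePreserving_flip :
    MeasurePreserving (fun p : E × ℝ => (p.1, -p.2)) volume volume :=
  (MeasurePreserving.id volume).prod (Measure.measurePreserving_neg (volume : Measure ℝ))

lemma setIntegral_add_flip {G : Type*} [NormedAddCommGroup G] [NormedSpace ℝ G]
    {Q : E × ℝ → G} (hQ : Integrable Q) :
    (∫ p in {p : E × ℝ | 0 < p.2}, Q p) + ∫ p in {p : E × ℝ | 0 < p.2}, Q (p.1, -p.2)
      = ∫ p, Q p := by
  have hm : MeasurableEmbedding fun p : E × ℝ => (p.1, -p.2) :=
    (flipE E).toHomeomorph.measurableEmbedding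
  have hs : MeasurableSet {p : E × ℝ | 0 < p.2} := measurableSet_lt measurable_const measurable_snd
  have hs' : {p : E × ℝ | 0 < p.2} = (fun p : E × ℝ => (p.1, -p.2)) ⁻¹' {p | p.2 < 0} := by
    ext p; simp
  have h1 : ∫ p in {p : E × ℝ | 0 < p.2}, Q (p.1, -p.2) = ∫ p in {p : E × ℝ | p.2 < 0}, Q p := by
    rw [hs']
    exact measurePreserving_flip.setIntegral_preimage_emb hm Q {p | p.2 < 0}
  have h0 : (volume : Measure (E × ℝ)) {p | p.2 = 0} = 0 := by
    have : {p : E × ℝ | p.2 = 0} = Set.univ ×ˢ {0} := by ext p; simp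
    rw [this, Measure.volume_eq_prod, Measure.prod_prod]
    simp
  have h2 : ({p : E × ℝ | p.2 < 0} : Set (E × ℝ)) =ᵐ[volume] {p : E × ℝ | 0 < p.2}ᶜ := by
    have : ∀ᵐ p : E × ℝ, ¬ p.2 = 0 := by rw [ae_iff]; simpa using h0
    filter_upwards [this] with p hp
    simp only [eq_iff_iff]
    change p.2 < 0 ↔ ¬ (0 < p.2)
    rw [not_lt]
    exact ⟨le_of_lt, fun h => lt_of_le_of_ne h hp⟩
  rw [h1, setIntegral_congr_set h2]
  exact integral_add_compl hs hQ

lemma halfM_add_flip (h : 𝓢(E × ℝ, ℂ)) : halfM h + halfM (flipS h) = lV h :=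
  setIntegral_add_flip (integrable_normSq h)

/-- The weighted norm of the data. -/
def fullS (h : 𝓢(E × ℝ, ℂ)) : ℝ := lV h + ∑ i, lV (H.cV i h) + lV (mulForm 1 (tForm E) h)

lemma integrable_weight_mul (h : 𝓢(E × ℝ, ℂ)) :
    Integrable fun p => (1 + H.N p.1 + p.2 ^ 2) * ‖h p‖ ^ 2 := by
  refine (((integrable_normSq h).add (H.integrable_N_mul h)).add
    (integrable_normSq (mulForm 1 (tForm E) h))).congr (.of_forall fun p => ?_)
  simp [tForm, mul_pow]; ring

lemma fullS_eq (h : 𝓢(E × ℝ, ℂ)) :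
    H.fullS h = ∫ p, (1 + H.N p.1 + p.2 ^ 2) * ‖h p‖ ^ 2 := by
  have e : ∀ p, (1 + H.N p.1 + p.2 ^ 2) * ‖h p‖ ^ 2
      = ‖h p‖ ^ 2 + ∑ i, ‖H.cV i h p‖ ^ 2 + ‖mulForm 1 (tForm E) h p‖ ^ 2 := by
    intro p
    rw [← N_mul_normSq_eq]
    simp [tForm, mul_pow]; ring
  simp only [e]
  have i2 : Integrable fun p => ∑ i, ‖H.cV i h p‖ ^ 2 :=
    integrable_finsetSum _ fun i _ => integrable_normSq _
  have i12 : Integrable fun p => ‖h p‖ ^ 2 + ∑ i, ‖H.cV i h p‖ ^ 2 := (integrable_normSq h).add i2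
  rw [integral_add i12 (integrable_normSq _), integral_add (integrable_normSq h) i2,
    integral_finsetSum _ fun i _ => integrable_normSq _]
  rfl

lemma halfS_add_flip (h : 𝓢(E × ℝ, ℂ)) :
    H.halfS (pF h) + H.flip.halfS (flipS (pF h)) = H.fullS h := by
  have e1 : halfM (dT (flipS (pF h))) = halfM (flipS (dT (pF h))) := by
    simp [dT_flipS, halfM]
  have e2 : H.halfZ (pF h) + H.flip.halfZ (flipS (pF h)) = ∑ i, lV (H.cV i h) := by
    refine (setIntegral_add_flip (H.integrable_N_mul (pF h))).trans ?_
    simp only [N_mul_normSq_eq, ← pF_cV]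
    rw [integral_finsetSum _ fun i _ => integrable_normSq _]
    simp only [integral_pF_normSq, lV]
  have e3 : lV (dT (pF h)) / (4 * Real.pi ^ 2) = lV (mulForm 1 (tForm E) h) := by
    rw [lineDeriv_t_pF, lV_pF, lV, lV, ← integral_div]
    congr 1; ext p
    have := Real.pi_pos
    simp [mul_pow]
    field_simp
    ring
  rw [fullS, ← e2, ← e3, ← lV_pF, ← halfM_add_flip (pF h), ← halfM_add_flip (dT (pF h)), halfS,
    halfS, e1]
  ring

/-- The field `X_i = ∂_{e i} + 2 b i ∂_t`. -/
def XT (i : ι) (h : 𝓢(E × ℝ, ℂ)) : 𝓢(E × ℝ, ℂ) :=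
  dZ (H.e i) h + mulForm 2 ((H.b i).comp (ContinuousLinearMap.fst ℝ E ℝ)) (dT h)

lemma pF_XT (i : ι) (h : 𝓢(E × ℝ, ℂ)) : pF (H.XT i h) = H.XL i (pF h) := by
  rw [XT, pF_add, pF_mulForm_fst, ← lineDeriv_pF, pF_lineDeriv_t]
  ext ⟨z, l⟩
  rw [XL_apply]
  simp [tForm]; ring

/-- The sublaplacian. -/
def lapT (h : 𝓢(E × ℝ, ℂ)) : 𝓢(E × ℝ, ℂ) := ∑ i, H.XT i (H.XT i h)

lemma pF_lapT (h : 𝓢(E × ℝ, ℂ)) : pF (H.lapT h) = H.lapL (pF h) := by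
  simp only [lapT, lapL, pF_sum, pF_XT]

lemma weight_growth : Function.HasTemperateGrowth
    fun p : E × ℝ => (((1 + H.N p.1 + p.2 ^ 2)⁻¹ : ℝ) : ℂ) := by
  have := Function.Complex.hasTemperateGrowth_ofReal.comp (hasTemperateGrowth_inv_add_sum_sq
    (Sum.elim (fun i => (H.c i).comp (ContinuousLinearMap.fst ℝ E ℝ)) fun _ : Unit => tForm E)
    one_pos)
  simpa [Function.comp_def, tForm, N, add_assoc] using this

/-- The pairing of a solution with a test function, in terms of the weighted norms. -/
lemma norm_integral_mul_conj_le_fullS {σ : ℂ} (hσ : σ.im ≠ 0) {f g : 𝓢(E × ℝ, ℂ)}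
    (hf : H.lapT f + σ • f = g) (q : 𝓢(E × ℝ, ℂ)) {C : ℝ} (hC : 0 < C) :
    ‖∫ p, f p * conj (q p)‖ ≤ 85 * (C * H.fullS g + H.fullS q / C) := by
  have h1 : H.lapL (pF f) + σ • pF f = pF g := by rw [← hf, pF_add, pF_smul, pF_lapT]
  have h2 : H.flip.lapL (flipS (pF f)) + σ • flipS (pF f) = flipS (pF g) := by
    rw [lapL_flip, ← h1]; rfl
  rw [← integral_pF_mul_conj, ← setIntegral_add_flip (integrable_mul_conj _ _)]
  refine (norm_add_le _ _).trans ?_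
  have k1 := H.norm_integral_half_le hσ h1 (q := pF q) hC
  have k2 := H.flip.norm_integral_half_le hσ h2 (q := flipS (pF q)) hC
  refine (add_le_add k1 k2).trans_eq ?_
  rw [← halfS_add_flip, ← halfS_add_flip]
  ring

/-- The resolvent estimate in an abstract frame. -/
theorem weighted_resolvent_estimate {σ : ℂ} (hσ : σ.im ≠ 0) {f g : 𝓢(E × ℝ, ℂ)}
    (hf : H.lapT f + σ • f = g) :
    ∫ p, (1 + H.N p.1 + p.2 ^ 2)⁻¹ * ‖f p‖ ^ 2
      ≤ 170 ^ 2 * ∫ p, (1 + H.N p.1 + p.2 ^ 2) * ‖g p‖ ^ 2 := by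
  set q : 𝓢(E × ℝ, ℂ) :=
    smulLeftCLM ℂ (fun p : E × ℝ => (((1 + H.N p.1 + p.2 ^ 2)⁻¹ : ℝ) : ℂ)) f with hq
  have hqa : ∀ p, q p = ((1 + H.N p.1 + p.2 ^ 2)⁻¹ : ℝ) * f p := fun p => by
    rw [hq, smulLeftCLM_apply_apply H.weight_growth, smul_eq_mul]
  have h1 := H.norm_integral_mul_conj_le_fullS hσ hf q (C := 170) (by norm_num)
  have e1 : ∀ p, f p * conj (q p) = (((1 + H.N p.1 + p.2 ^ 2)⁻¹ * ‖f p‖ ^ 2 : ℝ) : ℂ) := fun p => by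
    rw [hqa, map_mul, Complex.conj_ofReal, mul_left_comm, Complex.mul_conj,
      Complex.normSq_eq_norm_sq]
    push_cast; rfl
  have e2 : H.fullS q = ∫ p, (1 + H.N p.1 + p.2 ^ 2)⁻¹ * ‖f p‖ ^ 2 := by
    rw [fullS_eq]
    congr 1; ext p
    have : 0 < 1 + H.N p.1 + p.2 ^ 2 := by have := H.N_nonneg p.1; positivity
    rw [hqa, norm_mul, Complex.norm_real, Real.norm_of_nonneg (by positivity)]
    field_simp
  simp only [e1] at h1
  rw [integral_complex_ofReal, Complex.norm_real, e2, fullS_eq] at h1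
  have h2 := (le_abs_self _).trans h1
  linarith

lemma integrable_inv_weight_mul (f : 𝓢(E × ℝ, ℂ)) :
    Integrable fun p => (1 + H.N p.1 + p.2 ^ 2)⁻¹ * ‖f p‖ ^ 2 := by
  refine (integrable_mul_conj f (smulLeftCLM ℂ
    (fun p : E × ℝ => (((1 + H.N p.1 + p.2 ^ 2)⁻¹ : ℝ) : ℂ)) f)).re.congr (.of_forall fun p => ?_)
  simp only [smulLeftCLM_apply_apply H.weight_growth, smul_eq_mul, map_mul, Complex.conj_ofReal,
    mul_left_comm, Complex.mul_conj, Complex.normSq_eq_norm_sq, RCLike.re_to_complex,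
    ← Complex.ofReal_mul, Complex.ofReal_re]

end HFrame
end Heis

namespace Heis
open SchwartzMap
open scoped LineDeriv ContDiff FourierTransform ComplexConjugate

/-- The horizontal space. -/
abbrev Hz (d : ℕ) : Type := EuclideanSpace ℝ (Fin d) × EuclideanSpace ℝ (Fin d)

instance (d : ℕ) : (volume : Measure (Hz d)).IsAddHaarMeasure :=
  inferInstanceAs ((volume : Measure (EuclideanSpace ℝ (Fin d))).prod volume).IsAddHaarMeasure

/-- The first coordinates. -/
def coordX (d : ℕ) (j : Fin d) : Hz d →L[ℝ] ℝ :=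
  (EuclideanSpace.proj j).comp (ContinuousLinearMap.fst ℝ _ _)

/-- The second coordinates. -/
def coordY (d : ℕ) (j : Fin d) : Hz d →L[ℝ] ℝ :=
  (EuclideanSpace.proj j).comp (ContinuousLinearMap.snd ℝ _ _)

@[simp] lemma coordX_apply (d : ℕ) (j : Fin d) (z : Hz d) : coordX d j z = z.1 j := rfl

@[simp] lemma coordY_apply (d : ℕ) (j : Fin d) (z : Hz d) : coordY d j z = z.2 j := rfl

lemma sum_smul_single (d : ℕ) (x : EuclideanSpace ℝ (Fin d)) :
    ∑ j, x j • EuclideanSpace.single j (1 : ℝ) = x := by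
  ext i
  simp [Finset.sum_apply, Pi.single_apply]

/-- The frame of the Heisenberg group. -/
def heisFrame (d : ℕ) (hd : 2 ≤ d) : HFrame (Hz d) (Fin d ⊕ Fin d) where
  e := Sum.elim (fun j => (EuclideanSpace.single j 1, 0)) fun j => (0, EuclideanSpace.single j 1)
  c := Sum.elim (coordX d) (coordY d)
  b := Sum.elim (coordY d) fun j => - coordX d j
  c_e i j := by
    rcases i with i | i <;> rcases j with j | j <;> simp
  sum_ce z := by
    obtain ⟨x, y⟩ := z
    simp only [Fintype.sum_sum_type, Sum.elim_inl, Sum.elim_inr, coordX_apply, coordY_apply,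
      Prod.smul_mk, smul_zero]
    rw [Prod.ext_iff]
    simp [Prod.fst_sum, Prod.snd_sum, sum_smul_single]
  sum_cb z := by
    simp [Fintype.sum_sum_type, mul_comm]
  i₀ := Sum.inl ⟨0, by omega⟩
  j₀ := Sum.inr ⟨0, by omega⟩
  ne := by simp
  comm := by simp; norm_num
  card := by simp; omega

/-- The identification of the two models. -/
def assocE (d : ℕ) : (Hz d × ℝ) ≃L[ℝ] Hd d := ContinuousLinearEquiv.prodAssoc ℝ _ _ _

lemma assocE_apply (d : ℕ) (p : Hz d × ℝ) : assocE d p = (p.1.1, p.1.2, p.2) := rfl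

lemma measurePreserving_assocE (d : ℕ) : MeasurePreserving (assocE d) volume volume :=
  volume_preserving_prodAssoc

lemma measurableEmbedding_assocE (d : ℕ) : MeasurableEmbedding (assocE d) :=
  (assocE d).toHomeomorph.measurableEmbedding

section
variable {d : ℕ} (hd : 2 ≤ d)

lemma XT_inl {G : 𝓢(Hz d × ℝ, ℂ)} {φ : Hd d → ℂ} (hG : ⇑G = φ ∘ assocE d) (j : Fin d) :
    ⇑((heisFrame d hd).XT (Sum.inl j) G) = Xop d j φ ∘ assocE d := by
  ext p
  have h1 : fderiv ℝ G p = (fderiv ℝ φ (assocE d p)).comp (assocE d : Hz d × ℝ →L[ℝ] Hd d) := by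
    rw [hG]; exact (assocE d).comp_right_fderiv
  have h2 : ((EuclideanSpace.single j 1, 0, 2 * (assocE d p).2.1 j) : Hd d)
      = assocE d ((EuclideanSpace.single j 1, 0), 0) + (2 * p.1.2 j) • assocE d (0, 1) := by
    simp [assocE_apply]
  simp only [HFrame.XT, add_apply, dZ_apply, mulForm_apply, dT_apply, h1, Function.comp_apply, Xop]
  rw [h2, map_add, map_smul]
  simp [heisFrame]

lemma XT_inr {G : 𝓢(Hz d × ℝ, ℂ)} {φ : Hd d → ℂ} (hG : ⇑G = φ ∘ assocE d) (j : Fin d) :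
    ⇑((heisFrame d hd).XT (Sum.inr j) G) = Yop d j φ ∘ assocE d := by
  ext p
  have h1 : fderiv ℝ G p = (fderiv ℝ φ (assocE d p)).comp (assocE d : Hz d × ℝ →L[ℝ] Hd d) := by
    rw [hG]; exact (assocE d).comp_right_fderiv
  have h2 : ((0, EuclideanSpace.single j 1, -(2 * (assocE d p).1 j)) : Hd d)
      = assocE d ((0, EuclideanSpace.single j 1), 0) + (-(2 * p.1.1 j)) • assocE d (0, 1) := by
    simp [assocE_apply]
  simp only [HFrame.XT, add_apply, dZ_apply, mulForm_apply, dT_apply, h1, Function.comp_apply, Yop]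
  rw [h2, map_add, map_smul]
  simp [heisFrame]

lemma lapT_eq {G : 𝓢(Hz d × ℝ, ℂ)} {φ : Hd d → ℂ} (hG : ⇑G = φ ∘ assocE d) (p : Hz d × ℝ) :
    (heisFrame d hd).lapT G p = subLap d φ (assocE d p) := by
  rw [HFrame.lapT, sum_apply, Fintype.sum_sum_type, subLap, Finset.sum_add_distrib]
  congr 1 <;> refine Finset.sum_congr rfl fun j _ => ?_
  · exact congrFun (XT_inl hd (XT_inl hd hG j) j) p
  · exact congrFun (XT_inr hd (XT_inr hd hG j) j) p

lemma weight_eq (p : Hz d × ℝ) :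
    1 + zsq d (assocE d p) + (assocE d p).2.2 ^ 2 = 1 + (heisFrame d hd).N p.1 + p.2 ^ 2 := by
  simp [zsq, HFrame.N, assocE_apply, heisFrame, EuclideanSpace.real_norm_sq_eq]

end

lemma hundred_seventy_le {d : ℕ} (hd : 2 ≤ d) :
    170 ≤ 2 * (3 * Real.exp (1 / 4) - 2) ^ 2 * (5 + 4 / ((d : ℝ) - 1)) ^ 2 := by
  have h1 : (1.284 : ℝ) ≤ Real.exp (1 / 4) := by
    have := Real.sum_le_exp_of_nonneg (x := 1 / 4) (by norm_num) 5
    refine le_trans ?_ this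
    norm_num [Finset.sum_range_succ, Nat.factorial]
  have h2 : (5 : ℝ) ≤ 5 + 4 / ((d : ℝ) - 1) := by
    have : (2 : ℝ) ≤ d := by exact_mod_cast hd
    have : 0 ≤ 4 / ((d : ℝ) - 1) := div_nonneg (by norm_num) (by linarith)
    linarith
  calc (170 : ℝ) ≤ 2 * (3 * 1.284 - 2) ^ 2 * 5 ^ 2 := by norm_num
    _ ≤ _ := by gcongr

end Heis
/-- Uniform resolvent estimate `‖w₂ (L - σ)⁻¹ w₂‖ ≤ C_d`,
`L = -Δ_H`, in a priori form on Schwartz functions, with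
`C_d = 2 (3 e^{1/4} - 2)² (5 + 4/(d-1))²`, for `d ≥ 2`. -/
theorem uniform_resolvent_estimate_w2 (d : ℕ) (hd : 2 ≤ d)
    (σ : ℂ) (hσ : σ.im ≠ 0) (f : SchwartzMap (Hd d) ℂ) :
    ∫⁻ p, ENNReal.ofReal (w2 d p ^ 2 * ‖f p‖ ^ 2) ≤
      ENNReal.ofReal ((2 * (3 * Real.exp (1/4) - 2) ^ 2 * (5 + 4 / ((d : ℝ) - 1)) ^ 2) ^ 2) *
        ∫⁻ p, ENNReal.ofReal (((w2 d p)⁻¹) ^ 2 * ‖subLap d (⇑f) p + σ * f p‖ ^ 2) := by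
  set H := Heis.heisFrame d hd
  set F : SchwartzMap (Heis.Hz d × ℝ) ℂ :=
    SchwartzMap.compCLMOfContinuousLinearEquiv ℂ (Heis.assocE d) f
  have hF : ⇑F = f ∘ Heis.assocE d := rfl
  have hpos : ∀ p : Heis.Hz d × ℝ, 0 < 1 + H.N p.1 + p.2 ^ 2 := fun p => by
    have := H.N_nonneg p.1; positivity
  have hw : ∀ p, w2 d (Heis.assocE d p) ^ 2 = (1 + H.N p.1 + p.2 ^ 2)⁻¹ := fun p => by
    rw [w2, inv_pow, Heis.weight_eq hd, Real.sq_sqrt (hpos p).le]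
  have hmp := Heis.measurePreserving_assocE d
  have hme := Heis.measurableEmbedding_assocE d
  rw [← hmp.lintegral_comp_emb hme, ← hmp.lintegral_comp_emb hme]
  simp only [inv_pow, hw, inv_inv, ← Heis.lapT_eq hd hF]
  change ∫⁻ p, ENNReal.ofReal ((1 + H.N p.1 + p.2 ^ 2)⁻¹ * ‖F p‖ ^ 2) ≤ _ * ∫⁻ p,
    ENNReal.ofReal ((1 + H.N p.1 + p.2 ^ 2) * ‖(H.lapT F + σ • F) p‖ ^ 2)
  rw [← ofReal_integral_eq_lintegral_ofReal (H.integrable_inv_weight_mul F)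
      (.of_forall fun p => by have := hpos p; positivity),
    ← ofReal_integral_eq_lintegral_ofReal (H.integrable_weight_mul (H.lapT F + σ • F))
      (.of_forall fun p => by have := hpos p; positivity),
    ← ENNReal.ofReal_mul (sq_nonneg _)]
  refine ENNReal.ofReal_le_ofReal ((H.weighted_resolvent_estimate hσ rfl).trans ?_)
  have := Heis.hundred_seventy_le hd
  have h0 : 0 ≤ ∫ p, (1 + H.N p.1 + p.2 ^ 2) * ‖(H.lapT F + σ • F) p‖ ^ 2 :=
    integral_nonneg fun p => by have := hpos p; positivity
  gcongr
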